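/- arXiv:2206.13308 — 3 statements merged into one kernel-verified Lean document; each statement's English description precedes it below -/
import Mathlib

section
/- Let n > 4 and let G = A(Δ_n). Let G_0 be the quotient of G by the normal closure of the cycle commutator cc(a_1, …, a_n), let σ_0 : G_0 → Sym(n) be the homomorphism induced by a_i ↦ (i, i+1) for 1 ≤ i ≤ n−1 and a_n ↦ (1, n), and let H_0 ≤ G_0 be the preimage under σ_0 of the setwise stabiliser in Sym(n) of {1, 2}. Then H_0/[H_0,H_0] ≅ ℤ/2ℤ ⊕ ℤ^3. -/
/- Scaffolding: braid/commuting predicates, ordered products, cycle and twisted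
cycle commutators, and the Artin groups of the diagrams `Δ_n`, `Δ_{t,n}`, `D_n`
(generators numbered `1, …, n` as in the paper, realized on the index type `Fin n`). -/

namespace ArtinPaper

open scoped commutatorElement

/-- `BR u v` : `u` and `v` braid, i.e. `u v u = v u v`. -/
def BR {G : Type*} [Group G] (u v : G) : Prop := u * v * u = v * u * v

/-- `CM u v` : `u` and `v` commute, i.e. `u v = v u`. -/
def CM {G : Type*} [Group G] (u v : G) : Prop := u * v = v * u

/-- `mulIcc y a b = y a * y (a+1) * ⋯ * y b` (equal to `1` when `a > b`). -/
def mulIcc {M : Type*} [Monoid M] (y : ℕ → M) (a b : ℕ) : M :=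
  ((List.range (b + 1 - a)).map fun i => y (a + i)).prod

/-- The cycle commutator
`cc(y₁,…,yₙ) = [y₁, y₂ ⋯ y_{n-1} yₙ y_{n-1}⁻¹ ⋯ y₂⁻¹]`. -/
def cc {G : Type*} [Group G] (y : ℕ → G) (n : ℕ) : G :=
  ⁅y 1, mulIcc y 2 (n - 1) * y n * (mulIcc y 2 (n - 1))⁻¹⁆

/-- The `t`-twisted cycle commutator
`tc_t(y₁,…,yₙ) = [y₁, y₂⁻¹ ⋯ y_{t+1}⁻¹ y_{t+2} ⋯ y_{n-1} yₙ y_{n-1}⁻¹ ⋯ y_{t+2}⁻¹ y_{t+1} ⋯ y₂]`.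
(The twisted cycle commutator `tc(y₁,y₂,y₃,y₄)` is `tc y 4 1`.) -/
def tc {G : Type*} [Group G] (y : ℕ → G) (n t : ℕ) : G :=
  ⁅y 1, mulIcc (fun i => (y i)⁻¹) 2 (t + 1) *
      (mulIcc y (t + 2) (n - 1) * y n * (mulIcc y (t + 2) (n - 1))⁻¹) *
      (mulIcc (fun i => (y i)⁻¹) 2 (t + 1))⁻¹⁆

/-- The `i`-th generator (numbered `1, …, n`) of the free group on `Fin n`. -/
def gen (n i : ℕ) : FreeGroup (Fin n) :=
  if h : 0 < n then FreeGroup.of ⟨(i - 1) % n, Nat.mod_lt _ h⟩ else 1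

/-- The braid relator `u v u (v u v)⁻¹`. -/
def braidRel {G : Type*} [Group G] (u v : G) : G := u * v * u * (v * u * v)⁻¹

/-- Artin-type relations on generators `1, …, n` determined by an edge predicate `E`:
generators joined by an edge braid, all other pairs of generators commute. -/
def relsOf (n : ℕ) (E : ℕ → ℕ → Prop) : Set (FreeGroup (Fin n)) :=
  { w | ∃ i j, 1 ≤ i ∧ i < j ∧ j ≤ n ∧
      ((E i j ∧ w = braidRel (gen n i) (gen n j)) ∨
       (¬ E i j ∧ w = ⁅gen n i, gen n j⁆)) }

/-- Edges of the `n`-cycle `Δ_n`: `{i, i+1}` for `1 ≤ i ≤ n-1`, and `{1, n}`. -/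
def cycEdge (n i j : ℕ) : Prop := (1 ≤ i ∧ i + 1 ≤ n ∧ j = i + 1) ∨ (i = 1 ∧ j = n)

/-- Defining relations of the Artin group `A(Δ_n)` of the `n`-cycle. -/
def cycleRels (n : ℕ) : Set (FreeGroup (Fin n)) := relsOf n (cycEdge n)

/-- Edges of the diagram `Δ_{t,n}`, where `r = n - 3 - t` and the generators are
`b_1, …, b_{4+r}` (vertices `1, …, 4+r`) and `c_{5+r}, …, c_n` (vertices `5+r, …, n`):
the braiding pairs are `{b_1,b_2}, {b_2,b_3}, {b_3,b_1}, {b_4,b_1}, {b_1,b_5}`,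
`{b_i,b_{i+1}}` for `5 ≤ i ≤ 3+r`, `{b_3,c_{5+r}}`, and `{c_i,c_{i+1}}` for
`5+r ≤ i ≤ n-1`. -/
def deltaEdge (n t i j : ℕ) : Prop :=
  (i = 1 ∧ j = 2) ∨ (i = 2 ∧ j = 3) ∨ (i = 1 ∧ j = 3) ∨ (i = 1 ∧ j = 4) ∨
  (i = 1 ∧ j = 5 ∧ 5 ≤ 4 + (n - 3 - t)) ∨
  (5 ≤ i ∧ i + 1 ≤ 4 + (n - 3 - t) ∧ j = i + 1) ∨
  (i = 3 ∧ j = 5 + (n - 3 - t) ∧ 5 + (n - 3 - t) ≤ n) ∨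
  (5 + (n - 3 - t) ≤ i ∧ i + 1 ≤ n ∧ j = i + 1)

/-- Defining relations of the Artin group `A(Δ_{t,n})`. -/
def deltaRels (n t : ℕ) : Set (FreeGroup (Fin n)) := relsOf n (deltaEdge n t)

/-- Edges of the Coxeter diagram `D_n`: `{1,3}, {2,3}`, and `{i, i+1}` for
`3 ≤ i ≤ n-1` (in particular `1` and `2` are not joined, so `x_1 x_2 = x_2 x_1`). -/
def dEdge (n i j : ℕ) : Prop :=
  (i = 1 ∧ j = 3) ∨ (i = 2 ∧ j = 3) ∨ (3 ≤ i ∧ i + 1 ≤ n ∧ j = i + 1)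

/-- Defining relations of the Artin group `A(D_n)` of type `D_n`. -/
def dRels (n : ℕ) : Set (FreeGroup (Fin n)) := relsOf n (dEdge n)

/-- The Artin group `A(D_n)` of type `D_n`. -/
abbrev ArtinD (n : ℕ) := PresentedGroup (dRels n)

/-- `G_{n,t}`: the quotient of `A(Δ_n)` by the normal closure of the `t`-twisted
cycle commutator `tc_t(a_1, …, a_n)`. -/
abbrev Gnt (n t : ℕ) := PresentedGroup (cycleRels n ∪ {tc (gen n) n t})

/-- `Q_{n,t}`: the quotient of `A(Δ_{t,n})` by the normal closure of the twisted
cycle commutator `tc(b_1, b_2, b_3, b_4)`. -/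
abbrev Qnt (n t : ℕ) := PresentedGroup (deltaRels n t ∪ {tc (gen n) 4 1})

section Words

variable {G : Type*} [Group G] {s : ℕ → G} {m : ℕ}

/-- The elements `s 0, …, s (m - 1)` satisfy the Artin relations of type `A_m`. -/
structure BraidChain (s : ℕ → G) (m : ℕ) : Prop where
  braid : ∀ i, i + 1 < m → BR (s i) (s (i + 1))
  comm : ∀ i j, i + 2 ≤ j → j < m → Commute (s i) (s j)

/-- The descending word `s (a + k - 1) ⋯ s (a + 1) s a`. -/
def desc (s : ℕ → G) (a : ℕ) : ℕ → G
  | 0 => 1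
  | k + 1 => s (a + k) * desc s a k

theorem mulIcc_one_zero (s : ℕ → G) : mulIcc s 1 0 = 1 := by simp [mulIcc]

theorem mulIcc_one_succ (s : ℕ → G) (k : ℕ) :
    mulIcc s 1 (k + 1) = mulIcc s 1 k * s (k + 1) := by
  simp [mulIcc, List.range_succ, Nat.add_comm]

theorem map_mulIcc {K : Type*} [Group K] (f : G →* K) (y : ℕ → G) (a b : ℕ) :
    f (mulIcc y a b) = mulIcc (fun i => f (y i)) a b := by
  simp [mulIcc, map_list_prod, Function.comp_def]

theorem mulIcc_shift (y : ℕ → G) (a b : ℕ) :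
    mulIcc y (a + 1) (b + 1) = mulIcc (fun i => y (i + 1)) a b := by
  simp only [mulIcc, Nat.add_right_comm _ 1]
  simp [show b + 1 + 1 - (a + 1) = b + 1 - a by omega]

theorem BR.conj {u v : G} (h : BR u v) (g : G) : BR (g * u * g⁻¹) (g * v * g⁻¹) := by
  unfold BR at *
  calc g * u * g⁻¹ * (g * v * g⁻¹) * (g * u * g⁻¹) = g * (u * v * u) * g⁻¹ := by group
    _ = g * (v * u * v) * g⁻¹ := by rw [h]
    _ = _ := by group

theorem BR.symm {u v : G} (h : BR u v) : BR v u := Eq.symm h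

theorem BR.conj_iff {u v : G} (g : G) : BR (g * u * g⁻¹) (g * v * g⁻¹) ↔ BR u v := by
  refine ⟨fun h => ?_, fun h => h.conj g⟩
  have := h.conj g⁻¹
  simpa [mul_assoc] using this

theorem BR.conj_eq {u v : G} (h : BR u v) : u * v * u⁻¹ = v⁻¹ * u * v := by
  unfold BR at h
  rw [mul_inv_eq_iff_eq_mul, mul_assoc, mul_assoc, eq_inv_mul_iff_mul_eq, ← mul_assoc, ← mul_assoc,
    h]

theorem BR.eq_conj {u v : G} (h : BR u v) : v = u * v * u * (u * v)⁻¹ := by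
  unfold BR at h
  rw [h]; group

theorem commute_conj_iff {u v : G} (g : G) :
    Commute (g * u * g⁻¹) (g * v * g⁻¹) ↔ Commute u v :=
  ⟨fun h => by simpa [mul_assoc] using (Commute.conj_iff g⁻¹).2 h, fun h => (Commute.conj_iff g).2 h⟩

namespace BraidChain

theorem commute_mulIcc (h : BraidChain s m) {k j : ℕ} (hk : k + 2 ≤ j) (hj : j < m) :
    Commute (mulIcc s 1 k) (s j) := by
  induction k with
  | zero => rw [mulIcc_one_zero]; exact Commute.one_left _
  | succ k ih =>
    rw [mulIcc_one_succ]
    exact (ih (by omega)).mul_left (h.comm _ _ (by omega) hj)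

theorem mulIcc_mul (h : BraidChain s m) {k j : ℕ} (hj : 1 ≤ j) (hjk : j < k) (hk : k < m) :
    mulIcc s 1 k * s j = s (j + 1) * mulIcc s 1 k := by
  induction k with
  | zero => omega
  | succ k ih =>
    rcases Nat.lt_or_ge j k with hj' | hj'
    · rw [mulIcc_one_succ, mul_assoc, ← (h.comm j (k + 1) (by omega) hk).eq, ← mul_assoc,
        ih hj' (by omega), mul_assoc]
    · obtain rfl : j = k := by omega
      obtain ⟨k, rfl⟩ : ∃ k, j = k + 1 := ⟨j - 1, by omega⟩
      have hb : s (k + 1) * s (k + 2) * s (k + 1) = s (k + 2) * s (k + 1) * s (k + 2) :=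
        h.braid (k + 1) hk
      have hc := (h.commute_mulIcc (k := k) (j := k + 2) le_rfl hk).eq
      rw [mulIcc_one_succ, mulIcc_one_succ]
      calc mulIcc s 1 k * s (k + 1) * s (k + 2) * s (k + 1)
          = mulIcc s 1 k * (s (k + 1) * s (k + 2) * s (k + 1)) := by group
        _ = mulIcc s 1 k * s (k + 2) * (s (k + 1) * s (k + 2)) := by rw [hb]; group
        _ = _ := by rw [hc]; group

theorem mul_mulIcc_mulIcc (h : BraidChain s m) {k : ℕ} (hk : k + 1 < m) :
    s 1 * (mulIcc s 1 (k + 1) * mulIcc s 1 k) = mulIcc s 1 (k + 1) * mulIcc s 1 k * s (k + 1) := by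
  induction k with
  | zero => simp [mulIcc_one_zero, mulIcc_one_succ]
  | succ k ih =>
    have hc := (h.commute_mulIcc (k := k) (j := k + 2) le_rfl hk).eq
    have hb : s (k + 1) * s (k + 2) * s (k + 1) = s (k + 2) * s (k + 1) * s (k + 2) :=
      h.braid (k + 1) hk
    have ih := ih (by omega)
    calc s 1 * (mulIcc s 1 (k + 1 + 1) * mulIcc s 1 (k + 1))
        = s 1 * (mulIcc s 1 (k + 1) * (s (k + 2) * mulIcc s 1 k) * s (k + 1)) := by
          rw [mulIcc_one_succ s (k + 1), mulIcc_one_succ s k]; group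
      _ = s 1 * (mulIcc s 1 (k + 1) * mulIcc s 1 k) * (s (k + 2) * s (k + 1)) := by
          rw [← hc]; group
      _ = mulIcc s 1 (k + 1) * mulIcc s 1 k * (s (k + 1) * s (k + 2) * s (k + 1)) := by
          rw [ih]; group
      _ = mulIcc s 1 (k + 1) * (mulIcc s 1 k * s (k + 2)) * s (k + 1) * s (k + 2) := by
          rw [hb]; group
      _ = mulIcc s 1 (k + 1) * s (k + 2) * (mulIcc s 1 k * s (k + 1)) * s (k + 2) := by
          rw [hc]; group
      _ = _ := by rw [← mulIcc_one_succ, ← mulIcc_one_succ]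

theorem commute_desc (h : BraidChain s m) {a k j : ℕ} (hk : a + k + 1 ≤ j) (hj : j < m) :
    Commute (s j) (desc s a k) := by
  induction k with
  | zero => exact Commute.one_right _
  | succ k ih => exact (h.comm _ _ (by omega) hj).symm.mul_right (ih (by omega))

theorem commute_desc' (h : BraidChain s m) {a k j : ℕ} (hj : j + 2 ≤ a) (hk : a + k ≤ m) :
    Commute (s j) (desc s a k) := by
  induction k with
  | zero => exact Commute.one_right _
  | succ k ih => exact (h.comm _ _ (by omega) (by omega)).mul_right (ih (by omega))

theorem mul_desc (h : BraidChain s m) {a k j : ℕ} (ha : a ≤ j) (hj : j + 1 < a + k)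
    (hk : a + k ≤ m) : s j * desc s a k = desc s a k * s (j + 1) := by
  induction k with
  | zero => omega
  | succ k ih =>
    rcases Nat.lt_or_ge (j + 1) (a + k) with hj' | hj'
    · rw [desc, ← mul_assoc, (h.comm j (a + k) (by omega) (by omega)).eq, mul_assoc,
        ih hj' (by omega), mul_assoc]
    · obtain ⟨k, rfl⟩ : ∃ i, k = i + 1 := ⟨k - 1, by omega⟩
      obtain rfl : j = a + k := by omega
      have hb : s (a + k) * s (a + (k + 1)) * s (a + k) =
        s (a + (k + 1)) * s (a + k) * s (a + (k + 1)) := h.braid (a + k) (by omega)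
      have hc := (h.commute_desc (a := a) (k := k) (j := a + (k + 1)) (by omega) (by omega)).eq
      calc s (a + k) * (s (a + (k + 1)) * (s (a + k) * desc s a k))
          = s (a + (k + 1)) * s (a + k) * (s (a + (k + 1)) * desc s a k) := by
            simp only [← mul_assoc]; rw [hb]
        _ = _ := by rw [hc]; simp only [desc, mul_assoc]; rfl

theorem desc_mul_desc (h : BraidChain s m) {a k : ℕ} (hk : a + k < m) :
    s (a + k) * (desc s a k * desc s (a + 1) k) = desc s a k * desc s (a + 1) k * s a := by
  induction k with
  | zero => simp [desc]
  | succ k ih =>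
    have ih := ih (by omega)
    have e : a + 1 + k = a + (k + 1) := by omega
    have hc := (h.commute_desc (a := a) (k := k) (j := a + (k + 1)) (by omega) (by omega)).eq
    have hb : s (a + k) * s (a + (k + 1)) * s (a + k) =
      s (a + (k + 1)) * s (a + k) * s (a + (k + 1)) := h.braid (a + k) (by omega)
    simp only [desc, e]
    calc s (a + (k + 1)) * (s (a + k) * desc s a k * (s (a + (k + 1)) * desc s (a + 1) k))
        = s (a + (k + 1)) * s (a + k) * (desc s a k * s (a + (k + 1))) * desc s (a + 1) k := by
          simp only [mul_assoc]
      _ = s (a + k) * s (a + (k + 1)) * s (a + k) * desc s a k * desc s (a + 1) k := by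
          rw [← hc, hb]; simp only [mul_assoc]
      _ = s (a + k) * s (a + (k + 1)) * (s (a + k) * (desc s a k * desc s (a + 1) k)) := by
          simp only [mul_assoc]
      _ = s (a + k) * (s (a + (k + 1)) * desc s a k) * desc s (a + 1) k * s a := by
          rw [ih]; simp only [mul_assoc]
      _ = _ := by rw [hc]; simp only [mul_assoc]

end BraidChain

theorem desc_succ' (s : ℕ → G) (a k : ℕ) : desc s a (k + 1) = desc s (a + 1) k * s a := by
  induction k with
  | zero => simp [desc]
  | succ k ih => rw [desc, ih, desc, mul_assoc, show a + 1 + k = a + (k + 1) by omega]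

/-- The Artin relations of type `D_{m+1}` for `s 0, …, s (m - 1)` and `t`, where `s 0` and `t` are
the two vertices interchanged by the diagram automorphism. -/
structure DSystem (s : ℕ → G) (t : G) (m : ℕ) : Prop extends BraidChain s m where
  comm_zero : Commute (s 0) t
  braid_one : BR (s 1) t
  comm_tail : ∀ j, 2 ≤ j → j < m → Commute (s j) t

/-- The relations of the `(m+1)`-cycle and the cycle commutator, for `s 0, …, s (m - 1)` and `a`. -/
structure CycleSystem (s : ℕ → G) (a : G) (m : ℕ) : Prop extends BraidChain s m where
  braid_first : BR (s 0) a
  braid_last : BR (s (m - 1)) a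
  comm_mid : ∀ j, 1 ≤ j → j + 1 < m → Commute (s j) a
  cyc : Commute (s 0) (mulIcc s 1 (m - 1) * a * (mulIcc s 1 (m - 1))⁻¹)

theorem BraidChain.comm_mid_iff (h : BraidChain s m) (hm : 3 ≤ m) (a : G) :
    (∀ j, 1 ≤ j → j + 1 < m → Commute (s j) a) ↔ ∀ j, 2 ≤ j → j < m →
      Commute (s j) (mulIcc s 1 (m - 1) * a * (mulIcc s 1 (m - 1))⁻¹) := by
  have key : ∀ j, 1 ≤ j → j + 1 < m →
      s (j + 1) = mulIcc s 1 (m - 1) * s j * (mulIcc s 1 (m - 1))⁻¹ := fun j h1 h2 => by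
    rw [h.mulIcc_mul h1 (by omega) (by omega)]; group
  constructor
  · intro H j h1 h2
    obtain ⟨j, rfl⟩ : ∃ i, j = i + 1 := ⟨j - 1, by omega⟩
    rw [key j (by omega) h2, commute_conj_iff]
    exact H j (by omega) h2
  · intro H j h1 h2
    rw [← commute_conj_iff (mulIcc s 1 (m - 1)), ← key j h1 h2]
    exact H _ (by omega) h2

theorem BraidChain.braid_last_iff (h : BraidChain s m) (hm : 3 ≤ m) (a : G)
    (ha : ∀ j, 1 ≤ j → j + 1 < m → Commute (s j) a) :
    BR (s (m - 1)) a ↔ BR (s 1) (mulIcc s 1 (m - 1) * a * (mulIcc s 1 (m - 1))⁻¹) := by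
  obtain ⟨k, rfl⟩ : ∃ k, m = k + 2 := ⟨m - 2, by omega⟩
  simp only [show k + 2 - 1 = k + 1 by omega]
  have hv : ∀ i, i ≤ k → Commute (mulIcc s 1 i) a := by
    intro i
    induction i with
    | zero => intro _; rw [mulIcc_one_zero]; exact Commute.one_left _
    | succ i ih =>
      intro hi
      rw [mulIcc_one_succ]
      exact (ih (by omega)).mul_left (ha _ (by omega) (by omega))
  have hv := (hv k le_rfl).eq
  have h1 : s 1 = (mulIcc s 1 (k + 1) * mulIcc s 1 k) * s (k + 1) *
      (mulIcc s 1 (k + 1) * mulIcc s 1 k)⁻¹ := by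
    rw [← h.mul_mulIcc_mulIcc (by omega)]; group
  have h2 : mulIcc s 1 (k + 1) * a * (mulIcc s 1 (k + 1))⁻¹ =
      (mulIcc s 1 (k + 1) * mulIcc s 1 k) * a * (mulIcc s 1 (k + 1) * mulIcc s 1 k)⁻¹ := by
    rw [mul_assoc (mulIcc s 1 (k + 1)) (mulIcc s 1 k) a, hv]; group
  conv_rhs => rw [h1, h2]
  rw [BR.conj_iff]

theorem CycleSystem.dSystem {a : G} (h : CycleSystem s a m) (hm : 3 ≤ m) :
    DSystem s (mulIcc s 1 (m - 1) * a * (mulIcc s 1 (m - 1))⁻¹) m where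
  toBraidChain := h.toBraidChain
  comm_zero := h.cyc
  braid_one := (h.toBraidChain.braid_last_iff hm a h.comm_mid).1 h.braid_last
  comm_tail := (h.toBraidChain.comm_mid_iff hm a).1 h.comm_mid

theorem DSystem.cycleSystem {a : G} (hm : 3 ≤ m)
    (h : DSystem s (mulIcc s 1 (m - 1) * a * (mulIcc s 1 (m - 1))⁻¹) m) : CycleSystem s a m := by
  have hmid := (h.toBraidChain.comm_mid_iff hm a).2 h.comm_tail
  refine ⟨h.toBraidChain, ?_, (h.toBraidChain.braid_last_iff hm a hmid).2 h.braid_one, hmid,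
    h.comm_zero⟩
  have key : ∀ k, k + 1 < m → mulIcc s 1 (k + 1) * s 0 * (mulIcc s 1 (k + 1))⁻¹ =
      s 1 * s 0 * (s 1)⁻¹ := by
    intro k
    induction k with
    | zero => intro _; simp [mulIcc_one_succ, mulIcc_one_zero]
    | succ k ih =>
      intro hk
      rw [← ih (by omega), mulIcc_one_succ s (k + 1)]
      have := (h.comm 0 (k + 2) (by omega) hk).eq
      calc mulIcc s 1 (k + 1) * s (k + 2) * s 0 * (mulIcc s 1 (k + 1) * s (k + 2))⁻¹
          = mulIcc s 1 (k + 1) * (s (k + 2) * s 0) * (s (k + 2))⁻¹ * (mulIcc s 1 (k + 1))⁻¹ := by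
            group
        _ = _ := by rw [← this]; group
  rw [← BR.conj_iff (mulIcc s 1 (m - 1)), show m - 1 = m - 2 + 1 by omega, key _ (by omega),
    ← show m - 1 = m - 2 + 1 by omega, (h.braid 0 (by omega)).symm.conj_eq]
  have h0 : mulIcc s 1 (m - 1) * a * (mulIcc s 1 (m - 1))⁻¹ =
      (s 0)⁻¹ * (mulIcc s 1 (m - 1) * a * (mulIcc s 1 (m - 1))⁻¹) * ((s 0)⁻¹)⁻¹ := by
    rw [inv_inv, mul_assoc (s 0)⁻¹, ← h.comm_zero.eq, inv_mul_cancel_left]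
  rw [h0]
  simpa using h.braid_one.conj (s 0)⁻¹

end Words

section Generation

variable {G : Type*} [Group G] {s : ℕ → G} {m : ℕ}

/-- A braid carrying the first two strands to the positions `p` and `q + 1`. -/
def transv (s : ℕ → G) (p q : ℕ) : G := desc s 0 p * desc s 1 q

theorem desc_mem {L : Subgroup G} (hj : ∀ j, 2 ≤ j → j < m → s j ∈ L) {a k : ℕ} (ha : 2 ≤ a)
    (hk : a + k ≤ m) : desc s a k ∈ L := by
  induction k with
  | zero => exact L.one_mem
  | succ k ih => exact L.mul_mem (hj _ (by omega) (by omega)) (ih (by omega))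

namespace BraidChain

theorem desc_mul_desc_of_lt (h : BraidChain s m) {a k l : ℕ} (hk : k < l) (hl : a + l ≤ m) :
    desc s a k * desc s a l = desc s a l * desc s (a + 1) k := by
  induction k with
  | zero => simp [desc]
  | succ k ih =>
    rw [desc, mul_assoc, ih (by omega), ← mul_assoc, h.mul_desc (by omega) (by omega) hl, desc,
      mul_assoc, show a + k + 1 = a + 1 + k by omega]

theorem sq_mul_desc (h : BraidChain s m) {r : ℕ} (hr : r + 1 < m) :
    s (r + 1) * s (r + 1) * desc s 1 r =
      desc s 1 r * (desc s 2 r * (s 1 * s 1) * (desc s 2 r)⁻¹) := by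
  have key := h.desc_mul_desc (a := 1) (k := r) (by omega)
  rw [Nat.add_comm 1 r, one_add_one_eq_two] at key
  calc s (r + 1) * s (r + 1) * desc s 1 r
      = s (r + 1) * (s (r + 1) * (desc s 1 r * desc s 2 r)) * (desc s 2 r)⁻¹ := by group
    _ = s (r + 1) * (desc s 1 r * desc s 2 r * s 1) * (desc s 2 r)⁻¹ := by rw [key]
    _ = (s (r + 1) * (desc s 1 r * desc s 2 r)) * s 1 * (desc s 2 r)⁻¹ := by group
    _ = _ := by rw [key]; group

theorem sq_mul_transv (h : BraidChain s m) {i q : ℕ} (hi : i < q) (hq : q < m) :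
    s i * s i * transv s i q = transv s i q *
      (desc s 2 i * (s 0 * (s 1 * s 1) * (s 0)⁻¹) * (desc s 2 i)⁻¹) := by
  have hA := h.desc_mul_desc (a := 0) (k := i) (by omega)
  rw [Nat.zero_add, Nat.zero_add] at hA
  have hB := h.desc_mul_desc_of_lt (a := 1) hi (by omega)
  have hb : s 0 * s 1 * s 0 = s 1 * s 0 * s 1 := h.braid 0 (by omega)
  have hC : s 0 * s 0 * desc s 1 q = desc s 1 q * (s 0 * (s 1 * s 1) * (s 0)⁻¹) := by
    obtain ⟨r, rfl⟩ : ∃ r, q = r + 1 := ⟨q - 1, by omega⟩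
    have hF := (h.commute_desc' (a := 2) (k := r) (j := 0) le_rfl (by omega)).eq
    rw [desc_succ']
    calc s 0 * s 0 * (desc s 2 r * s 1) = s 0 * (s 0 * desc s 2 r) * s 1 := by group
      _ = s 0 * (desc s 2 r * s 0) * s 1 := by rw [hF]
      _ = s 0 * desc s 2 r * s 0 * s 1 := by group
      _ = desc s 2 r * s 0 * (s 0 * s 1 * s 0) * (s 0)⁻¹ := by rw [hF]; group
      _ = desc s 2 r * s 0 * (s 1 * s 0 * s 1) * (s 0)⁻¹ := by rw [hb]
      _ = desc s 2 r * (s 0 * s 1 * s 0) * s 1 * (s 0)⁻¹ := by group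
      _ = _ := by rw [hb]; group
  unfold transv
  generalize desc s 0 i = P at *
  generalize desc s 1 i = V at *
  generalize desc s 1 q = Q at *
  change V * Q = Q * desc s 2 i at hB
  generalize desc s 2 i = E at *
  calc s i * s i * (P * Q) = s i * (s i * (P * V)) * V⁻¹ * Q := by group
    _ = s i * (P * V * s 0) * V⁻¹ * Q := by rw [hA]
    _ = s i * (P * V) * s 0 * V⁻¹ * Q := by group
    _ = P * V * s 0 * s 0 * V⁻¹ * (Q * E) * E⁻¹ := by rw [hA]; group
    _ = P * V * (s 0 * s 0 * Q) * E⁻¹ := by rw [← hB]; group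
    _ = P * (V * Q) * (s 0 * (s 1 * s 1) * (s 0)⁻¹) * E⁻¹ := by rw [hC]; group
    _ = _ := by rw [hB]; group

theorem mul_transv (h : BraidChain s m) {L : Subgroup G} (h0 : s 0 ∈ L) (h1 : s 1 * s 1 ∈ L)
    (hj : ∀ j, 2 ≤ j → j < m → s j ∈ L) {i p q : ℕ} (hi : i < m) (hpq : p ≤ q) (hq : q < m) :
    ∃ p' q', p' ≤ q' ∧ q' < m ∧ ∃ l ∈ L, s i * transv s p q = transv s p' q' * l := by
  rcases lt_trichotomy i p with hip | rfl | hip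
  · obtain ⟨p, rfl⟩ : ∃ r, p = r + 1 := ⟨p - 1, by omega⟩
    rcases Nat.lt_or_ge i p with hip' | hip'
    · refine ⟨p + 1, q, hpq, hq, s (i + 2), hj _ (by omega) (by omega), ?_⟩
      rw [transv, ← mul_assoc, h.mul_desc (by omega) (by omega) (by omega), mul_assoc,
        h.mul_desc (by omega) (by omega) (by omega), mul_assoc]
    · obtain rfl : i = p := by omega
      refine ⟨i, q, by omega, hq,
        desc s 2 i * (s 0 * (s 1 * s 1) * (s 0)⁻¹) * (desc s 2 i)⁻¹, ?_, ?_⟩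
      rotate_left
      · rw [← h.sq_mul_transv (by omega) hq]
        simp only [transv, desc, Nat.zero_add, mul_assoc]
      · have hE : desc s 2 i ∈ L := desc_mem hj le_rfl (by omega)
        exact L.mul_mem (L.mul_mem hE (L.mul_mem (L.mul_mem h0 h1) (L.inv_mem h0)))
          (L.inv_mem hE)
  · rcases Nat.eq_or_lt_of_le hpq with rfl | hiq
    · refine ⟨i, i, le_rfl, hq, s 0, h0, ?_⟩
      have := h.desc_mul_desc (a := 0) (k := i) (by omega)
      simpa only [transv, Nat.zero_add] using this
    · refine ⟨i + 1, q, hiq, hq, 1, L.one_mem, ?_⟩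
      simp only [transv, desc, Nat.zero_add, mul_assoc, mul_one]
  · have hc : ∀ j, p < j → j < m → s j * transv s p q = desc s 0 p * (s j * desc s 1 q) :=
      fun j hj hjm => by
        rw [transv, ← mul_assoc, (h.commute_desc (by omega) hjm).eq, mul_assoc]
    rcases lt_trichotomy i q with hiq | rfl | hiq
    · refine ⟨p, q, hpq, hq, s (i + 1), hj _ (by omega) (by omega), ?_⟩
      rw [hc i hip hi, h.mul_desc (by omega) (by omega) (by omega), transv, mul_assoc]
    · obtain ⟨r, rfl⟩ : ∃ r, i = r + 1 := ⟨i - 1, by omega⟩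
      refine ⟨p, r, by omega, by omega, desc s 2 r * (s 1 * s 1) * (desc s 2 r)⁻¹, ?_, ?_⟩
      rotate_left
      · rw [hc _ hip hi, desc, Nat.add_comm 1 r, transv, mul_assoc (desc s 0 p),
          ← h.sq_mul_desc hi]
        simp only [mul_assoc]
      · have hE : desc s 2 r ∈ L := desc_mem hj le_rfl (by omega)
        exact L.mul_mem (L.mul_mem hE h1) (L.inv_mem hE)
    · rcases Nat.eq_or_lt_of_le (Nat.succ_le_of_lt hiq) with rfl | hiq
      · refine ⟨p, q + 1, by omega, hi, 1, L.one_mem, ?_⟩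
        rw [hc _ hip hi, mul_one, transv, desc, Nat.add_comm 1 q]
      · refine ⟨p, q, hpq, hq, s i, hj _ (by omega) hi, ?_⟩
        rw [hc _ hip hi, (h.commute_desc (by omega) hi).eq, transv, mul_assoc]

end BraidChain

theorem commute_desc_of_forall {d : G} {a k : ℕ} (h : ∀ j, a ≤ j → j < a + k → Commute d (s j)) :
    Commute d (desc s a k) := by
  induction k with
  | zero => exact Commute.one_right _
  | succ k ih =>
    exact (h _ (by omega) (by omega)).mul_right (ih fun j h1 h2 => h j h1 (by omega))

theorem BraidChain.mul_transv_of_commute (h : BraidChain s m) {L : Subgroup G} {d : G}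
    (hd0 : Commute d (s 0)) (hdj : ∀ j, 2 ≤ j → j < m → Commute d (s j)) (hd : d ∈ L)
    (hd1 : (s 1)⁻¹ * d * s 1 ∈ L)
    (hd2 : (s 1 * s 0 * s 2 * s 1)⁻¹ * d * (s 1 * s 0 * s 2 * s 1) ∈ L) {p q : ℕ}
    (hpq : p ≤ q) (hq : q < m) : ∃ l ∈ L, d * transv s p q = transv s p q * l := by
  suffices H : (transv s p q)⁻¹ * d * transv s p q ∈ L from ⟨_, H, by group⟩
  have strip : ∀ x y : G, Commute d x → (x * y)⁻¹ * d * (x * y) = y⁻¹ * d * y := fun x y hx => by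
    calc (x * y)⁻¹ * d * (x * y) = y⁻¹ * (x⁻¹ * (d * x)) * y := by group
      _ = _ := by rw [hx.eq]; group
  have hdD : ∀ a k, 2 ≤ a → a + k ≤ m → Commute d (desc s a k) := fun a k ha hk =>
    commute_desc_of_forall fun j h1 h2 => hdj j (by omega) (by omega)
  have hQ : ∀ r, r + 1 < m → (desc s 1 (r + 1))⁻¹ * d * desc s 1 (r + 1) ∈ L := fun r hr => by
    rw [desc_succ', strip _ _ (hdD 2 r le_rfl (by omega))]
    exact hd1
  match p, q with
  | 0, 0 => simpa [transv, desc] using hd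
  | 0, r + 1 => simpa [transv, desc.eq_1] using hQ r hq
  | 1, 0 => omega
  | 1, r + 1 =>
    rw [transv, show desc s 0 1 = s 0 by simp [desc], strip _ _ hd0]
    exact hQ r hq
  | p + 2, 0 => omega
  | p + 2, 1 => omega
  | p + 2, r + 2 =>
    have e : transv s (p + 2) (r + 2) =
        (desc s 2 p * desc s 3 r) * (s 1 * s 0 * s 2 * s 1) := by
      have h1 := (h.commute_desc' (a := 3) (k := r) (j := 1) le_rfl (by omega)).eq
      have h2 := (h.commute_desc' (a := 3) (k := r) (j := 0) (by omega) (by omega)).eq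
      rw [transv, desc_succ', desc_succ', desc_succ', desc_succ']
      calc desc s 2 p * s 1 * s 0 * (desc s 3 r * s 2 * s 1)
          = desc s 2 p * s 1 * (s 0 * desc s 3 r) * s 2 * s 1 := by group
        _ = desc s 2 p * (s 1 * desc s 3 r) * s 0 * s 2 * s 1 := by rw [h2]; group
        _ = _ := by rw [h1]; group
    rw [e, strip _ _ ((hdD 2 p le_rfl (by omega)).mul_right (hdD 3 r (by omega) (by omega)))]
    exact hd2

open Pointwise in
/-- Schreier's argument: if the cosets `transv s p q * L` are permuted by generators, then every
element lies in one of them. -/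
theorem DSystem.exists_transv {t : G} (h : DSystem s t m) (hm : 3 ≤ m)
    (hgen : Subgroup.closure (insert t (s '' Set.Iio m)) = ⊤) {L : Subgroup G}
    (h0 : s 0 ∈ L) (h1 : s 1 * s 1 ∈ L) (hj : ∀ j, 2 ≤ j → j < m → s j ∈ L)
    (hd : t * (s 0)⁻¹ ∈ L) (hd1 : (s 1)⁻¹ * (t * (s 0)⁻¹) * s 1 ∈ L)
    (hd2 : (s 1 * s 0 * s 2 * s 1)⁻¹ * (t * (s 0)⁻¹) * (s 1 * s 0 * s 2 * s 1) ∈ L) (g : G) :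
    ∃ p q, p ≤ q ∧ q < m ∧ (transv s p q)⁻¹ * g ∈ L := by
  set X : Set (G ⧸ L) := {x | ∃ p q, p ≤ q ∧ q < m ∧ ((transv s p q : G) : G ⧸ L) = x} with hX
  have hfin : X.Finite := by
    refine (((Set.finite_Iio m).prod (Set.finite_Iio m)).image
      fun a : ℕ × ℕ => ((transv s a.1 a.2 : G) : G ⧸ L)).subset ?_
    rintro _ ⟨p, q, hpq, hq, rfl⟩
    exact ⟨(p, q), ⟨lt_of_le_of_lt hpq hq, hq⟩, rfl⟩
  have hs : ∀ i < m, s i ∈ MulAction.stabilizer G X := by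
    intro i hi
    rw [MulAction.mem_stabilizer_set_iff_smul_set_subset hfin]
    rintro _ ⟨_, ⟨p, q, hpq, hq, rfl⟩, rfl⟩
    obtain ⟨p', q', h1, h2, l, hl, e⟩ := h.mul_transv h0 h1 hj hi hpq hq
    refine ⟨p', q', h1, h2, ?_⟩
    change ((transv s p' q' : G) : G ⧸ L) = ((s i * transv s p q : G) : G ⧸ L)
    rw [e, QuotientGroup.mk_mul_of_mem _ hl]
  have hdX : t * (s 0)⁻¹ ∈ MulAction.stabilizer G X := by
    rw [MulAction.mem_stabilizer_set_iff_smul_set_subset hfin]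
    rintro _ ⟨_, ⟨p, q, hpq, hq, rfl⟩, rfl⟩
    have c0 : ∀ x, Commute (s 0) x → Commute x t → Commute (t * (s 0)⁻¹) x := fun x hx ht =>
      (ht.symm.mul_left hx.inv_left)
    obtain ⟨l, hl, e⟩ := h.toBraidChain.mul_transv_of_commute
      (c0 _ (Commute.refl _) h.comm_zero)
      (fun j h2 h3 => c0 _ (h.comm 0 j (by omega) h3) (h.comm_tail j h2 h3)) hd hd1 hd2 hpq hq
    refine ⟨p, q, hpq, hq, ?_⟩
    change ((transv s p q : G) : G ⧸ L) = ((t * (s 0)⁻¹ * transv s p q : G) : G ⧸ L)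
    rw [e, QuotientGroup.mk_mul_of_mem _ hl]
  have htop : MulAction.stabilizer G X = ⊤ := by
    rw [eq_top_iff, ← hgen, Subgroup.closure_le]
    rintro x (rfl | ⟨i, hi, rfl⟩)
    · simpa using Subgroup.mul_mem _ hdX (hs 0 (by omega))
    · exact hs i hi
  have hg : g ∈ MulAction.stabilizer G X := htop ▸ Subgroup.mem_top g
  have hmem : ((g : G) : G ⧸ L) ∈ X := by
    rw [← MulAction.mem_stabilizer_iff.1 hg]
    exact ⟨((1 : G) : G ⧸ L), ⟨0, 0, le_rfl, by omega, by simp [transv, desc]⟩, by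
      change ((g * 1 : G) : G ⧸ L) = _; rw [mul_one]⟩
  obtain ⟨p, q, hpq, hq, e⟩ := hmem
  exact ⟨p, q, hpq, hq, QuotientGroup.eq.1 e⟩

end Generation

section Relations

variable {n : ℕ} {K : Type*} [Group K]

theorem mulIcc_congr {y z : ℕ → K} {a b : ℕ} (h : ∀ i, a ≤ i → i ≤ b → y i = z i) :
    mulIcc y a b = mulIcc z a b := by
  unfold mulIcc
  refine congrArg List.prod (List.map_congr_left fun i hi => h _ (by omega) ?_)
  have := List.mem_range.1 hi
  omega

theorem CycleSystem.congr {s s' : ℕ → K} {a : K} {m : ℕ} (h : CycleSystem s a m) (hm : 3 ≤ m)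
    (hs : ∀ i < m, s' i = s i) : CycleSystem s' a m where
  braid i hi := by rw [hs _ hi, hs _ (by omega)]; exact h.braid i hi
  comm i j hij hj := by rw [hs _ hj, hs _ (by omega)]; exact h.comm i j hij hj
  braid_first := by rw [hs _ (by omega)]; exact h.braid_first
  braid_last := by rw [hs _ (by omega)]; exact h.braid_last
  comm_mid j h1 h2 := by rw [hs _ (by omega)]; exact h.comm_mid j h1 h2
  cyc := by
    rw [hs _ (by omega), mulIcc_congr fun i _ hi => hs i (by omega)]
    exact h.cyc

theorem map_braidRel_eq_one {F : Type*} [Group F] (φ : F →* K) (u v : F) :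
    φ (braidRel u v) = 1 ↔ BR (φ u) (φ v) := by
  simp only [braidRel, map_mul, map_inv, mul_inv_eq_one, BR]

theorem map_commutator_eq_one {F : Type*} [Group F] (φ : F →* K) (u v : F) :
    φ ⁅u, v⁆ = 1 ↔ Commute (φ u) (φ v) := by
  rw [map_commutatorElement, commutatorElement_eq_one_iff_commute]

theorem map_cc_eq_one (hn : 5 ≤ n) (φ : FreeGroup (Fin n) →* K) :
    φ (cc (gen n) n) = 1 ↔ Commute (φ (gen n 1))
      (mulIcc (fun i => φ (gen n (i + 1))) 1 (n - 1 - 1) * φ (gen n n) *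
        (mulIcc (fun i => φ (gen n (i + 1))) 1 (n - 1 - 1))⁻¹) := by
  have : mulIcc (fun i => φ (gen n i)) 2 (n - 1) =
      mulIcc (fun i => φ (gen n (i + 1))) 1 (n - 1 - 1) := by
    rw [show n - 1 = n - 1 - 1 + 1 by omega]
    exact mulIcc_shift (fun i => φ (gen n i)) 1 (n - 1 - 1)
  rw [cc, map_commutator_eq_one, map_mul, map_mul, map_inv, map_mulIcc, this]

/-- A homomorphism from the free group kills the relators of `A(Δ_n)` and the cycle commutator iff
the images of the generators form a `CycleSystem`. -/
theorem cycleSystem_iff (hn : 5 ≤ n) (φ : FreeGroup (Fin n) →* K) :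
    CycleSystem (fun i => φ (gen n (i + 1))) (φ (gen n n)) (n - 1) ↔
      ∀ r ∈ cycleRels n ∪ {cc (gen n) n}, φ r = 1 := by
  constructor
  · rintro h r (⟨i, j, hi, hij, hj, ⟨hE, rfl⟩ | ⟨hE, rfl⟩⟩ | rfl)
    · rw [map_braidRel_eq_one]
      rcases hE with ⟨-, -, rfl⟩ | ⟨rfl, rfl⟩
      · obtain ⟨i, rfl⟩ : ∃ k, i = k + 1 := ⟨i - 1, by omega⟩
        rcases Nat.lt_or_ge (i + 2) n with h' | h'
        · exact h.braid i (by omega)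
        · obtain rfl : n = i + 2 := by omega
          exact h.braid_last
      · exact h.braid_first
    · rw [map_commutator_eq_one]
      unfold cycEdge at hE
      push Not at hE
      obtain ⟨i, rfl⟩ : ∃ k, i = k + 1 := ⟨i - 1, by omega⟩
      rcases Nat.lt_or_ge j n with h' | h'
      · obtain ⟨j, rfl⟩ : ∃ k, j = k + 1 := ⟨j - 1, by omega⟩
        exact h.comm i j (by omega) (by omega)
      · obtain rfl : j = n := by omega
        exact h.comm_mid i (by omega) (by omega)
    · exact (map_cc_eq_one hn φ).2 h.cyc
  · intro h
    have hb : ∀ i j, 1 ≤ i → i < j → j ≤ n → cycEdge n i j → BR (φ (gen n i)) (φ (gen n j)) :=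
      fun i j h1 h2 h3 h4 => (map_braidRel_eq_one φ _ _).1
        (h _ (Or.inl ⟨i, j, h1, h2, h3, Or.inl ⟨h4, rfl⟩⟩))
    have hc : ∀ i j, 1 ≤ i → i < j → j ≤ n → ¬ cycEdge n i j →
        Commute (φ (gen n i)) (φ (gen n j)) :=
      fun i j h1 h2 h3 h4 => (map_commutator_eq_one φ _ _).1
        (h _ (Or.inl ⟨i, j, h1, h2, h3, Or.inr ⟨h4, rfl⟩⟩))
    refine ⟨⟨fun i hi => ?_, fun i j hij hj => ?_⟩, ?_, ?_, fun j h1 h2 => ?_, ?_⟩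
    · exact hb _ _ (by omega) (by omega) (by omega) (Or.inl ⟨by omega, by omega, rfl⟩)
    · exact hc _ _ (by omega) (by omega) (by omega) (by unfold cycEdge; omega)
    · exact hb _ _ (by omega) (by omega) (by omega) (Or.inr ⟨rfl, rfl⟩)
    · exact hb _ _ (by omega) (by omega) (by omega) (Or.inl ⟨by omega, by omega, by omega⟩)
    · exact hc _ _ (by omega) (by omega) (by omega) (by unfold cycEdge; omega)
    · exact (map_cc_eq_one hn φ).1 (h _ (Or.inr rfl))

theorem gen_succ {i : ℕ} (hi : i < n) : gen n (i + 1) = FreeGroup.of ⟨i, hi⟩ := by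
  simp [gen, Nat.mod_eq_of_lt hi, show 0 < n by omega]

end Relations

section Colorings

open Equiv

open scoped Pointwise

variable {X C : Type*} [CommGroup C]

/-- Permutations of `X` twisted by `C`-valued functions on the two-colourings of `X`
(a colouring is identified with the set of points of the first colour). -/
abbrev Twisted (X C : Type*) [CommGroup C] :=
  (Set X → C) ⋊[mulAutArrow (G := Perm X) (A := Set X) (M := C)] Perm X

theorem Twisted.mul_left_apply (a b : Twisted X C) (S : Set X) :
    (a * b).left S = a.left S * b.left (a.right⁻¹ • S) := rfl

variable [DecidableEq X]

/-- The transposition of `i` and `j`, with a weight depending on the colours of `i` and `j`. -/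
def crossing (ψ : Prop → Prop → C) (i j : X) : Twisted X C :=
  ⟨fun S => ψ (i ∈ S) (j ∈ S), swap i j⟩

theorem mem_swap_inv_smul (i j k : X) (S : Set X) :
    k ∈ (swap i j)⁻¹ • S ↔ swap i j k ∈ S := by
  rw [Set.mem_smul_set_iff_inv_smul_mem, inv_inv]; rfl

theorem crossing_commute_of_disjoint (ψ ψ' : Prop → Prop → C) {i j k l : X} (hik : i ≠ k)
    (hil : i ≠ l) (hjk : j ≠ k) (hjl : j ≠ l) :
    Commute (crossing ψ i j) (crossing ψ' k l) := by
  refine SemidirectProduct.ext (funext fun S => ?_) ?_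
  · simp only [Twisted.mul_left_apply, crossing, mem_swap_inv_smul,
      swap_apply_of_ne_of_ne hik hil, swap_apply_of_ne_of_ne hjk hjl,
      swap_apply_of_ne_of_ne hik.symm hjk.symm, swap_apply_of_ne_of_ne hil.symm hjl.symm]
    exact mul_comm _ _
  · refine (Perm.Disjoint.commute fun x => ?_)
    by_cases h1 : x = i
    · subst h1; exact Or.inr (swap_apply_of_ne_of_ne hik hil)
    by_cases h2 : x = j
    · subst h2; exact Or.inr (swap_apply_of_ne_of_ne hjk hjl)
    exact Or.inl (swap_apply_of_ne_of_ne h1 h2)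

theorem crossing_commute (ψ ψ' : Prop → Prop → C) (i j : X)
    (h : ∀ P Q, ψ P Q * ψ' Q P = ψ' P Q * ψ Q P) :
    Commute (crossing ψ i j) (crossing ψ' i j) := by
  refine SemidirectProduct.ext (funext fun S => ?_) rfl
  simp only [Twisted.mul_left_apply, crossing, mem_swap_inv_smul, swap_apply_left,
    swap_apply_right]
  exact h _ _

theorem crossing_braid (ψ ψ' : Prop → Prop → C) {i j k : X} (hij : i ≠ j) (hik : i ≠ k)
    (hjk : j ≠ k) (h : ∀ P Q R, ψ P Q * ψ' P R * ψ Q R = ψ' Q R * ψ P R * ψ' P Q) :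
    BR (crossing ψ i j) (crossing ψ' j k) := by
  refine SemidirectProduct.ext (funext fun S => ?_) ?_
  · simp only [Twisted.mul_left_apply, crossing, SemidirectProduct.mul_right, mul_inv_rev,
      mul_smul, mem_swap_inv_smul, swap_apply_left, swap_apply_right,
      swap_apply_of_ne_of_ne hij hik, swap_apply_of_ne_of_ne hik.symm hjk.symm]
    exact h _ _ _
  · simp only [crossing, SemidirectProduct.mul_right]
    ext x
    simp only [Perm.mul_apply, swap_apply_def]
    grind

open Classical in
/-- Weight counting crossings according to the colours of the two strands. -/
noncomputable def weight (α β γ : C) (P Q : Prop) : C :=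
  if P then (if Q then α else γ) else (if Q then 1 else β)

open Classical in
/-- The weight `weight`, changed by `ε` when the two colours differ. -/
noncomputable def weight' (α β γ ε : C) (P Q : Prop) : C :=
  weight α β γ P Q * if P ↔ Q then 1 else ε

/-- Crossings of neighbouring positions in `Fin n`. -/
noncomputable def adjCrossing (n : ℕ) (α β γ : C) (i : ℕ) : Twisted (Fin n) C :=
  if h : i + 1 < n then crossing (weight α β γ) ⟨i, by omega⟩ ⟨i + 1, h⟩ else 1

theorem adjCrossing_dSystem {n : ℕ} (hn : 5 ≤ n) (α β γ ε : C) (hε : ε * ε = 1) :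
    DSystem (adjCrossing n α β γ)
      (crossing (weight' α β γ ε) ⟨0, by omega⟩ ⟨1, by omega⟩) (n - 1) where
  braid i hi := by
    rw [adjCrossing, adjCrossing, dif_pos (by omega), dif_pos (by omega)]
    refine crossing_braid _ _ (by simp) (by simp [Fin.ext_iff]; omega) (by simp)
      fun P Q R => ?_
    ac_rfl
  comm i j hij hj := by
    rw [adjCrossing, adjCrossing, dif_pos (by omega), dif_pos (by omega)]
    refine crossing_commute_of_disjoint _ _ ?_ ?_ ?_ ?_ <;> simp [Fin.ext_iff] <;> omega
  comm_zero := by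
    rw [adjCrossing, dif_pos (by omega)]
    refine crossing_commute _ _ _ _ fun P Q => ?_
    by_cases P <;> by_cases Q <;> simp [weight, weight', *]
    rw [mul_comm]
  braid_one := by
    rw [adjCrossing, dif_pos (by omega)]
    refine (crossing_braid _ _ (by simp) (by simp) (by simp) fun P Q R => ?_).symm
    by_cases P <;> by_cases Q <;> by_cases R <;>
      simp [weight, weight', *, mul_comm, mul_left_comm]
  comm_tail j h2 hj := by
    rw [adjCrossing, dif_pos (by omega)]
    refine crossing_commute_of_disjoint _ _ ?_ ?_ ?_ ?_ <;> simp [Fin.ext_iff] <;> omega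

end Colorings

theorem addEquiv_of_generators {A : Type*} [AddCommGroup A] (F : A →+ ZMod 2 × ℤ × ℤ × ℤ)
    {x y z w : A} (hx : (2 : ℤ) • x = 0) (hFx : F x = (1, 0, 0, 0)) (hFy : F y = (0, 1, 0, 0))
    (hFz : F z = (0, 0, 1, 0)) (hFw : F w = (0, 0, 0, 1))
    (hgen : AddSubgroup.closure {x, y, z, w} = ⊤) :
    Nonempty (A ≃+ (ZMod 2 × ℤ × ℤ × ℤ)) := by
  let e : ZMod 2 →+ A := ZMod.lift 2 ⟨zmultiplesHom A x, by simpa using hx⟩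
  let g : ZMod 2 × ℤ × ℤ × ℤ →+ A := e.coprod ((zmultiplesHom A y).coprod
    ((zmultiplesHom A z).coprod (zmultiplesHom A w)))
  have he : ∀ k : ℤ, e k = k • x := fun k => by simp [e, ZMod.lift_coe]
  have hg : ∀ (k b c d : ℤ), g (k, b, c, d) = k • x + (b • y + (c • z + d • w)) :=
    fun k b c d => by simp [g, he]
  have hinj : Function.Injective g := by
    refine Function.LeftInverse.injective (g := F) ?_
    rintro ⟨a, b, c, d⟩
    obtain ⟨k, rfl⟩ := ZMod.intCast_surjective a
    rw [hg]
    simp [hFx, hFy, hFz, hFw]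
  have hsurj : Function.Surjective g := by
    rw [← AddMonoidHom.range_eq_top, eq_top_iff, ← hgen, AddSubgroup.closure_le]
    rintro v (rfl | rfl | rfl | rfl)
    · exact ⟨((1 : ℤ), 0, 0, 0), by rw [hg]; simp⟩
    · exact ⟨((0 : ℤ), 1, 0, 0), by rw [hg]; simp⟩
    · exact ⟨((0 : ℤ), 0, 1, 0), by rw [hg]; simp⟩
    · exact ⟨((0 : ℤ), 0, 0, 1), by rw [hg]; simp⟩
  exact ⟨(AddEquiv.ofBijective g ⟨hinj, hsurj⟩).symm⟩

section Permutations

open Equiv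

open scoped Pointwise

variable {G : Type*} [Group G] {s : ℕ → G} {n : ℕ}

theorem swap_succ_apply_of_ne {i j : ℕ} (hi : i + 1 < n) (hj : j < n) (h1 : j ≠ i)
    (h2 : j ≠ i + 1) :
    swap (⟨i, by omega⟩ : Fin n) ⟨i + 1, hi⟩ ⟨j, hj⟩ = ⟨j, hj⟩ :=
  swap_apply_of_ne_of_ne (by simpa [Fin.ext_iff] using h1) (by simpa [Fin.ext_iff] using h2)

variable {σ : G →* Perm (Fin n)}

theorem map_desc_apply_start
    (hσ : ∀ i (h : i + 1 < n), σ (s i) = swap ⟨i, by omega⟩ ⟨i + 1, h⟩) {a k : ℕ}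
    (hk : a + k < n) : σ (desc s a k) ⟨a, by omega⟩ = ⟨a + k, hk⟩ := by
  induction k with
  | zero => simp [desc]
  | succ k ih =>
    rw [desc, map_mul, Perm.mul_apply, ih (by omega), hσ _ (by omega), swap_apply_left]
    rfl

theorem map_desc_apply_of_lt
    (hσ : ∀ i (h : i + 1 < n), σ (s i) = swap ⟨i, by omega⟩ ⟨i + 1, h⟩) {a k j : ℕ}
    (hk : a + k < n) (hj : j < n) (hja : j < a) : σ (desc s a k) ⟨j, hj⟩ = ⟨j, hj⟩ := by
  induction k with
  | zero => simp [desc]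
  | succ k ih =>
    rw [desc, map_mul, Perm.mul_apply, ih (by omega), hσ _ (by omega),
      swap_succ_apply_of_ne _ _ (by omega) (by omega)]

theorem map_desc_apply_of_gt
    (hσ : ∀ i (h : i + 1 < n), σ (s i) = swap ⟨i, by omega⟩ ⟨i + 1, h⟩) {a k j : ℕ}
    (hj : j < n) (hja : a + k < j) : σ (desc s a k) ⟨j, hj⟩ = ⟨j, hj⟩ := by
  induction k with
  | zero => simp [desc]
  | succ k ih =>
    rw [desc, map_mul, Perm.mul_apply, ih (by omega), hσ _ (by omega),
      swap_succ_apply_of_ne _ _ (by omega) (by omega)]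

theorem map_transv_apply_zero
    (hσ : ∀ i (h : i + 1 < n), σ (s i) = swap ⟨i, by omega⟩ ⟨i + 1, h⟩) {p q : ℕ} (hpq : p ≤ q)
    (hq : q + 1 < n) : σ (transv s p q) ⟨0, by omega⟩ = ⟨p, by omega⟩ := by
  rw [transv, map_mul, Perm.mul_apply, map_desc_apply_of_lt hσ (by omega) _ one_pos,
    map_desc_apply_start hσ (by omega)]
  simp

theorem map_transv_apply_one
    (hσ : ∀ i (h : i + 1 < n), σ (s i) = swap ⟨i, by omega⟩ ⟨i + 1, h⟩) {p q : ℕ} (hpq : p ≤ q)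
    (hq : q + 1 < n) : σ (transv s p q) ⟨1, by omega⟩ = ⟨q + 1, hq⟩ := by
  rw [transv, map_mul, Perm.mul_apply, map_desc_apply_start hσ (by omega),
    map_desc_apply_of_gt hσ _ (by omega)]
  simp [Nat.add_comm]

theorem map_mulIcc_apply_last
    (hσ : ∀ i (h : i + 1 < n), σ (s i) = swap ⟨i, by omega⟩ ⟨i + 1, h⟩) {k : ℕ}
    (hk : k + 1 < n) : σ (mulIcc s 1 k) ⟨k + 1, hk⟩ = ⟨1, by omega⟩ := by
  induction k with
  | zero => simp [mulIcc_one_zero]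
  | succ k ih =>
    rw [mulIcc_one_succ, map_mul, Perm.mul_apply, hσ _ hk, swap_apply_right, ih]

theorem map_mulIcc_apply_zero
    (hσ : ∀ i (h : i + 1 < n), σ (s i) = swap ⟨i, by omega⟩ ⟨i + 1, h⟩) {k : ℕ}
    (hk : k + 1 < n) : σ (mulIcc s 1 k) ⟨0, by omega⟩ = ⟨0, by omega⟩ := by
  induction k with
  | zero => simp [mulIcc_one_zero]
  | succ k ih =>
    rw [mulIcc_one_succ, map_mul, Perm.mul_apply, hσ _ hk,
      swap_succ_apply_of_ne _ _ (by omega) (by omega), ih (by omega)]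

theorem map_mulIcc_conj
    (hσ : ∀ i (h : i + 1 < n), σ (s i) = swap ⟨i, by omega⟩ ⟨i + 1, h⟩) (hn : 5 ≤ n) {a : G}
    (ha : σ a = swap ⟨n - 1, by omega⟩ ⟨0, by omega⟩) :
    σ (mulIcc s 1 (n - 1 - 1) * a * (mulIcc s 1 (n - 1 - 1))⁻¹) = σ (s 0) := by
  have h1 := map_mulIcc_apply_last hσ (k := n - 1 - 1) (by omega)
  simp only [show n - 1 - 1 + 1 = n - 1 by omega] at h1
  rw [map_mul, map_mul, map_inv, ha, hσ 0 (by omega), ← swap_apply_apply, h1,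
    map_mulIcc_apply_zero hσ (by omega), swap_comm]

theorem mem_stabilizer_pair {X : Type*} (g : Perm X) (x y : X) :
    g ∈ MulAction.stabilizer (Perm X) ({x, y} : Set X) ↔ ({g x, g y} : Set X) = {x, y} := by
  rw [MulAction.mem_stabilizer_iff, ← Set.image_smul, Set.image_pair]
  rfl

theorem DSystem.exists_mem_ker_conj {K : Type*} [Group K] {m : ℕ} {t : G} (h : DSystem s t m)
    (hm : 3 ≤ m) {ρ : G →* K} (ht : ρ t = ρ (s 0)) : ∃ k ∈ ρ.ker, t = k * s 0 * k⁻¹ := by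
  refine ⟨(t * s 1)⁻¹ * (s 0 * s 1), ?_, ?_⟩
  · rw [MonoidHom.mem_ker, map_mul, map_inv, map_mul, map_mul, ht, inv_mul_cancel]
  · have h1 := h.braid_one.symm.eq_conj
    have h2 := (h.braid 0 (by omega)).eq_conj
    rw [zero_add] at h2
    have h3 : (t * s 1) * t * (t * s 1)⁻¹ = s 0 * s 1 * s 0 * (s 0 * s 1)⁻¹ := by
      rw [← h1, ← h2]
    calc t = (t * s 1)⁻¹ * ((t * s 1) * t * (t * s 1)⁻¹) * (t * s 1) := by group
      _ = _ := by rw [h3]; group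

/-- The preimage of the setwise stabilizer of the first two points is generated modulo
commutators by four elements. -/
theorem DSystem.comap_stabilizer_le
    (hσ : ∀ i (h : i + 1 < n), σ (s i) = swap ⟨i, by omega⟩ ⟨i + 1, h⟩) {t : G} (hn : 5 ≤ n)
    (h : DSystem s t (n - 1))
    (hgen : Subgroup.closure (insert t (s '' Set.Iio (n - 1))) = ⊤) (ht : σ t = σ (s 0))
    {H L : Subgroup G}
    (hH : H = (MulAction.stabilizer (Perm (Fin n))
      ({⟨0, by omega⟩, ⟨1, by omega⟩} : Set (Fin n))).comap σ)
    (hLH : L ≤ H) (hcomm : ∀ x ∈ H, ∀ y ∈ H, ⁅x, y⁆ ∈ L) (h0 : s 0 ∈ L) (h1 : s 1 * s 1 ∈ L)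
    (h2 : s 2 ∈ L) (hd1 : (s 1)⁻¹ * (t * (s 0)⁻¹) * s 1 ∈ L) : H ≤ L := by
  have hmem : ∀ g, g ∈ H ↔ ({σ g ⟨0, by omega⟩, σ g ⟨1, by omega⟩} : Set (Fin n)) =
      {⟨0, by omega⟩, ⟨1, by omega⟩} := fun g => by
    rw [hH, Subgroup.mem_comap, mem_stabilizer_pair]
  have hker : σ.ker ≤ H := by rw [hH]; exact MonoidHom.ker_le_comap σ _
  have hsH : ∀ j, 2 ≤ j → j + 1 < n → s j ∈ H := fun j h2 hj => by
    rw [hmem, hσ j hj, swap_succ_apply_of_ne _ _ (by omega) (by omega),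
      swap_succ_apply_of_ne _ _ (by omega) (by omega)]
  have hj : ∀ j, 2 ≤ j → j < n - 1 → s j ∈ L := by
    intro j h2j
    induction j, h2j using Nat.le_induction with
    | base => exact fun _ => h2
    | succ j hj2 ih =>
      intro hj
      have hb : s j * s (j + 1) * s j = s (j + 1) * s j * s (j + 1) := h.braid j hj
      have key : s (j + 1) = ⁅s j * s (j + 1), s j⁆ * s j := by
        rw [commutatorElement_def, hb]; group
      have hsj := hsH j hj2 (by omega)
      rw [key]
      exact L.mul_mem (hcomm _ (H.mul_mem hsj (hsH _ (by omega) (by omega))) _ hsj)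
        (ih (by omega))
  obtain ⟨k, hk, htk⟩ := h.exists_mem_ker_conj (by omega) ht
  have hconj : ∀ g, g⁻¹ * s 0 * g ∈ H → g⁻¹ * (t * (s 0)⁻¹) * g ∈ L := fun g hg => by
    have : g⁻¹ * (t * (s 0)⁻¹) * g = ⁅g⁻¹ * k * g, g⁻¹ * s 0 * g⁆ := by
      rw [htk, commutatorElement_def]; group
    rw [this]
    refine hcomm _ (hker ?_) _ hg
    simpa using σ.normal_ker.conj_mem k hk g⁻¹
  have hd : t * (s 0)⁻¹ ∈ L := by simpa using hconj 1 (by simpa using hLH h0)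
  have hd2 := hconj (s 1 * s 0 * s 2 * s 1) (by
    have hb0 : s 0 * s 1 * s 0 = s 1 * s 0 * s 1 := h.braid 0 (by omega)
    have hb1 : s 1 * s 2 * s 1 = s 2 * s 1 * s 2 := h.braid 1 (by omega)
    have : s 0 * (s 1 * s 0 * s 2 * s 1) = s 1 * s 0 * s 2 * s 1 * s 2 := by
      calc s 0 * (s 1 * s 0 * s 2 * s 1) = s 0 * s 1 * s 0 * (s 2 * s 1) := by group
        _ = s 1 * s 0 * (s 1 * s 2 * s 1) := by rw [hb0]; group
        _ = _ := by rw [hb1]; group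
    rw [mul_assoc, this, inv_mul_cancel_left]
    exact hsH 2 le_rfl (by omega))
  intro g hg
  obtain ⟨p, q, hpq, hq, hL⟩ := h.exists_transv (by omega) hgen h0 h1 hj hd hd1 hd2 g
  have hT : transv s p q ∈ H := by
    simpa using H.mul_mem hg (H.inv_mem (hLH hL))
  rw [hmem, map_transv_apply_zero hσ hpq (by omega), map_transv_apply_one hσ hpq (by omega)] at hT
  have hq0 : (⟨q + 1, by omega⟩ : Fin n) ∈ ({⟨0, by omega⟩, ⟨1, by omega⟩} : Set (Fin n)) := by
    rw [← hT]; simp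
  obtain rfl : q = 0 := by simpa [Fin.ext_iff] using hq0
  obtain rfl : p = 0 := by omega
  simpa [transv, desc] using hL

end Permutations

section Evaluation

open Equiv

open scoped Pointwise

variable {G C : Type*} [Group G] [CommGroup C] {n : ℕ}

/-- The value of a lift `Ψ` at the colouring `S`, a homomorphism on the preimage of the
stabilizer of `S`. -/
def evalAt {X : Type*} (Ψ : G →* Twisted X C) {σ : G →* Perm X}
    (hΨ : ∀ g, (Ψ g).right = σ g) (S : Set X) :
    (MulAction.stabilizer (Perm X) S).comap σ →* C where
  toFun h := (Ψ h).left S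
  map_one' := by simp
  map_mul' a b := by
    have : (σ a)⁻¹ • S = S := MulAction.mem_stabilizer_iff.1 (Subgroup.inv_mem _ a.2)
    rw [Subgroup.coe_mul, map_mul, Twisted.mul_left_apply, hΨ, this]

theorem adjCrossing_left (α β γ : C) {i : ℕ} (hi : i + 1 < n) (S : Set (Fin n)) :
    (adjCrossing n α β γ i).left S =
      weight α β γ ((⟨i, by omega⟩ : Fin n) ∈ S) (⟨i + 1, hi⟩ ∈ S) := by
  rw [adjCrossing, dif_pos hi]; rfl

theorem adjCrossing_right (α β γ : C) {i : ℕ} (hi : i + 1 < n) :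
    (adjCrossing n α β γ i).right = swap ⟨i, by omega⟩ ⟨i + 1, hi⟩ := by
  rw [adjCrossing, dif_pos hi]; rfl

theorem sq_adjCrossing_left (α β γ : C) (hn : 5 ≤ n) :
    (adjCrossing n α β γ 1 * adjCrossing n α β γ 1).left {⟨0, by omega⟩, ⟨1, by omega⟩} = γ := by
  rw [Twisted.mul_left_apply, adjCrossing_left _ _ _ (by omega), adjCrossing_left _ _ _ (by omega),
    adjCrossing_right _ _ _ (by omega)]
  simp only [mem_swap_inv_smul, swap_apply_left, swap_apply_right]
  simp [weight]

theorem crossing_mul_inv_conj_left (α β γ ε : C) (hn : 5 ≤ n) :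
    ((adjCrossing n α β γ 1)⁻¹ * (crossing (X := Fin n) (weight' α β γ ε) ⟨0, by omega⟩ ⟨1, by omega⟩ *
      (adjCrossing n α β γ 0)⁻¹) * adjCrossing n α β γ 1).left
      ({⟨0, by omega⟩, ⟨1, by omega⟩} : Set (Fin n)) = ε := by
  set S₀ : Set (Fin n) := {⟨0, by omega⟩, ⟨1, by omega⟩}
  set u := adjCrossing n α β γ 1
  set v := adjCrossing n α β γ 0
  set t : Twisted (Fin n) C := crossing (weight' α β γ ε) ⟨0, by omega⟩ ⟨1, by omega⟩
  have htv : t.right = v.right := (adjCrossing_right α β γ (by omega)).symm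
  have hd : (t * v⁻¹).right = 1 := by
    rw [SemidirectProduct.mul_right, SemidirectProduct.inv_right, htv, mul_inv_cancel]
  have h2 := inv_mul_cancel_right t v
  generalize t * v⁻¹ = d at hd h2 ⊢
  have h1 : u * (u⁻¹ * d * u) = d * u := by group
  generalize u⁻¹ * d * u = e at h1 ⊢
  replace h1 := congrArg (fun x => x.left (u.right • S₀)) h1
  replace h2 := congrArg (fun x => x.left (u.right • S₀)) h2
  simp only [Twisted.mul_left_apply, hd, inv_one, one_smul, inv_smul_smul] at h1 h2
  have ht : t.left (u.right • S₀) = v.left (u.right • S₀) * ε := by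
    have h0 : (⟨0, by omega⟩ : Fin n) ∈ u.right • S₀ := by
      rw [Set.mem_smul_set_iff_inv_smul_mem, adjCrossing_right _ _ _ (by omega), swap_inv,
        Perm.smul_def, swap_succ_apply_of_ne _ _ (by omega) (by omega)]
      simp [S₀]
    have h1 : (⟨1, by omega⟩ : Fin n) ∉ u.right • S₀ := by
      rw [Set.mem_smul_set_iff_inv_smul_mem, adjCrossing_right _ _ _ (by omega), swap_inv,
        Perm.smul_def, swap_apply_left]
      simp [S₀]
    rw [adjCrossing_left _ _ _ (by omega)]
    simp [t, crossing, weight', h0, h1]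
  rw [ht, mul_comm] at h2
  rw [mul_left_cancel h2, mul_comm] at h1
  exact mul_right_cancel h1

end Evaluation

section Abelianization

open Equiv

open scoped Pointwise

variable {G : Type*} [Group G] {s : ℕ → G} {n : ℕ} {σ : G →* Perm (Fin n)}

theorem DSystem.nonempty_abelianization_addEquiv
    (hσ : ∀ i (h : i + 1 < n), σ (s i) = swap ⟨i, by omega⟩ ⟨i + 1, h⟩) {t : G} (hn : 5 ≤ n)
    (h : DSystem s t (n - 1))
    (hgen : Subgroup.closure (insert t (s '' Set.Iio (n - 1))) = ⊤) (ht : σ t = σ (s 0))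
    {α β γ ε : Multiplicative (ZMod 2 × ℤ × ℤ × ℤ)} (hα : α.toAdd = (0, 1, 0, 0))
    (hβ : β.toAdd = (0, 0, 1, 0)) (hγ : γ.toAdd = (0, 0, 0, 1)) (hε : ε.toAdd = (1, 0, 0, 0))
    (Ψ : G →* Twisted (Fin n) (Multiplicative (ZMod 2 × ℤ × ℤ × ℤ)))
    (hΨ : ∀ g, (Ψ g).right = σ g) (hΨs : ∀ i, i + 1 < n → Ψ (s i) = adjCrossing n α β γ i)
    (hΨt : Ψ t = crossing (weight' α β γ ε) ⟨0, by omega⟩ ⟨1, by omega⟩)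
    {H : Subgroup G} (hH : H = (MulAction.stabilizer (Perm (Fin n))
      ({⟨0, by omega⟩, ⟨1, by omega⟩} : Set (Fin n))).comap σ) :
    Nonempty (Additive (Abelianization H) ≃+ (ZMod 2 × ℤ × ℤ × ℤ)) := by
  obtain ⟨f, hfa⟩ : ∃ f : H →* Multiplicative (ZMod 2 × ℤ × ℤ × ℤ), ∀ g (hg : g ∈ H),
      f ⟨g, hg⟩ = (Ψ g).left {⟨0, by omega⟩, ⟨1, by omega⟩} := by
    subst hH
    exact ⟨evalAt Ψ hΨ _, fun _ _ => rfl⟩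
  have hker : σ.ker ≤ H := by rw [hH]; exact MonoidHom.ker_le_comap σ _
  have h0H : s 0 ∈ H := by
    rw [hH, Subgroup.mem_comap, mem_stabilizer_pair, hσ 0 (by omega), swap_apply_left,
      swap_apply_right, Set.pair_comm]
  have h2H : s 2 ∈ H := by
    rw [hH, Subgroup.mem_comap, mem_stabilizer_pair, hσ 2 (by omega),
      swap_succ_apply_of_ne _ _ (by omega) (by omega),
      swap_succ_apply_of_ne _ _ (by omega) (by omega)]
  have h1H : s 1 * s 1 ∈ H := hker (by
    rw [MonoidHom.mem_ker, map_mul, hσ 1 (by omega), swap_mul_self])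
  have hdH : (s 1)⁻¹ * (t * (s 0)⁻¹) * s 1 ∈ H := hker (by
    have : t * (s 0)⁻¹ ∈ σ.ker := by
      rw [MonoidHom.mem_ker, map_mul, map_inv, ht, mul_inv_cancel]
    simpa using σ.normal_ker.conj_mem _ this (s 1)⁻¹)
  have hsq : Abelianization.of (⟨_, hdH⟩ : H) ^ 2 = 1 := by
    obtain ⟨k, hk, htk⟩ := h.exists_mem_ker_conj (by omega) ht
    have hk' : (s 1)⁻¹ * k * s 1 ∈ H := hker (by
      simpa using σ.normal_ker.conj_mem k hk (s 1)⁻¹)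
    have hs' : (s 1)⁻¹ * (s 0 * s 0) * s 1 ∈ H := hker (by
      have : s 0 * s 0 ∈ σ.ker := by
        rw [MonoidHom.mem_ker, map_mul, hσ 0 (by omega), swap_mul_self]
      simpa using σ.normal_ker.conj_mem _ this (s 1)⁻¹)
    have : (⟨_, hdH⟩ : H) ^ 2 = ⁅(⟨_, hk'⟩ : H), ⟨_, hs'⟩⁆ := by
      apply Subtype.ext
      have htt : t * t = k * (s 0 * s 0) * k⁻¹ := by
        nth_rw 1 [htk]; nth_rw 1 [htk]; group
      calc ((s 1)⁻¹ * (t * (s 0)⁻¹) * s 1) ^ 2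
          = (s 1)⁻¹ * (t * ((s 0)⁻¹ * t) * (s 0)⁻¹) * s 1 := by rw [sq]; group
        _ = (s 1)⁻¹ * (t * t * ((s 0)⁻¹ * (s 0)⁻¹)) * s 1 := by
          rw [h.comm_zero.inv_left.eq]; group
        _ = ⁅(s 1)⁻¹ * k * s 1, (s 1)⁻¹ * (s 0 * s 0) * s 1⁆ := by
          rw [htt, commutatorElement_def]; group
    rw [← map_pow, this, map_commutatorElement, commutatorElement_eq_one_iff_mul_comm, mul_comm]
  refine addEquiv_of_generators (Abelianization.lift f).toAdditiveLeft
    (x := Additive.ofMul (Abelianization.of ⟨_, hdH⟩))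
    (y := Additive.ofMul (Abelianization.of ⟨_, h0H⟩))
    (z := Additive.ofMul (Abelianization.of ⟨_, h2H⟩))
    (w := Additive.ofMul (Abelianization.of ⟨_, h1H⟩)) ?_ ?_ ?_ ?_ ?_ ?_
  · exact congrArg Additive.ofMul ((zpow_ofNat _ 2).trans hsq)
  · change (Abelianization.lift f _).toAdd = _
    rw [toMul_ofMul, Abelianization.lift_apply_of, hfa, map_mul, map_mul, map_inv, map_mul, map_inv, hΨt,
      hΨs 0 (by omega), hΨs 1 (by omega), crossing_mul_inv_conj_left _ _ _ _ hn, hε]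
  · change (Abelianization.lift f _).toAdd = _
    rw [toMul_ofMul, Abelianization.lift_apply_of, hfa, hΨs 0 (by omega), adjCrossing_left _ _ _ (by omega)]
    simp [weight, hα]
  · change (Abelianization.lift f _).toAdd = _
    rw [toMul_ofMul, Abelianization.lift_apply_of, hfa, hΨs 2 (by omega), adjCrossing_left _ _ _ (by omega)]
    simp [weight, hβ]
  · change (Abelianization.lift f _).toAdd = _
    rw [toMul_ofMul, Abelianization.lift_apply_of, hfa, map_mul, hΨs 1 (by omega),
      sq_adjCrossing_left _ _ _ hn, hγ]
  · set P := AddSubgroup.closure (G := Additive (Abelianization H)) _ with hP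
    have hsub := AddSubgroup.subset_closure.trans hP.ge
    have hle := h.comap_stabilizer_le hσ hn hgen ht hH
      (L := ((AddSubgroup.toSubgroup' P).comap Abelianization.of).map (Subgroup.subtype _))
      (Subgroup.map_subtype_le _) (fun x hx y hy => ⟨⁅(⟨x, hx⟩ : H), (⟨y, hy⟩ : H)⁆, ?_, rfl⟩)
      ⟨⟨_, h0H⟩, hsub (Or.inr (Or.inl rfl)), rfl⟩ ⟨⟨_, h1H⟩, hsub (Or.inr (Or.inr (Or.inr rfl))), rfl⟩
      ⟨⟨_, h2H⟩, hsub (Or.inr (Or.inr (Or.inl rfl))), rfl⟩ ⟨⟨_, hdH⟩, hsub (Or.inl rfl), rfl⟩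
    · refine eq_top_iff.2 fun x _ => ?_
      obtain ⟨g, hg⟩ := QuotientGroup.mk_surjective x.toMul
      obtain ⟨g', hg', hgg⟩ := hle g.2
      obtain rfl : g' = g := Subtype.ext hgg
      have : Additive.ofMul (Abelianization.of g') ∈ P := hg'
      rwa [show Abelianization.of g' = x.toMul from hg] at this
    · have : Abelianization.of ⁅(⟨x, hx⟩ : H), (⟨y, hy⟩ : H)⁆ = 1 := by
        rw [map_commutatorElement, commutatorElement_eq_one_iff_mul_comm, mul_comm]
      exact (congrArg (Additive.ofMul · ∈ P) this).mpr P.zero_mem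

end Abelianization

section Main

open Equiv

variable {n : ℕ}

theorem gen_self (hn : 0 < n) : gen n n = FreeGroup.of ⟨n - 1, by omega⟩ := by
  rw [← gen_succ, Nat.sub_add_cancel hn]

theorem closure_cycle_generators (hn : 5 ≤ n) {rels : Set (FreeGroup (Fin n))} :
    Subgroup.closure (insert (PresentedGroup.mk rels (gen n n))
      ((fun i => PresentedGroup.mk rels (gen n (i + 1))) '' Set.Iio (n - 1))) = ⊤ := by
  rw [eq_top_iff, ← PresentedGroup.closure_range_of rels]
  refine Subgroup.closure_mono ?_
  rintro _ ⟨i, rfl⟩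
  have hi := gen_succ i.2
  rcases Nat.lt_or_ge i (n - 1) with h | h
  · exact Or.inr ⟨i, h, by simp only [hi]; rfl⟩
  · refine Or.inl ?_
    rw [gen_self (by omega)]
    exact congrArg PresentedGroup.of (Fin.ext (by simp; omega))

theorem closure_insert_conj {G : Type*} [Group G] {S : Set G} {a w : G}
    (hw : w ∈ Subgroup.closure S) (h : Subgroup.closure (insert a S) = ⊤) :
    Subgroup.closure (insert (w * a * w⁻¹) S) = ⊤ := by
  have hw' := Subgroup.closure_mono (Set.subset_insert (w * a * w⁻¹) S) hw
  rw [eq_top_iff, ← h, Subgroup.closure_le]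
  rintro x (rfl | hx)
  · have := mul_mem (mul_mem (inv_mem hw')
      (Subgroup.subset_closure (Set.mem_insert (w * x * w⁻¹) S))) hw'
    simpa [mul_assoc] using this
  · exact Subgroup.subset_closure (Set.mem_insert_of_mem _ hx)

theorem mulIcc_one_mem {G : Type*} [Group G] {L : Subgroup G} {s : ℕ → G} {k : ℕ}
    (h : ∀ i, i ≤ k → s i ∈ L) : mulIcc s 1 k ∈ L := by
  induction k with
  | zero => rw [mulIcc_one_zero]; exact L.one_mem
  | succ k ih =>
    rw [mulIcc_one_succ]
    exact L.mul_mem (ih fun i hi => h i (by omega)) (h _ le_rfl)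

/-- The homomorphism to `Twisted (Fin n) C` recording the colours of crossings. -/
theorem exists_hom_twisted {C : Type*} [CommGroup C] (hn : 5 ≤ n) (α β γ ε : C)
    (hε : ε * ε = 1) :
    ∃ Ψ : PresentedGroup (cycleRels n ∪ {cc (gen n) n}) →* Twisted (Fin n) C,
      (∀ i, i + 1 < n → Ψ (PresentedGroup.mk _ (gen n (i + 1))) = adjCrossing n α β γ i) ∧
      Ψ (PresentedGroup.mk _ (gen n n)) = (mulIcc (adjCrossing n α β γ) 1 (n - 1 - 1))⁻¹ *
        crossing (X := Fin n) (weight' α β γ ε) ⟨0, by omega⟩ ⟨1, by omega⟩ *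
        mulIcc (adjCrossing n α β γ) 1 (n - 1 - 1) := by
  have hD := adjCrossing_dSystem hn α β γ ε hε
  set w := mulIcc (adjCrossing n α β γ) 1 (n - 1 - 1) with hw
  set t : Twisted (Fin n) C := crossing (weight' α β γ ε) ⟨0, by omega⟩ ⟨1, by omega⟩
  rw [show t = w * (w⁻¹ * t * w) * w⁻¹ by group] at hD
  have hC := hD.cycleSystem (by omega)
  let φ : FreeGroup (Fin n) →* Twisted (Fin n) C := FreeGroup.lift fun i =>
    if i.1 + 1 < n then adjCrossing n α β γ i else w⁻¹ * t * w
  have hφ : ∀ i, i + 1 < n → φ (gen n (i + 1)) = adjCrossing n α β γ i := fun i hi => by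
    rw [gen_succ (by omega), FreeGroup.lift_apply_of, if_pos hi]
  have hφ' : φ (gen n n) = w⁻¹ * t * w := by
    rw [gen_self (by omega), FreeGroup.lift_apply_of, if_neg (by simp; omega)]
  have hrel := (cycleSystem_iff hn φ).1 (by
    rw [hφ']
    exact hC.congr (by omega) fun i hi => hφ i (by omega))
  exact ⟨PresentedGroup.toGroup hrel, hφ, hφ'⟩

end Main

open Pointwise in
/-- part of Proposition 4.2: for `n > 4`, with `G₀` the quotient
of `A(Δ_n)` by the normal closure of the cycle commutator `cc(a_1,…,a_n)`,
`σ₀ : G₀ → Sym(n)` induced by `a_i ↦ (i,i+1)`, `a_n ↦ (1,n)`, and `H₀` the preimage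
under `σ₀` of the setwise stabiliser of `{1, 2}` (i.e. `{0, 1}` in our `Fin n`
indexing), the abelianisation of `H₀` is `ℤ/2ℤ ⊕ ℤ³`. -/
theorem abelianization_H0 (n : ℕ) (hn : 4 < n)
    (σ₀ : PresentedGroup (cycleRels n ∪ {cc (gen n) n}) →* Equiv.Perm (Fin n))
    (hσ₀ : ∀ x : Fin n, σ₀ (PresentedGroup.of x)
      = Equiv.swap x ⟨(x.val + 1) % n, Nat.mod_lt _ (by omega)⟩) :
    Nonempty (Additive (Abelianization
      (Subgroup.comap σ₀ (MulAction.stabilizer (Equiv.Perm (Fin n))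
        ({⟨0, by omega⟩, ⟨1, by omega⟩} : Set (Fin n))))) ≃+ (ZMod 2 × ℤ × ℤ × ℤ)) := by
  set mk := PresentedGroup.mk (cycleRels n ∪ {cc (gen n) n})
  set s : ℕ → PresentedGroup (cycleRels n ∪ {cc (gen n) n}) := fun i => mk (gen n (i + 1)) with hs
  have hσ : ∀ i (h : i + 1 < n), σ₀ (s i) = Equiv.swap ⟨i, by omega⟩ ⟨i + 1, h⟩ := by
    intro i h
    rw [hs]
    simp only [gen_succ (show i < n by omega)]
    refine (hσ₀ ⟨i, by omega⟩).trans ?_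
    simp only [Nat.mod_eq_of_lt h]
  have hσa : σ₀ (mk (gen n n)) = Equiv.swap ⟨n - 1, by omega⟩ ⟨0, by omega⟩ := by
    rw [gen_self (by omega)]
    refine (hσ₀ ⟨n - 1, by omega⟩).trans ?_
    simp only [Nat.sub_add_cancel (show 1 ≤ n by omega), Nat.mod_self]
  have hC : CycleSystem s (mk (gen n n)) (n - 1) := (cycleSystem_iff hn mk).2 fun r hr =>
    PresentedGroup.one_of_mem hr
  let α : Multiplicative (ZMod 2 × ℤ × ℤ × ℤ) := Multiplicative.ofAdd (0, 1, 0, 0)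
  let β : Multiplicative (ZMod 2 × ℤ × ℤ × ℤ) := Multiplicative.ofAdd (0, 0, 1, 0)
  let γ : Multiplicative (ZMod 2 × ℤ × ℤ × ℤ) := Multiplicative.ofAdd (0, 0, 0, 1)
  let ε : Multiplicative (ZMod 2 × ℤ × ℤ × ℤ) := Multiplicative.ofAdd (1, 0, 0, 0)
  obtain ⟨Ψ, hΨs, hΨa⟩ := exists_hom_twisted hn α β γ ε (by decide)
  have hw : Ψ (mulIcc s 1 (n - 1 - 1)) = mulIcc (adjCrossing n α β γ) 1 (n - 1 - 1) := by
    rw [map_mulIcc]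
    exact mulIcc_congr fun i _ hi => hΨs i (by omega)
  have hΨt : Ψ (mulIcc s 1 (n - 1 - 1) * mk (gen n n) * (mulIcc s 1 (n - 1 - 1))⁻¹) =
      crossing (weight' α β γ ε) ⟨0, by omega⟩ ⟨1, by omega⟩ := by
    rw [map_mul, map_mul, map_inv, hw, hΨa]; group
  have ht := map_mulIcc_conj hσ hn hσa
  have hgen := closure_insert_conj
    (mulIcc_one_mem fun i (hi : i ≤ n - 1 - 1) => Subgroup.subset_closure
      (Set.mem_image_of_mem s (Set.mem_Iio.2 (show i < n - 1 by omega))))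
    (closure_cycle_generators hn)
  have hΨ : SemidirectProduct.rightHom.comp Ψ = σ₀ := by
    refine MonoidHom.eq_of_eqOn_dense hgen ?_
    rintro _ (rfl | ⟨i, hi, rfl⟩)
    · rw [MonoidHom.comp_apply, hΨt, ht, hσ 0 (by omega)]; rfl
    · have hi : i + 1 < n := by have := Set.mem_Iio.1 hi; omega
      rw [hσ i hi]
      exact (congrArg _ (hΨs i hi)).trans (adjCrossing_right α β γ hi)
  exact (hC.dSystem (by omega)).nonempty_abelianization_addEquiv hσ hn hgen ht rfl rfl rfl rfl Ψ
    (DFunLike.congr_fun hΨ) hΨs hΨt rfl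

end ArtinPaper
end

section
/- Let n > 4 and 1 ≤ t ≤ n−3, and let G = A(Δ_n). Let G_t be the quotient of G by the normal closure of the t-twisted cycle commutator tc_t(a_1, …, a_n), let σ_t : G_t → Sym(n) be the homomorphism induced by a_i ↦ (i, i+1) for 1 ≤ i ≤ n−1 and a_n ↦ (1, n), and let H_t ≤ G_t be the preimage under σ_t of the setwise stabiliser in Sym(n) of {1, 2}. Then H_t/[H_t,H_t] ≅ ℤ/2ℤ ⊕ ℤ/4ℤ ⊕ ℤ^2. -/
/- Scaffolding: braid/commuting predicates, ordered products, cycle and twisted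
cycle commutators, and the Artin groups of the diagrams `Δ_n`, `Δ_{t,n}`, `D_n`
(generators numbered `1, …, n` as in the paper, realized on the index type `Fin n`). -/

namespace ArtinPaper

open scoped commutatorElement

/-- The successor of `i` on the cycle `0, …, n - 1`. -/
def nxt (n i : ℕ) : ℕ := if i + 1 = n then 0 else i + 1

/-- The value at the pair `{p, q}` of a standard cocycle on a generator interchanging `i` and `j`:
`y` if both points are moved, `x` if none is, `e` if one point moves from `i` to `j` and `f` if
one point moves from `j` to `i`. -/
def pairVal {M : Type*} (x y e f : M) (i j p q : ℕ) : M :=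
  if p = i ∨ q = i then (if p = j ∨ q = j then y else e)
  else if p = j ∨ q = j then f else x

/-- The value of a standard cocycle on a forward step from `i` to `nxt n i`. -/
def wrap {M : Type*} [Zero M] (n : ℕ) (w : M) (i : ℕ) : M := if i + 1 = n then w else 0

/-- `φ` is a cocycle, along the action `σ`, on pairs of distinct points below `n`. -/
structure IsPairCocycle {G M : Type*} [Group G] [AddCommGroup M] (n : ℕ)
    (σ : G →* Equiv.Perm ℕ) (φ : G → ℕ → ℕ → M) : Prop where
  lt : ∀ g p, p < n → σ g p < n
  mul : ∀ g h p q, p < n → q < n → p ≠ q → φ (g * h) p q = φ g (σ h p) (σ h q) + φ h p q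

/-- A pair cocycle with the standard values on the generators `a 0, …, a (n - 1)`. -/
structure IsStandard {G M : Type*} [Group G] [AddCommGroup M] (n : ℕ) (a : ℕ → G)
    (σ : G →* Equiv.Perm ℕ) (φ : G → ℕ → ℕ → M) (x y c w : M) : Prop
    extends IsPairCocycle n σ φ where
  perm : ∀ i < n, σ (a i) = Equiv.swap i (nxt n i)
  gen : ∀ i < n, ∀ p q, p < n → q < n → p ≠ q →
    φ (a i) p q = pairVal x y (wrap n w i) (c - wrap n w i) i (nxt n i) p q

namespace IsPairCocycle

variable {G M : Type*} [Group G] [AddCommGroup M] {n : ℕ} {σ : G →* Equiv.Perm ℕ}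
  {φ : G → ℕ → ℕ → M}

lemma one (h : IsPairCocycle n σ φ) {p q : ℕ} (hp : p < n) (hq : q < n) (hpq : p ≠ q) :
    φ 1 p q = 0 := by
  simpa using h.mul 1 1 p q hp hq hpq

lemma inv (h : IsPairCocycle n σ φ) (g : G) {p q : ℕ} (hp : p < n) (hq : q < n) (hpq : p ≠ q) :
    φ g⁻¹ p q = - φ g (σ g⁻¹ p) (σ g⁻¹ q) := by
  have h1 := h.mul g g⁻¹ p q hp hq hpq
  rw [mul_inv_cancel, h.one hp hq hpq] at h1
  exact eq_neg_of_add_eq_zero_right h1.symm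

lemma ne (σ : G →* Equiv.Perm ℕ) (g : G) {p q : ℕ} (hpq : p ≠ q) : σ g p ≠ σ g q :=
  fun h => hpq ((σ g).injective h)

lemma mul_inv_eq_zero (h : IsPairCocycle n σ φ) {g k : G} {p q : ℕ} (hp : p < n) (hq : q < n)
    (hpq : p ≠ q)
    (H : ∀ p q, p < n → q < n → p ≠ q → φ g p q = φ k p q) : φ (g * k⁻¹) p q = 0 := by
  rw [h.mul _ _ _ _ hp hq hpq, h.inv k hp hq hpq,
    H _ _ (h.lt _ _ hp) (h.lt _ _ hq) (ne σ _ hpq), add_neg_cancel]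

/-- Value of a pair cocycle on a conjugate. -/
lemma conj (h : IsPairCocycle n σ φ) (g k : G) {p q : ℕ} (hp : p < n) (hq : q < n) (hpq : p ≠ q) :
    φ (g * k * g⁻¹) (σ g p) (σ g q) = φ g (σ k p) (σ k q) + φ k p q - φ g p q := by
  rw [h.mul _ _ _ _ (h.lt _ _ hp) (h.lt _ _ hq) (ne σ _ hpq), h.mul, h.inv]
  · simp [sub_eq_add_neg]
  all_goals simp [h.lt, hp, hq, hpq]

/-- The increasing product `b s * b (s + 1) * ⋯ * b (s + m - 1)`. -/
def run {G : Type*} [Group G] (b : ℕ → G) (s m : ℕ) : G :=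
  ((List.range m).map fun i => b (s + i)).prod

lemma run_succ (b : ℕ → G) (s m : ℕ) : run b s (m + 1) = run b s m * b (s + m) := by
  simp [run, List.range_succ]

lemma run_zero (b : ℕ → G) (s : ℕ) : run b s 0 = 1 := by
  simp [run]

lemma run_apply_top {b : ℕ → G} {s : ℕ} (m : ℕ)
    (hσ : ∀ i, s ≤ i → i < s + m → σ (b i) = Equiv.swap i (i + 1)) :
    σ (run b s m) (s + m) = s := by
  induction m with
  | zero => simp [run_zero]
  | succ m ih =>
    rw [run_succ, map_mul, Equiv.Perm.mul_apply, hσ _ (by omega) (by omega), ← add_assoc,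
      Equiv.swap_apply_right, ih (fun i h1 h2 => hσ i h1 (by omega))]

lemma run_apply_of_lt {b : ℕ → G} {s : ℕ} (m : ℕ)
    (hσ : ∀ i, s ≤ i → i < s + m → σ (b i) = Equiv.swap i (i + 1)) {k : ℕ}
    (hk : k < s ∨ s + m < k) : σ (run b s m) k = k := by
  induction m with
  | zero => simp [run_zero]
  | succ m ih =>
    rw [run_succ, map_mul, Equiv.Perm.mul_apply, hσ _ (by omega) (by omega),
      Equiv.swap_apply_of_ne_of_ne (by omega) (by omega),
      ih (fun i h1 h2 => hσ i h1 (by omega)) (by omega)]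

lemma run_apply_mid {b : ℕ → G} {s : ℕ} (m : ℕ)
    (hσ : ∀ i, s ≤ i → i < s + m → σ (b i) = Equiv.swap i (i + 1)) {k : ℕ}
    (hk : s ≤ k) (hk' : k < s + m) : σ (run b s m) k = k + 1 := by
  induction m with
  | zero => omega
  | succ m ih =>
    have hσ' : ∀ i, s ≤ i → i < s + m → σ (b i) = Equiv.swap i (i + 1) :=
      fun i h1 h2 => hσ i h1 (by omega)
    rw [run_succ, map_mul, Equiv.Perm.mul_apply, hσ _ (by omega) (by omega)]
    rcases Nat.lt_or_ge k (s + m) with h | h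
    · rw [Equiv.swap_apply_of_ne_of_ne (by omega) (by omega), ih hσ' h]
    · obtain rfl : k = s + m := by omega
      rw [Equiv.swap_apply_left, run_apply_of_lt m hσ' (by omega)]

section Run

variable {b : ℕ → G} {s : ℕ} {X Y E F : M}

lemma run_val_outside (h : IsPairCocycle n σ φ) (m : ℕ) (hn : s + m < n)
    (hσ : ∀ i, s ≤ i → i < s + m → σ (b i) = Equiv.swap i (i + 1))
    (hb : ∀ i, s ≤ i → i < s + m → ∀ p q, p < n → q < n → p ≠ q →
      φ (b i) p q = pairVal X Y E F i (i + 1) p q)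
    {r k : ℕ} (hr : r < s ∨ s + m < r) (hk : k < s ∨ s + m < k) (hrn : r < n) (hkn : k < n)
    (hrk : r ≠ k) : φ (run b s m) r k = m • X := by
  induction m with
  | zero => simp [run_zero, h.one hrn hkn hrk]
  | succ m ih =>
    rw [run_succ, h.mul _ _ _ _ hrn hkn hrk, hσ _ (by omega) (by omega),
      Equiv.swap_apply_of_ne_of_ne (by omega) (by omega),
      Equiv.swap_apply_of_ne_of_ne (by omega) (by omega),
      ih (by omega) (fun i h1 h2 => hσ i h1 (by omega)) (fun i h1 h2 => hb i h1 (by omega))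
        (by omega) (by omega), hb _ (by omega) (by omega) _ _ hrn hkn hrk, pairVal,
      if_neg (by omega), if_neg (by omega), succ_nsmul]

lemma run_val_mid (h : IsPairCocycle n σ φ) (m : ℕ) (hn : s + m < n)
    (hσ : ∀ i, s ≤ i → i < s + m → σ (b i) = Equiv.swap i (i + 1))
    (hb : ∀ i, s ≤ i → i < s + m → ∀ p q, p < n → q < n → p ≠ q →
      φ (b i) p q = pairVal X Y E F i (i + 1) p q)
    {r k : ℕ} (hr : r < s ∨ s + m < r) (hk : s ≤ k) (hk' : k < s + m) (hrn : r < n) :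
    φ (run b s m) r k + X = m • X + E := by
  induction m with
  | zero => omega
  | succ m ih =>
    have hσ' : ∀ i, s ≤ i → i < s + m → σ (b i) = Equiv.swap i (i + 1) :=
      fun i h1 h2 => hσ i h1 (by omega)
    have hb' : ∀ i, s ≤ i → i < s + m → ∀ p q, p < n → q < n → p ≠ q →
      φ (b i) p q = pairVal X Y E F i (i + 1) p q := fun i h1 h2 => hb i h1 (by omega)
    rw [run_succ, h.mul _ _ _ _ hrn (by omega) (by omega), hσ _ (by omega) (by omega),
      Equiv.swap_apply_of_ne_of_ne (by omega) (by omega),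
      hb _ (by omega) (by omega) _ _ hrn (by omega) (by omega)]
    rcases Nat.lt_or_ge k (s + m) with hlt | hge
    · have := ih (by omega) hσ' hb' (by omega) hlt
      rw [Equiv.swap_apply_of_ne_of_ne (by omega) (by omega), pairVal,
        if_neg (by omega), if_neg (by omega), succ_nsmul, this]
      abel
    · obtain rfl : k = s + m := by omega
      rw [Equiv.swap_apply_left, h.run_val_outside m (by omega) hσ' hb' (by omega) (by omega) hrn
        (by omega) (by omega), pairVal, if_pos (by omega), if_neg (by omega), succ_nsmul]
      abel

lemma run_val_top_outside (h : IsPairCocycle n σ φ) (m : ℕ) (hn : s + m < n)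
    (hσ : ∀ i, s ≤ i → i < s + m → σ (b i) = Equiv.swap i (i + 1))
    (hb : ∀ i, s ≤ i → i < s + m → ∀ p q, p < n → q < n → p ≠ q →
      φ (b i) p q = pairVal X Y E F i (i + 1) p q)
    {k : ℕ} (hk : k < s ∨ s + m < k) (hkn : k < n) :
    φ (run b s m) (s + m) k = m • F := by
  induction m with
  | zero => simp [run_zero, h.one (by omega : s < n) hkn (by omega)]
  | succ m ih =>
    rw [run_succ, h.mul _ _ _ _ (by omega) hkn (by omega), hσ _ (by omega) (by omega),
      ← add_assoc, Equiv.swap_apply_right, Equiv.swap_apply_of_ne_of_ne (by omega) (by omega),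
      ih (by omega) (fun i h1 h2 => hσ i h1 (by omega)) (fun i h1 h2 => hb i h1 (by omega))
        (by omega), hb _ (by omega) (by omega) _ _ (by omega) hkn (by omega), pairVal,
      if_neg (by omega), if_pos (by omega), succ_nsmul]

lemma run_val_top_mid (h : IsPairCocycle n σ φ) (m : ℕ) (hn : s + m < n)
    (hσ : ∀ i, s ≤ i → i < s + m → σ (b i) = Equiv.swap i (i + 1))
    (hb : ∀ i, s ≤ i → i < s + m → ∀ p q, p < n → q < n → p ≠ q →
      φ (b i) p q = pairVal X Y E F i (i + 1) p q)
    {k : ℕ} (hk : s ≤ k) (hk' : k < s + m) :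
    φ (run b s m) (s + m) k + F = m • F + Y := by
  induction m with
  | zero => omega
  | succ m ih =>
    have hσ' : ∀ i, s ≤ i → i < s + m → σ (b i) = Equiv.swap i (i + 1) :=
      fun i h1 h2 => hσ i h1 (by omega)
    have hb' : ∀ i, s ≤ i → i < s + m → ∀ p q, p < n → q < n → p ≠ q →
      φ (b i) p q = pairVal X Y E F i (i + 1) p q := fun i h1 h2 => hb i h1 (by omega)
    rw [run_succ, h.mul _ _ _ _ (by omega) (by omega) (by omega), hσ _ (by omega) (by omega),
      ← add_assoc, Equiv.swap_apply_right,
      hb _ (by omega) (by omega) _ _ (by omega) (by omega) (by omega)]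
    rcases Nat.lt_or_ge k (s + m) with hlt | hge
    · have := ih (by omega) hσ' hb' hlt
      rw [Equiv.swap_apply_of_ne_of_ne (by omega) (by omega), pairVal,
        if_neg (by omega), if_pos (by omega), succ_nsmul, this]
      abel
    · obtain rfl : k = s + m := by omega
      rw [Equiv.swap_apply_left, pairVal, if_pos (by omega), if_pos (by omega),
        h.run_val_top_outside m (by omega) hσ' hb' (by omega) (by omega), succ_nsmul]
      abel

end Run

end IsPairCocycle

open IsPairCocycle

/-- The element conjugating the last generator in the `t`-twisted cycle commutator. -/
def twist {G : Type*} [Group G] (a : ℕ → G) (n t : ℕ) : G :=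
  run (fun i => (a i)⁻¹) 1 t * run a (t + 1) (n - 2 - t)

lemma tc_eq {G : Type*} [Group G] {y a : ℕ → G} (hy : ∀ i, y (i + 1) = a i) {n t : ℕ}
    (hn : 4 < n) :
    tc y n t = ⁅a 0, twist a n t * a (n - 1) * (twist a n t)⁻¹⁆ := by
  have h1 : mulIcc (fun i => (y i)⁻¹) 2 (t + 1) = run (fun i => (a i)⁻¹) 1 t := by
    simp only [mulIcc, run, show t + 1 + 1 - 2 = t by omega]
    congr 2
    funext i
    rw [← hy, show 1 + i + 1 = 2 + i by omega]
  have h2 : mulIcc y (t + 2) (n - 1) = run a (t + 1) (n - 2 - t) := by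
    simp only [mulIcc, run, show n - 1 + 1 - (t + 2) = n - 2 - t by omega]
    congr 2
    funext i
    rw [← hy, show t + 1 + i + 1 = t + 2 + i by omega]
  have h3 : y n = a (n - 1) := by rw [← hy, show n - 1 + 1 = n by omega]
  rw [tc, h1, h2, h3, ← zero_add 1, hy 0, twist]
  congr 1
  group

namespace IsStandard

variable {G M : Type*} [Group G] [AddCommGroup M] {n : ℕ} {a : ℕ → G} {σ : G →* Equiv.Perm ℕ}
  {φ : G → ℕ → ℕ → M} {x y c w : M}

lemma perm_step (h : IsStandard n a σ φ x y c w) {i : ℕ} (hi : i + 1 < n) :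
    σ (a i) = Equiv.swap i (i + 1) := by
  rw [h.perm i (by omega), nxt, if_neg (by omega)]

lemma gen_step (h : IsStandard n a σ φ x y c w) {i : ℕ} (hi : i + 1 < n) {p q : ℕ}
    (hp : p < n) (hq : q < n) (hpq : p ≠ q) : φ (a i) p q = pairVal x y 0 c i (i + 1) p q := by
  rw [h.gen i (by omega) p q hp hq hpq, nxt, wrap, if_neg (by omega), if_neg (by omega), sub_zero]

lemma perm_inv_step (h : IsStandard n a σ φ x y c w) {i : ℕ} (hi : i + 1 < n) :
    σ (a i)⁻¹ = Equiv.swap i (i + 1) := by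
  rw [map_inv, h.perm_step hi, Equiv.swap_inv]

lemma gen_inv_step (h : IsStandard n a σ φ x y c w) {i : ℕ} (hi : i + 1 < n) {p q : ℕ}
    (hp : p < n) (hq : q < n) (hpq : p ≠ q) :
    φ (a i)⁻¹ p q = pairVal (-x) (-y) (-c) 0 i (i + 1) p q := by
  rw [h.inv _ hp hq hpq, h.gen_step hi (h.lt _ _ hp) (h.lt _ _ hq) (ne σ _ hpq),
    h.perm_inv_step hi]
  by_cases h1 : p = i
  · subst h1
    by_cases h2 : q = p + 1
    · simp [h2, pairVal]
    · simp [pairVal, h2, Equiv.swap_apply_of_ne_of_ne (Ne.symm hpq) h2, Ne.symm hpq]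
  by_cases h2 : p = i + 1
  · subst h2
    by_cases h3 : q = i
    · simp [h3, pairVal]
    · simp [pairVal, h3, Equiv.swap_apply_of_ne_of_ne h3 (Ne.symm hpq), Ne.symm hpq]
  rw [Equiv.swap_apply_of_ne_of_ne h1 h2]
  by_cases h3 : q = i
  · subst h3; simp [pairVal, h1, h2]
  by_cases h4 : q = i + 1
  · subst h4; simp [pairVal, h1, h2]
  rw [Equiv.swap_apply_of_ne_of_ne h3 h4]
  simp [pairVal, h1, h2, h3, h4]

section Twist

variable {t : ℕ}

lemma twist_zero (h : IsStandard n a σ φ x y c w) (ht : t + 3 ≤ n) : σ (twist a n t) 0 = 0 := by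
  rw [twist, map_mul, Equiv.Perm.mul_apply,
    run_apply_of_lt _ (fun i h1 h2 => h.perm_step (by omega)) (by omega),
    run_apply_of_lt _ (fun i h1 h2 => h.perm_inv_step (by omega)) (by omega)]

lemma run_top (h : IsStandard n a σ φ x y c w) (ht : t + 3 ≤ n) :
    σ (run a (t + 1) (n - 2 - t)) (n - 1) = t + 1 := by
  have := run_apply_top (σ := σ) (b := a) (s := t + 1) (n - 2 - t)
    (fun i h1 h2 => h.perm_step (by omega))
  rwa [show t + 1 + (n - 2 - t) = n - 1 by omega] at this

lemma twist_top (h : IsStandard n a σ φ x y c w) (ht : t + 3 ≤ n) :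
    σ (twist a n t) (n - 1) = 1 := by
  rw [twist, map_mul, Equiv.Perm.mul_apply, h.run_top ht, add_comm t 1,
    run_apply_top _ (fun i h1 h2 => h.perm_inv_step (by omega))]

lemma twist_mid (h : IsStandard n a σ φ x y c w) (ht : t + 3 ≤ n) {k : ℕ} (hk : 1 ≤ k)
    (hk' : k + 2 ≤ n) : σ (twist a n t) k = k + 1 := by
  rw [twist, map_mul, Equiv.Perm.mul_apply]
  rcases Nat.lt_or_ge t k with hlt | hge
  · rw [run_apply_mid _ (fun i h1 h2 => h.perm_step (by omega)) (by omega) (by omega),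
      run_apply_of_lt _ (fun i h1 h2 => h.perm_inv_step (by omega)) (by omega)]
  · rw [run_apply_of_lt _ (fun i h1 h2 => h.perm_step (by omega)) (by omega),
      run_apply_mid _ (fun i h1 h2 => h.perm_inv_step (by omega)) (by omega) (by omega)]

lemma twist_val_high (h : IsStandard n a σ φ x y c w) (ht : t + 3 ≤ n) {k : ℕ} (hk : t < k)
    (hk' : k + 2 ≤ n) :
    φ (twist a n t) (n - 1) k - φ (twist a n t) 0 k =
      (n - 2 - t) • c + y - c + t • x + x - (n - 2 - t) • x := by
  have hs : t + 1 + (n - 2 - t) = n - 1 := by omega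
  have hB := h.run_val_top_mid (b := a) (s := t + 1) (n - 2 - t) (by omega)
    (fun i h1 h2 => h.perm_step (by omega))
    (fun i h1 h2 p q hp hq hpq => h.gen_step (by omega) hp hq hpq)
    (k := k) (by omega) (by omega)
  have hB' := h.run_val_mid (b := a) (s := t + 1) (n - 2 - t) (by omega)
    (fun i h1 h2 => h.perm_step (by omega))
    (fun i h1 h2 p q hp hq hpq => h.gen_step (by omega) hp hq hpq)
    (r := 0) (k := k) (by omega) (by omega) (by omega) (by omega)
  have hA := h.run_val_top_outside (b := fun i => (a i)⁻¹) (s := 1) t (by omega)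
    (fun i h1 h2 => h.perm_inv_step (by omega))
    (fun i h1 h2 p q hp hq hpq => h.gen_inv_step (by omega) hp hq hpq)
    (k := k + 1) (by omega) (by omega)
  have hA' := h.run_val_outside (b := fun i => (a i)⁻¹) (s := 1) t (by omega)
    (fun i h1 h2 => h.perm_inv_step (by omega))
    (fun i h1 h2 p q hp hq hpq => h.gen_inv_step (by omega) hp hq hpq)
    (r := 0) (k := k + 1) (by omega) (by omega) (by omega) (by omega) (by omega)
  rw [hs] at hB
  rw [add_comm 1 t] at hA
  rw [twist, h.mul _ _ _ _ (by omega) (by omega) (by omega),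
    h.mul _ _ _ _ (by omega) (by omega) (by omega), h.run_top ht,
    run_apply_mid _ (fun i h1 h2 => h.perm_step (by omega)) (by omega) (by omega),
    run_apply_of_lt _ (fun i h1 h2 => h.perm_step (by omega)) (by omega), hA, hA',
    eq_sub_of_add_eq hB, eq_sub_of_add_eq hB']
  simp only [smul_neg, smul_zero]
  abel

lemma twist_val_low (h : IsStandard n a σ φ x y c w) (ht : t + 3 ≤ n) {k : ℕ} (hk : 1 ≤ k)
    (hk' : k ≤ t) :
    φ (twist a n t) (n - 1) k - φ (twist a n t) 0 k =
      (n - 2 - t) • c - y + c + t • x - x - (n - 2 - t) • x := by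
  have hs : t + 1 + (n - 2 - t) = n - 1 := by omega
  have hB := h.run_val_top_outside (b := a) (s := t + 1) (n - 2 - t) (by omega)
    (fun i h1 h2 => h.perm_step (by omega))
    (fun i h1 h2 p q hp hq hpq => h.gen_step (by omega) hp hq hpq)
    (k := k) (by omega) (by omega)
  have hB' := h.run_val_outside (b := a) (s := t + 1) (n - 2 - t) (by omega)
    (fun i h1 h2 => h.perm_step (by omega))
    (fun i h1 h2 p q hp hq hpq => h.gen_step (by omega) hp hq hpq)
    (r := 0) (k := k) (by omega) (by omega) (by omega) (by omega) (by omega)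
  have hA := h.run_val_top_mid (b := fun i => (a i)⁻¹) (s := 1) t (by omega)
    (fun i h1 h2 => h.perm_inv_step (by omega))
    (fun i h1 h2 p q hp hq hpq => h.gen_inv_step (by omega) hp hq hpq)
    (k := k) (by omega) (by omega)
  have hA' := h.run_val_mid (b := fun i => (a i)⁻¹) (s := 1) t (by omega)
    (fun i h1 h2 => h.perm_inv_step (by omega))
    (fun i h1 h2 p q hp hq hpq => h.gen_inv_step (by omega) hp hq hpq)
    (r := 0) (k := k) (by omega) (by omega) (by omega) (by omega)
  rw [hs] at hB
  rw [add_comm 1 t] at hA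
  rw [twist, h.mul _ _ _ _ (by omega) (by omega) (by omega),
    h.mul _ _ _ _ (by omega) (by omega) (by omega), h.run_top ht,
    run_apply_of_lt _ (fun i h1 h2 => h.perm_step (by omega)) (by omega),
    run_apply_of_lt _ (fun i h1 h2 => h.perm_step (by omega)) (by omega),
    hB, hB', eq_sub_of_add_eq hA, eq_sub_of_add_eq hA']
  simp only [smul_neg, smul_zero]
  abel

/-- The conjugate of the last generator whose commutator with `a 0` is the twisted
cycle commutator. -/
def twisted {G : Type*} [Group G] (a : ℕ → G) (n t : ℕ) : G :=
  twist a n t * a (n - 1) * (twist a n t)⁻¹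

lemma perm_last (h : IsStandard n a σ φ x y c w) (hn : 4 < n) :
    σ (a (n - 1)) = Equiv.swap (n - 1) 0 := by
  rw [h.perm _ (by omega), nxt, if_pos (by omega)]

lemma gen_last (h : IsStandard n a σ φ x y c w) (hn : 4 < n) {p q : ℕ}
    (hp : p < n) (hq : q < n) (hpq : p ≠ q) :
    φ (a (n - 1)) p q = pairVal x y w (c - w) (n - 1) 0 p q := by
  rw [h.gen _ (by omega) p q hp hq hpq, nxt, wrap, if_pos (by omega), if_pos (by omega)]

lemma perm_twisted (h : IsStandard n a σ φ x y c w) (hn : 4 < n) (ht : t + 3 ≤ n) :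
    σ (twisted a n t) = Equiv.swap 0 1 := by
  rw [twisted, map_mul, map_mul, h.perm_last hn, map_inv, ← Equiv.swap_apply_apply,
    h.twist_top ht, h.twist_zero ht, Equiv.swap_comm]

lemma twisted_val_zero (h : IsStandard n a σ φ x y c w) (hn : 4 < n) (ht : t + 3 ≤ n) {k : ℕ}
    (hk : 1 ≤ k) (hk' : k + 2 ≤ n) :
    φ (twisted a n t) 0 (k + 1) =
      (φ (twist a n t) (n - 1) k - φ (twist a n t) 0 k) + (c - w) := by
  have := h.conj (twist a n t) (a (n - 1)) (p := 0) (q := k) (by omega) (by omega) (by omega)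
  rw [h.twist_zero ht, h.twist_mid ht hk hk', h.perm_last hn, Equiv.swap_apply_right,
    Equiv.swap_apply_of_ne_of_ne (by omega) (by omega),
    h.gen_last hn (by omega) (by omega) (by omega), pairVal, if_neg (by omega),
    if_pos (by omega)] at this
  rw [twisted, this]
  abel

lemma twisted_val_one (h : IsStandard n a σ φ x y c w) (hn : 4 < n) (ht : t + 3 ≤ n) {k : ℕ}
    (hk : 1 ≤ k) (hk' : k + 2 ≤ n) :
    φ (twisted a n t) 1 (k + 1) =
      w - (φ (twist a n t) (n - 1) k - φ (twist a n t) 0 k) := by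
  have := h.conj (twist a n t) (a (n - 1)) (p := n - 1) (q := k) (by omega) (by omega) (by omega)
  rw [h.twist_top ht, h.twist_mid ht hk hk', h.perm_last hn, Equiv.swap_apply_left,
    Equiv.swap_apply_of_ne_of_ne (by omega) (by omega),
    h.gen_last hn (by omega) (by omega) (by omega), pairVal, if_pos (by omega),
    if_neg (by omega)] at this
  rw [twisted, this]
  abel

lemma commutator_twisted (h : IsStandard n a σ φ x y c w) (hn : 4 < n) (ht : t + 3 ≤ n) {k : ℕ}
    (hk : 1 ≤ k) (hk' : k + 2 ≤ n) :
    φ (a 0 * twisted a n t) 0 (k + 1) - φ (twisted a n t * a 0) 0 (k + 1) =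
      2 • (φ (twist a n t) (n - 1) k - φ (twist a n t) 0 k + c - w) ∧
    φ (twisted a n t * a 0) 1 (k + 1) - φ (a 0 * twisted a n t) 1 (k + 1) =
      2 • (φ (twist a n t) (n - 1) k - φ (twist a n t) 0 k + c - w) := by
  constructor
  · rw [h.mul _ _ _ _ (by omega) (by omega) (by omega),
      h.mul _ _ _ _ (by omega) (by omega) (by omega), h.perm_twisted hn ht,
      h.perm_step (i := 0) (by omega), zero_add, Equiv.swap_apply_left,
      Equiv.swap_apply_of_ne_of_ne (by omega) (by omega), h.twisted_val_zero hn ht hk hk',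
      h.twisted_val_one hn ht hk hk', h.gen_step (by omega) (by omega) (by omega) (by omega),
      h.gen_step (by omega) (by omega) (by omega) (by omega), pairVal, pairVal, if_neg (by omega),
      if_pos (by omega), if_pos (by omega), if_neg (by omega)]
    abel
  · rw [h.mul _ _ _ _ (by omega) (by omega) (by omega),
      h.mul _ _ _ _ (by omega) (by omega) (by omega), h.perm_twisted hn ht,
      h.perm_step (i := 0) (by omega), zero_add, Equiv.swap_apply_right,
      Equiv.swap_apply_of_ne_of_ne (by omega) (by omega), h.twisted_val_zero hn ht hk hk',
      h.twisted_val_one hn ht hk hk', h.gen_step (by omega) (by omega) (by omega) (by omega),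
      h.gen_step (by omega) (by omega) (by omega) (by omega), pairVal, pairVal, if_neg (by omega),
      if_pos (by omega), if_pos (by omega), if_neg (by omega)]
    abel

end Twist

section Commutator

variable {t : ℕ}

/-- If a standard cocycle vanishes on the twisted cycle commutator, its values satisfy the
relations of `ℤ/2 ⊕ ℤ/4 ⊕ ℤ²`. -/
lemma relations (h : IsStandard n a σ φ x y c w) (hn : 4 < n) (ht1 : 1 ≤ t) (ht : t + 3 ≤ n)
    (H : ∀ p q, p < n → q < n → p ≠ q → φ ⁅a 0, twisted a n t⁆ p q = 0) :
    2 • ((n - 2 - t) • c + t • x + x - (n - 2 - t) • x + y - w) = 0 ∧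
      4 • (x + y - c) = 0 := by
  have key : ∀ k, 1 ≤ k → k + 2 ≤ n →
      2 • (φ (twist a n t) (n - 1) k - φ (twist a n t) 0 k + c - w) = 0 := by
    intro k hk hk'
    rw [← (h.commutator_twisted hn ht hk hk').1, sub_eq_zero]
    have h1 := h.mul ⁅a 0, twisted a n t⁆ (twisted a n t * a 0) 0 (k + 1) (by omega) (by omega)
      (by omega)
    rw [H _ _ (h.lt _ _ (by omega)) (h.lt _ _ (by omega)) (ne σ _ (by omega)), zero_add] at h1
    rw [← h1]
    congr 1
    rw [commutatorElement_def]
    group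
  have h1 := key (n - 2) (by omega) (by omega)
  have h2 := key 1 (by omega) (by omega)
  rw [h.twist_val_high ht (by omega) (by omega)] at h1
  rw [h.twist_val_low ht (by omega) (by omega)] at h2
  constructor
  · rw [← h1]
    abel
  · have h3 := congrArg₂ (· - ·) h1 h2
    simp only [sub_zero] at h3
    rw [← h3]
    abel

lemma commutator_eq_zero (h : IsStandard n a σ φ x y c w) (hn : 4 < n) (ht : t + 3 ≤ n)
    (hs : ∀ g p q, p < n → q < n → p ≠ q → φ g p q = φ g q p)
    (h1 : 2 • ((n - 2 - t) • c + t • x + x - (n - 2 - t) • x + y - w) = 0)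
    (h2 : 4 • (x + y - c) = 0) {p q : ℕ} (hp : p < n) (hq : q < n) (hpq : p ≠ q) :
    φ ⁅a 0, twisted a n t⁆ p q = 0 := by
  have key : ∀ k, 1 ≤ k → k + 2 ≤ n →
      2 • (φ (twist a n t) (n - 1) k - φ (twist a n t) 0 k + c - w) = 0 := by
    intro k hk hk'
    rcases Nat.lt_or_ge t k with hlt | hge
    · rw [h.twist_val_high ht hlt hk', ← h1]
      abel
    · rw [h.twist_val_low ht hk hge]
      have h3 := congrArg₂ (· - ·) h1 h2
      simp only [sub_zero] at h3
      rw [← h3]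
      abel
  have h0 : ∀ k, 2 ≤ k → k < n →
      φ (a 0 * twisted a n t) 0 k = φ (twisted a n t * a 0) 0 k := by
    intro k hk hk'
    obtain ⟨k, rfl⟩ := Nat.exists_eq_add_of_le' (show 1 ≤ k by omega)
    rw [← sub_eq_zero, (h.commutator_twisted hn ht (by omega) (by omega)).1]
    exact key k (by omega) (by omega)
  have h1' : ∀ k, 2 ≤ k → k < n →
      φ (a 0 * twisted a n t) 1 k = φ (twisted a n t * a 0) 1 k := by
    intro k hk hk'
    obtain ⟨k, rfl⟩ := Nat.exists_eq_add_of_le' (show 1 ≤ k by omega)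
    rw [eq_comm, ← sub_eq_zero, (h.commutator_twisted hn ht (by omega) (by omega)).2]
    exact key k (by omega) (by omega)
  have hc : ⁅a 0, twisted a n t⁆ = a 0 * twisted a n t * (twisted a n t * a 0)⁻¹ := by
    rw [commutatorElement_def]
    group
  rw [hc]
  refine h.mul_inv_eq_zero hp hq hpq ?_
  intro p q hp hq hpq
  by_cases hp2 : 2 ≤ p
  · by_cases hq2 : 2 ≤ q
    · rw [h.mul _ _ _ _ hp hq hpq, h.mul _ _ _ _ hp hq hpq, h.perm_twisted hn ht,
        h.perm_step (by omega), zero_add,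
        Equiv.swap_apply_of_ne_of_ne (by omega) (by omega),
        Equiv.swap_apply_of_ne_of_ne (by omega) (by omega), add_comm]
    · rw [hs _ _ _ hp hq hpq, hs _ _ _ hp hq hpq]
      obtain rfl | rfl : q = 0 ∨ q = 1 := by omega
      · exact h0 p hp2 hp
      · exact h1' p hp2 hp
  · by_cases hq2 : 2 ≤ q
    · obtain rfl | rfl : p = 0 ∨ p = 1 := by omega
      · exact h0 q hq2 hq
      · exact h1' q hq2 hq
    · rw [h.mul _ _ _ _ hp hq hpq, h.mul _ _ _ _ hp hq hpq, h.perm_twisted hn ht,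
        h.perm_step (by omega), zero_add, add_comm]
      obtain ⟨rfl, rfl⟩ | ⟨rfl, rfl⟩ : (p = 0 ∧ q = 1) ∨ (p = 1 ∧ q = 0) := by omega
      · rw [Equiv.swap_apply_left, Equiv.swap_apply_right, hs (a 0) 1 0 hq hp hpq.symm,
          hs (twisted a n t) 1 0 hq hp hpq.symm]
      · rw [Equiv.swap_apply_left, Equiv.swap_apply_right, hs (a 0) 0 1 hq hp hpq.symm,
          hs (twisted a n t) 0 1 hq hp hpq.symm]

end Commutator

section Relations

lemma nxt_lt {n i : ℕ} (hn : 4 < n) (hi : i < n) : nxt n i < n := by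
  unfold nxt; split_ifs <;> omega

lemma braid_val (h : IsStandard n a σ φ x y c w) (hn : 4 < n) {i : ℕ} (hi : i < n) {p q : ℕ}
    (hp : p < n) (hq : q < n) (hpq : p ≠ q) :
    φ (a i * a (nxt n i) * a i) p q = φ (a (nxt n i) * a i * a (nxt n i)) p q := by
  have hj := nxt_lt hn hi
  have hij : i ≠ nxt n i := by unfold nxt; split_ifs <;> omega
  have hik : i ≠ nxt n (nxt n i) := by unfold nxt; split_ifs <;> omega
  have hjk : nxt n i ≠ nxt n (nxt n i) := by unfold nxt; split_ifs <;> omega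
  rw [h.mul _ _ _ _ hp hq hpq, h.mul _ _ _ _ (h.lt _ _ hp) (h.lt _ _ hq) (ne σ _ hpq),
    h.mul _ _ _ _ hp hq hpq, h.mul _ _ _ _ (h.lt _ _ hp) (h.lt _ _ hq) (ne σ _ hpq),
    h.gen i hi _ _ hp hq hpq, h.gen _ hj _ _ hp hq hpq,
    h.gen i hi _ _ (h.lt _ _ hp) (h.lt _ _ hq) (ne σ _ hpq),
    h.gen _ hj _ _ (h.lt _ _ hp) (h.lt _ _ hq) (ne σ _ hpq),
    h.gen i hi _ _ (h.lt _ _ (h.lt _ _ hp)) (h.lt _ _ (h.lt _ _ hq)) (ne σ _ (ne σ _ hpq)),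
    h.gen _ hj _ _ (h.lt _ _ (h.lt _ _ hp)) (h.lt _ _ (h.lt _ _ hq)) (ne σ _ (ne σ _ hpq)),
    h.perm i hi, h.perm _ hj]
  generalize wrap n w i = e
  generalize wrap n w (nxt n i) = f
  generalize nxt n (nxt n i) = k at *
  generalize nxt n i = j at *
  clear h hp hq hi hj
  simp only [pairVal, Equiv.swap_apply_def]
  by_cases hpi : p = i <;> by_cases hpj : p = j <;> by_cases hpk : p = k <;>
    by_cases hqi : q = i <;> by_cases hqj : q = j <;> by_cases hqk : q = k <;>
    first
    | (exfalso; omega)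
    | (simp [hpi, hpj, hpk, hqi, hqj, hqk, hij, hik, hjk, hij.symm, hik.symm, hjk.symm] <;> abel)

lemma comm_val (h : IsStandard n a σ φ x y c w) (hn : 4 < n) {i j : ℕ} (hi : i < n) (hj : j < n)
    (hij : i ≠ j) (hij' : nxt n i ≠ j) (hji' : nxt n j ≠ i) {p q : ℕ}
    (hp : p < n) (hq : q < n) (hpq : p ≠ q) :
    φ (a i * a j) p q = φ (a j * a i) p q := by
  have hii : i ≠ nxt n i := by unfold nxt; split_ifs <;> omega
  have hjj : j ≠ nxt n j := by unfold nxt; split_ifs <;> omega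
  have hnn : nxt n i ≠ nxt n j := by unfold nxt; split_ifs <;> omega
  rw [h.mul _ _ _ _ hp hq hpq, h.mul _ _ _ _ hp hq hpq,
    h.gen i hi _ _ hp hq hpq, h.gen j hj _ _ hp hq hpq,
    h.gen i hi _ _ (h.lt _ _ hp) (h.lt _ _ hq) (ne σ _ hpq),
    h.gen _ hj _ _ (h.lt _ _ hp) (h.lt _ _ hq) (ne σ _ hpq),
    h.perm i hi, h.perm _ hj]
  generalize wrap n w i = e
  generalize wrap n w j = f
  generalize nxt n i = i' at *
  generalize nxt n j = j' at *
  clear h hp hq hi hj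
  simp only [pairVal, Equiv.swap_apply_def]
  by_cases hpi : p = i <;> by_cases hpj : p = j <;> by_cases hpk : p = i' <;>
    by_cases hpl : p = j' <;>
    by_cases hqi : q = i <;> by_cases hqj : q = j <;> by_cases hqk : q = i' <;>
    by_cases hql : q = j' <;>
    first
    | (exfalso; omega)
    | (simp [hpi, hpj, hpk, hpl, hqi, hqj, hqk, hql, hij, hij', hji', hii, hjj, hnn, hij.symm,
        hij'.symm, hji'.symm, hii.symm, hjj.symm, hnn.symm] <;> abel)

end Relations
end IsStandard

section Existence

/-- The permutation of pairs with a label, acting by `s` on the pair and adding `u` to the label. -/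
def shear {M : Type*} [AddCommGroup M] (s : Equiv.Perm ℕ) (u : ℕ → ℕ → M) :
    Equiv.Perm ((ℕ × ℕ) × M) where
  toFun X := ((s X.1.1, s X.1.2), X.2 + u X.1.1 X.1.2)
  invFun X := ((s⁻¹ X.1.1, s⁻¹ X.1.2), X.2 - u (s⁻¹ X.1.1) (s⁻¹ X.1.2))
  left_inv X := by simp
  right_inv X := by simp

/-- Pair cocycles on a presented group can be prescribed on the generators, provided that the
corresponding cocycles on the free group vanish on the relators. -/
lemma exists_pairCocycle {α M : Type*} [AddCommGroup M] {n : ℕ} {rels : Set (FreeGroup α)}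
    (σ : PresentedGroup rels →* Equiv.Perm ℕ) (hlt : ∀ g p, p < n → σ g p < n)
    (v : α → ℕ → ℕ → M)
    (H : ∀ ψ : FreeGroup α → ℕ → ℕ → M, IsPairCocycle n (σ.comp (PresentedGroup.mk rels)) ψ →
      (∀ b p q, p < n → q < n → p ≠ q → ψ (FreeGroup.of b) p q = v b p q) →
      ∀ r ∈ rels, ∀ p q, p < n → q < n → p ≠ q → ψ r p q = 0) :
    ∃ φ : PresentedGroup rels → ℕ → ℕ → M, IsPairCocycle n σ φ ∧
      ∀ b p q, p < n → q < n → p ≠ q → φ (PresentedGroup.of b) p q = v b p q := by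
  classical
  let good : ℕ → ℕ → Prop := fun p q => p < n ∧ q < n ∧ p ≠ q
  have hgood : ∀ g p q, good (σ g p) (σ g q) → good p q := by
    rintro g p q ⟨h1, h2, h3⟩
    refine ⟨?_, ?_, fun h => h3 (h ▸ rfl)⟩
    · simpa using hlt g⁻¹ _ h1
    · simpa using hlt g⁻¹ _ h2
  let v' : α → ℕ → ℕ → M := fun b p q => if good p q then v b p q else 0
  let Ψ : FreeGroup α →* Equiv.Perm ((ℕ × ℕ) × M) :=
    FreeGroup.lift fun b => shear (σ (PresentedGroup.of b)) (v' b)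
  have hΨ : ∀ f, ∃ u : ℕ → ℕ → M, (∀ p q, ¬ good p q → u p q = 0) ∧
      ∀ p q m, Ψ f ((p, q), m) =
        ((σ (PresentedGroup.mk rels f) p, σ (PresentedGroup.mk rels f) q), m + u p q) := by
    intro f
    induction f using FreeGroup.induction_on with
    | C1 => exact ⟨0, by simp⟩
    | of b =>
      refine ⟨v' b, fun p q h => if_neg h, fun p q m => ?_⟩
      simp only [Ψ, FreeGroup.lift_apply_of]
      rfl
    | inv_of b _ =>
      refine ⟨fun p q => - v' b ((σ (PresentedGroup.of b))⁻¹ p) ((σ (PresentedGroup.of b))⁻¹ q),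
        fun p q h => ?_, fun p q m => ?_⟩
      · have : ¬ good ((σ (PresentedGroup.of b))⁻¹ p) ((σ (PresentedGroup.of b))⁻¹ q) := by
          rw [← map_inv]
          exact fun h' => h (by
            have := hgood (PresentedGroup.of b) p q
            exact hgood _ _ _ h')
        simp only [v', if_neg this, neg_zero]
      · simp only [map_inv, Ψ, FreeGroup.lift_apply_of, ← sub_eq_add_neg]
        rfl
    | mul f g hf hg =>
      obtain ⟨u, hu, hf⟩ := hf
      obtain ⟨u', hu', hg⟩ := hg
      refine ⟨fun p q => u' p q +
        u (σ (PresentedGroup.mk rels g) p) (σ (PresentedGroup.mk rels g) q), fun p q h => ?_,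
        fun p q m => ?_⟩
      · simp only [hu' p q h, zero_add]
        exact hu _ _ fun h' => h (hgood _ _ _ h')
      · rw [map_mul, Equiv.Perm.mul_apply, hg, hf, map_mul, map_mul]
        simp [add_assoc]
  choose u hu hΨ using hΨ
  have hmul : ∀ f g p q, u (f * g) p q =
      u f (σ (PresentedGroup.mk rels g) p) (σ (PresentedGroup.mk rels g) q) + u g p q := by
    intro f g p q
    have h1 := hΨ (f * g) p q 0
    rw [map_mul, Equiv.Perm.mul_apply, hΨ, hΨ, Prod.ext_iff] at h1
    have h2 := h1.2
    simp only [zero_add] at h2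
    rw [← h2, add_comm]
  have hof : ∀ b p q, u (FreeGroup.of b) p q = v' b p q := by
    intro b p q
    have h1 := hΨ (FreeGroup.of b) p q 0
    simp only [Ψ, FreeGroup.lift_apply_of, Prod.ext_iff] at h1
    have h2 := h1.2
    simp only [zero_add, shear, Equiv.coe_fn_mk] at h2
    exact h2.symm
  have hu0 := H u ⟨fun g p hp => hlt _ p hp, fun f g p q _ _ _ => hmul f g p q⟩
    fun b p q hp hq hpq => (hof b p q).trans (if_pos ⟨hp, hq, hpq⟩)
  have hrels : ∀ r ∈ rels,
      FreeGroup.lift (fun b => shear (σ (PresentedGroup.of b)) (v' b)) r = 1 := by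
    intro r hr
    ext1 ⟨⟨p, q⟩, m⟩
    have h0 : u r p q = 0 := by
      by_cases h : good p q
      · exact hu0 r hr p q h.1 h.2.1 h.2.2
      · exact hu r p q h
    change Ψ r ((p, q), m) = _
    rw [hΨ, h0, PresentedGroup.one_of_mem hr]
    simp
  have hmk : ∀ f, PresentedGroup.toGroup hrels (PresentedGroup.mk rels f) = Ψ f := fun f => rfl
  have hval : ∀ f p q,
      (PresentedGroup.toGroup hrels (PresentedGroup.mk rels f) ((p, q), 0)).2 = u f p q := by
    intro f p q
    rw [hmk, hΨ, zero_add]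
  refine ⟨fun g p q => (PresentedGroup.toGroup hrels g ((p, q), 0)).2, ⟨hlt, ?_⟩, ?_⟩
  · intro g h p q _ _ _
    obtain ⟨g, rfl⟩ := PresentedGroup.mk_surjective rels g
    obtain ⟨h, rfl⟩ := PresentedGroup.mk_surjective rels h
    rw [← map_mul, hval, hval, hval, hmul]
  · intro b p q hp hq hpq
    exact (hval _ p q).trans ((hof b p q).trans (if_pos ⟨hp, hq, hpq⟩))

/-- A homomorphism carrying one pair cocycle to another on a generating family carries it
everywhere. -/
lemma IsPairCocycle.ext_of_generators {ι G M M' : Type*} [Group G] [AddCommGroup M]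
    [AddCommGroup M'] {n : ℕ} {σ : G →* Equiv.Perm ℕ} {φ : G → ℕ → ℕ → M} {ψ : G → ℕ → ℕ → M'}
    (h : IsPairCocycle n σ φ) (h' : IsPairCocycle n σ ψ) (θ : M →+ M') {f : ι → G}
    (hf : Subgroup.closure (Set.range f) = ⊤)
    (H : ∀ b p q, p < n → q < n → p ≠ q → θ (φ (f b) p q) = ψ (f b) p q)
    (g : G) {p q : ℕ} (hp : p < n) (hq : q < n) (hpq : p ≠ q) :
    θ (φ g p q) = ψ g p q := by
  have hg : g ∈ Subgroup.closure (Set.range f) := hf ▸ Subgroup.mem_top g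
  induction hg using Subgroup.closure_induction generalizing p q with
  | mem x hx =>
    obtain ⟨b, rfl⟩ := hx
    exact H b p q hp hq hpq
  | one => rw [h.one hp hq hpq, h'.one hp hq hpq, map_zero]
  | inv x _ ih =>
    rw [h.inv _ hp hq hpq, h'.inv _ hp hq hpq, map_neg,
      ih (h.lt _ _ hp) (h.lt _ _ hq) (ne σ _ hpq)]
  | mul x y _ _ ihx ihy =>
    rw [h.mul _ _ _ _ hp hq hpq, h'.mul _ _ _ _ hp hq hpq, map_add, ihy hp hq hpq,
      ihx (h.lt _ _ hp) (h.lt _ _ hq) (ne σ _ hpq)]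

lemma IsPairCocycle.swap {G M : Type*} [Group G] [AddCommGroup M] {n : ℕ}
    {σ : G →* Equiv.Perm ℕ} {φ : G → ℕ → ℕ → M} (h : IsPairCocycle n σ φ) :
    IsPairCocycle n σ fun g p q => φ g q p :=
  ⟨h.lt, fun g k _ _ hp hq hpq => h.mul g k _ _ hq hp hpq.symm⟩

lemma pairVal_comm {M : Type*} (x y e f : M) (i j p q : ℕ) :
    pairVal x y e f i j p q = pairVal x y e f i j q p := by
  simp only [pairVal, or_comm]

end Existence

/-- A pair cocycle on a group with the braid and commutation relations of the `n`-cycle which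
vanishes on the forward steps `i ↦ i + 1`. -/
structure IsForward {G M : Type*} [Group G] [AddCommGroup M] (n : ℕ) (a : ℕ → G)
    (σ : G →* Equiv.Perm ℕ) (φ : G → ℕ → ℕ → M) : Prop extends IsPairCocycle n σ φ where
  symm : ∀ g p q, φ g p q = φ g q p
  perm : ∀ i < n, σ (a i) = Equiv.swap i (nxt n i)
  braid : ∀ i < n, a i * a (nxt n i) * a i = a (nxt n i) * a i * a (nxt n i)
  comm : ∀ i j, i < n → j < n → i ≠ j → nxt n i ≠ j → nxt n j ≠ i → a i * a j = a j * a i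
  fwd : ∀ i k, i + 1 < n → k < n → k ≠ i → k ≠ i + 1 → φ (a i) i k = 0

namespace IsForward

variable {G M : Type*} [Group G] [AddCommGroup M] {n : ℕ} {a : ℕ → G} {σ : G →* Equiv.Perm ℕ}
  {φ : G → ℕ → ℕ → M}

lemma comm_expand (h : IsForward n a σ φ) {i j : ℕ} (hi : i < n) (hj : j < n)
    (hij : i ≠ j) (hij' : nxt n i ≠ j) (hji' : nxt n j ≠ i) {p q : ℕ}
    (hp : p < n) (hq : q < n) (hpq : p ≠ q) :
    φ (a i) (Equiv.swap j (nxt n j) p) (Equiv.swap j (nxt n j) q) + φ (a j) p q =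
      φ (a j) (Equiv.swap i (nxt n i) p) (Equiv.swap i (nxt n i) q) + φ (a i) p q := by
  rw [← h.perm i hi, ← h.perm j hj, ← h.mul _ _ _ _ hp hq hpq, ← h.mul _ _ _ _ hp hq hpq,
    h.comm i j hi hj hij hij' hji']

lemma braid_expand (h : IsForward n a σ φ) {i j k : ℕ} (hi : i < n) (hj : j < n)
    (hij : nxt n i = j) (hjk : nxt n j = k) {p q : ℕ} (hp : p < n) (hq : q < n) (hpq : p ≠ q) :
    φ (a i) (Equiv.swap j k (Equiv.swap i j p)) (Equiv.swap j k (Equiv.swap i j q)) +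
        (φ (a j) (Equiv.swap i j p) (Equiv.swap i j q) + φ (a i) p q) =
      φ (a j) (Equiv.swap i j (Equiv.swap j k p)) (Equiv.swap i j (Equiv.swap j k q)) +
        (φ (a i) (Equiv.swap j k p) (Equiv.swap j k q) + φ (a j) p q) := by
  have h1 := h.perm i hi
  have h2 := h.perm j hj
  rw [hij] at h1
  rw [hjk] at h2
  have key := congrArg (fun g => φ g p q) (h.braid i hi)
  simp only [hij, mul_assoc] at key
  rw [h.mul _ _ _ _ hp hq hpq, h.mul _ _ _ _ hp hq hpq, h.mul _ _ _ _ hp hq hpq,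
    h.mul _ _ _ _ hp hq hpq, map_mul, map_mul, h1, h2] at key
  exact key

lemma loop_comm (h : IsForward n a σ φ) {i j : ℕ} (hi : i < n) (hj : j < n)
    (hij : i ≠ j) (hij' : nxt n i ≠ j) (hji' : nxt n j ≠ i) {p q : ℕ}
    (hp : p < n) (hq : q < n) (hpq : p ≠ q) (hpi : p ≠ i) (hpi' : p ≠ nxt n i) (hqi : q ≠ i)
    (hqi' : q ≠ nxt n i) :
    φ (a i) (Equiv.swap j (nxt n j) p) (Equiv.swap j (nxt n j) q) = φ (a i) p q := by
  have := h.comm_expand hi hj hij hij' hji' hp hq hpq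
  rw [Equiv.swap_apply_of_ne_of_ne hpi hpi', Equiv.swap_apply_of_ne_of_ne hqi hqi', add_comm] at this
  exact add_left_cancel this

section Braid

variable {i j k : ℕ}

lemma loop_far (h : IsForward n a σ φ) (hi : i < n) (hj : j < n) (hij : nxt n i = j)
    (hjk : nxt n j = k) {p q : ℕ} (hp : p < n) (hq : q < n) (hpq : p ≠ q) (hpi : p ≠ i)
    (hpj : p ≠ j) (hpk : p ≠ k) (hqi : q ≠ i) (hqj : q ≠ j) (hqk : q ≠ k) :
    φ (a i) p q = φ (a j) p q := by
  have := h.braid_expand hi hj hij hjk hp hq hpq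
  simp only [Equiv.swap_apply_of_ne_of_ne hpi hpj, Equiv.swap_apply_of_ne_of_ne hqi hqj,
    Equiv.swap_apply_of_ne_of_ne hpj hpk, Equiv.swap_apply_of_ne_of_ne hqj hqk] at this
  rw [add_comm (φ (a j) p q) (φ (a i) p q)] at this
  exact add_right_cancel (this.trans (by abel))

lemma loop_near (h : IsForward n a σ φ) (hi : i < n) (hj : j < n) (hij : nxt n i = j)
    (hjk : nxt n j = k) (hij' : i ≠ j) (hik' : i ≠ k) {r : ℕ}
    (hr : r < n) (hri : r ≠ i) (hrj : r ≠ j) (hrk : r ≠ k) : φ (a i) k r = φ (a j) i r := by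
  have := h.braid_expand hi hj hij hjk hi hr hri.symm
  simp only [Equiv.swap_apply_of_ne_of_ne hri hrj, Equiv.swap_apply_of_ne_of_ne hrj hrk,
    Equiv.swap_apply_left, Equiv.swap_apply_of_ne_of_ne hij' hik'] at this
  exact add_right_cancel (this.trans (by abel))

lemma both_step (h : IsForward n a σ φ) (hi : i < n) (hj : j < n) (hij : nxt n i = j)
    (hjk : nxt n j = k) (hij' : i ≠ j) (hik' : i ≠ k) (hjk' : j ≠ k) :
    φ (a i) i j = φ (a j) j k := by
  have := h.braid_expand hi hj hij hjk hi hj hij'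
  simp only [Equiv.swap_apply_left, Equiv.swap_apply_right,
    Equiv.swap_apply_of_ne_of_ne hij' hik',
    Equiv.swap_apply_of_ne_of_ne hik'.symm hjk'.symm] at this
  rw [h.symm _ k i, h.symm _ j i] at this
  have h2 : φ (a i) i k + φ (a j) i j + φ (a i) i j = φ (a i) i k + φ (a j) i j + φ (a j) j k := by
    rw [add_assoc, this]; abel
  exact add_left_cancel h2

lemma round_far (h : IsForward n a σ φ) (hi : i < n) (hj : j < n) (hij : nxt n i = j)
    (hjk : nxt n j = k) (hij' : i ≠ j) (hik' : i ≠ k) (hjk' : j ≠ k) {r : ℕ}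
    (hr : r < n) (hri : r ≠ i) (hrj : r ≠ j) (hrk : r ≠ k) :
    φ (a i) j r + φ (a i) i r = φ (a j) k r + φ (a j) j r := by
  have := h.braid_expand hi hj hij hjk hj hr hrj.symm
  simp only [Equiv.swap_apply_of_ne_of_ne hri hrj, Equiv.swap_apply_of_ne_of_ne hrj hrk,
    Equiv.swap_apply_left, Equiv.swap_apply_right, Equiv.swap_apply_of_ne_of_ne hij' hik',
    Equiv.swap_apply_of_ne_of_ne hik'.symm hjk'.symm] at this
  rw [h.loop_near hi hj hij hjk hij' hik' hr hri hrj hrk] at this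
  have h2 : φ (a j) i r + (φ (a i) j r + φ (a i) i r) =
      φ (a j) i r + (φ (a j) k r + φ (a j) j r) := by
    rw [add_left_comm (φ (a j) i r) (φ (a j) k r), ← this]; abel
  exact add_left_cancel h2

lemma round_near (h : IsForward n a σ φ) (hi : i < n) (hj : j < n) (hk : k < n)
    (hij : nxt n i = j)
    (hjk : nxt n j = k) (hij' : i ≠ j) (hik' : i ≠ k) (hjk' : j ≠ k) :
    φ (a i) j k + φ (a i) i k = φ (a j) k i + φ (a j) j i := by
  have := h.braid_expand hi hj hij hjk hi hk hik'
  simp only [Equiv.swap_apply_left, Equiv.swap_apply_right, Equiv.swap_apply_of_ne_of_ne hij' hik',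
    Equiv.swap_apply_of_ne_of_ne hik'.symm hjk'.symm] at this
  rw [h.both_step hi hj hij hjk hij' hik' hjk', h.symm _ k j, h.symm (a j) i k] at this
  have h2 : φ (a j) j k + (φ (a i) j k + φ (a i) i k) =
      φ (a j) j k + (φ (a j) k i + φ (a j) j i) := by
    rw [add_left_comm (φ (a j) j k) (φ (a i) j k), this]; abel
  exact add_left_cancel h2

end Braid

lemma nxt_of_lt {n i : ℕ} (hi : i + 1 < n) : nxt n i = i + 1 := if_neg (by omega)

lemma nxt_pred {n : ℕ} (hn : 4 < n) : nxt n (n - 1) = 0 := if_pos (by omega)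

lemma loop_zero_one (h : IsForward n a σ φ) {i : ℕ} (hi : i + 3 < n) :
    φ (a (i + 2)) 0 1 = φ (a 2) 0 1 := by
  induction i with
  | zero => rfl
  | succ i ih =>
    rw [← ih (by omega)]
    exact (h.loop_far (i := i + 2) (j := i + 3) (k := i + 4) (by omega) (by omega)
      (nxt_of_lt (by omega)) (nxt_of_lt (by omega)) (by omega) (by omega) (by omega) (by omega)
      (by omega) (by omega) (by omega) (by omega) (by omega)).symm

/-- All values on loops away from the pair agree, for the generators of the linear diagram. -/
lemma loop_linear (h : IsForward n a σ φ) (N : ℕ) : ∀ i p q, p + q ≤ N → i + 1 < n → p < q → q < n →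
    p ≠ i → p ≠ i + 1 → q ≠ i → q ≠ i + 1 → φ (a i) p q = φ (a 2) 0 1 := by
  induction N with
  | zero => intro i p q; omega
  | succ N ih =>
    intro i p q hN hi hpq hq hpi hpi' hqi hqi'
    have hni := nxt_of_lt hi
    rcases Nat.eq_zero_or_pos p with rfl | hp
    · by_cases hq1 : q = 1
      · subst hq1
        obtain ⟨i, rfl⟩ := Nat.exists_eq_add_of_le' (show 2 ≤ i by omega)
        exact h.loop_zero_one (by omega)
      · by_cases hqi2 : q = i + 2
        · subst hqi2
          rw [h.symm, h.loop_near (i := i) (j := i + 1) (k := i + 2) (by omega) (by omega) hni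
            (nxt_of_lt (by omega)) (by omega) (by omega) (by omega) (by omega) (by omega)
            (by omega), h.symm]
          exact ih _ _ _ (by omega) (by omega) (by omega) (by omega) (by omega) (by omega)
            (by omega) (by omega)
        · have hnq : nxt n (q - 1) = q := by rw [nxt_of_lt (by omega)]; omega
          rw [← h.loop_comm (i := i) (j := q - 1) (by omega) (by omega) (by omega) (by omega)
            (by omega) (by omega) hq (by omega) hpi (by omega) hqi (by omega), hnq,
            Equiv.swap_apply_right, Equiv.swap_apply_of_ne_of_ne (by omega) (by omega)]
          exact ih _ _ _ (by omega) (by omega) (by omega) (by omega) (by omega) (by omega)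
            (by omega) (by omega)
    · by_cases hpi2 : p = i + 2
      · subst hpi2
        rw [h.loop_near (i := i) (j := i + 1) (k := i + 2) (by omega) (by omega) hni
            (nxt_of_lt (by omega)) (by omega) (by omega) (by omega) (by omega) (by omega)
            (by omega)]
        exact ih _ _ _ (by omega) (by omega) (by omega) (by omega) (by omega) (by omega)
          (by omega) (by omega)
      · have hnq : nxt n (p - 1) = p := by rw [nxt_of_lt (by omega)]; omega
        rw [← h.loop_comm (i := i) (j := p - 1) (by omega) (by omega) (by omega) (by omega)
          (by omega) (by omega) hq (by omega) hpi (by omega) hqi (by omega), hnq,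
          Equiv.swap_apply_right, Equiv.swap_apply_of_ne_of_ne (by omega) (by omega)]
        exact ih _ _ _ (by omega) (by omega) (by omega) (by omega) (by omega) (by omega)
          (by omega) (by omega)

lemma loop_last (h : IsForward n a σ φ) (hn : 4 < n) (d : ℕ) : ∀ p q, q + d + 2 = n → 1 ≤ p → p < q →
    φ (a (n - 1)) p q = φ (a 2) 0 1 := by
  have hl := nxt_pred hn
  induction d with
  | zero =>
    intro p q hq hp hpq
    rw [h.symm, ← h.loop_near (i := q) (j := n - 1) (k := 0) (by omega) (by omega)
      (by rw [nxt_of_lt (by omega)]; omega) hl (by omega) (by omega) (by omega) (by omega)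
      (by omega) (by omega)]
    exact h.loop_linear _ _ _ _ le_rfl (by omega) (by omega) (by omega) (by omega) (by omega)
      (by omega) (by omega)
  | succ d ih =>
    intro p q hq hp hpq
    have hnq : nxt n q = q + 1 := nxt_of_lt (by omega)
    rw [← h.loop_comm (i := n - 1) (j := q) (by omega) (by omega) (by omega) (by omega)
      (by omega) (by omega) (by omega) (by omega) (by omega) (by omega) (by omega) (by omega),
      hnq, Equiv.swap_apply_left, Equiv.swap_apply_of_ne_of_ne (by omega) (by omega)]
    exact ih _ _ (by omega) hp (by omega)

lemma both_linear (h : IsForward n a σ φ) {i : ℕ} (hi : i + 1 < n) :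
    φ (a i) i (i + 1) = φ (a 0) 0 1 := by
  induction i with
  | zero => rfl
  | succ i ih =>
    rw [← ih (by omega)]
    exact (h.both_step (by omega) (by omega) (nxt_of_lt (by omega)) (nxt_of_lt (by omega))
      (by omega) (by omega) (by omega)).symm

lemma both_last (h : IsForward n a σ φ) (hn : 4 < n) :
    φ (a (n - 1)) (n - 1) 0 = φ (a 0) 0 1 :=
  h.both_step (by omega) (by omega) (nxt_pred hn) (nxt_of_lt (by omega))
      (by omega) (by omega) (by omega)

lemma back_zero (h : IsForward n a σ φ) {i : ℕ} (hi : i + 2 < n) :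
    φ (a (i + 1)) (i + 2) 0 = φ (a 1) 2 0 := by
  induction i with
  | zero => rfl
  | succ i ih =>
    have := h.round_far (i := i + 1) (j := i + 2) (k := i + 3) (by omega) (by omega)
      (nxt_of_lt (by omega)) (nxt_of_lt (by omega)) (by omega) (by omega) (by omega)
      (r := 0) (by omega) (by omega) (by omega) (by omega)
    rw [h.fwd _ _ (by omega) (by omega) (by omega) (by omega),
      h.fwd _ _ (by omega) (by omega) (by omega) (by omega), add_zero, add_zero] at this
    rw [← ih (by omega), this]

/-- All values on backward steps agree, for the generators of the linear diagram. -/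
lemma back_linear (h : IsForward n a σ φ) (k : ℕ) : ∀ i, i + 1 < n → k < n → k ≠ i → k ≠ i + 1 →
    φ (a i) (i + 1) k = φ (a 1) 2 0 := by
  induction k using Nat.strong_induction_on with | _ k ih
  intro i hi hk hki hki'
  rcases Nat.eq_zero_or_pos k with rfl | hk0
  · obtain ⟨i, rfl⟩ := Nat.exists_eq_add_of_le' (show 1 ≤ i by omega)
    exact h.back_zero (by omega)
  by_cases hki2 : k = i + 2
  · subst hki2
    have := h.round_near (i := i) (j := i + 1) (k := i + 2) (by omega) (by omega) (by omega)
      (nxt_of_lt (by omega)) (nxt_of_lt (by omega)) (by omega) (by omega) (by omega)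
    rw [h.fwd _ _ (by omega) (by omega) (by omega) (by omega),
      h.fwd _ _ (by omega) (by omega) (by omega) (by omega), add_zero, add_zero] at this
    rw [this]
    exact ih i (by omega) (i + 1) (by omega) (by omega) (by omega) (by omega)
  · have hni := nxt_of_lt hi
    have hnk : nxt n (k - 1) = k := by rw [nxt_of_lt (by omega)]; omega
    have := h.comm_expand (i := i) (j := k - 1) (by omega) (by omega) (by omega) (by omega)
      (by omega) (p := i + 1) (q := k - 1) (by omega) (by omega) (by omega)
    rw [hnk, hni, Equiv.swap_apply_left, Equiv.swap_apply_right,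
      Equiv.swap_apply_of_ne_of_ne (by omega) (by omega),
      Equiv.swap_apply_of_ne_of_ne (by omega) (by omega), h.symm _ _ (k - 1), h.symm _ i (k - 1),
      h.fwd _ _ (by omega) (by omega) (by omega) (by omega),
      h.fwd _ _ (by omega) (by omega) (by omega) (by omega), add_zero, zero_add] at this
    rw [this]
    exact ih (k - 1) (by omega) i hi (by omega) (by omega) (by omega)

lemma last_step (h : IsForward n a σ φ) (hn : 4 < n) {k : ℕ} (hk : 1 ≤ k) (hk' : k + 1 < n) :
    φ (a (n - 1)) (n - 1) k = φ (a (n - 1)) (n - 1) 1 ∧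
      φ (a (n - 1)) 0 k = φ (a (n - 1)) 0 1 := by
  have hl := nxt_pred hn
  induction k, hk using Nat.le_induction with
  | base => exact ⟨rfl, rfl⟩
  | succ k hk ih =>
    have hnk := nxt_of_lt (n := n) (i := k) (by omega)
    rw [← (ih (by omega)).1, ← (ih (by omega)).2]
    constructor
    · have := h.comm_expand (i := n - 1) (j := k) (by omega) (by omega) (by omega) (by omega)
        (by omega) (p := n - 1) (q := k) (by omega) (by omega) (by omega)
      rw [hl, hnk, Equiv.swap_apply_left, Equiv.swap_apply_left,
        Equiv.swap_apply_of_ne_of_ne (by omega) (by omega),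
        Equiv.swap_apply_of_ne_of_ne (by omega) (by omega), h.symm (a k) (n - 1) k, h.symm (a k) 0 k,
        h.fwd k (n - 1) (by omega) (by omega) (by omega) (by omega),
        h.fwd k 0 (by omega) (by omega) (by omega) (by omega), add_zero, zero_add] at this
      exact this
    · have := h.comm_expand (i := n - 1) (j := k) (by omega) (by omega) (by omega) (by omega)
        (by omega) (p := 0) (q := k) (by omega) (by omega) (by omega)
      rw [hl, hnk, Equiv.swap_apply_left, Equiv.swap_apply_right,
        Equiv.swap_apply_of_ne_of_ne (by omega) (by omega),
        Equiv.swap_apply_of_ne_of_ne (by omega) (by omega), h.symm (a k) 0 k, h.symm (a k) (n - 1) k,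
        h.fwd k (n - 1) (by omega) (by omega) (by omega) (by omega),
        h.fwd k 0 (by omega) (by omega) (by omega) (by omega), add_zero, zero_add] at this
      exact this

lemma last_round (h : IsForward n a σ φ) (hn : 4 < n) :
    φ (a (n - 1)) 0 1 = φ (a 1) 2 0 - φ (a (n - 1)) (n - 1) 1 := by
  have := h.round_far (i := n - 1) (j := 0) (k := 1) (by omega) (by omega)
    (nxt_pred hn) (nxt_of_lt (by omega)) (by omega) (by omega) (by omega)
    (r := 2) (by omega) (by omega) (by omega) (by omega)
  rw [(h.last_step hn (k := 2) (by omega) (by omega)).1,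
    (h.last_step hn (k := 2) (by omega) (by omega)).2,
    h.fwd 0 2 (by omega) (by omega) (by omega) (by omega), add_zero,
    h.back_linear 2 0 (by omega) (by omega) (by omega) (by omega)] at this
  exact eq_sub_of_add_eq this

theorem isStandard (h : IsForward n a σ φ) (hn : 4 < n) :
    IsStandard n a σ φ (φ (a 2) 0 1) (φ (a 0) 0 1) (φ (a 1) 2 0) (φ (a (n - 1)) (n - 1) 1) := by
  refine ⟨h.toIsPairCocycle, h.perm, ?_⟩
  intro i hi
  suffices H : ∀ p q, p < n → q < n → p ≠ q → (q = i ∨ q = nxt n i → p = i ∨ p = nxt n i) →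
      (p = nxt n i → q ≠ i) → ((p ≠ i ∧ p ≠ nxt n i) → p < q) →
      φ (a i) p q = pairVal (φ (a 2) 0 1) (φ (a 0) 0 1) (wrap n (φ (a (n - 1)) (n - 1) 1) i)
        (φ (a 1) 2 0 - wrap n (φ (a (n - 1)) (n - 1) 1) i) i (nxt n i) p q by
    intro p q hp hq hpq
    by_cases h1 : (q = i ∨ q = nxt n i → p = i ∨ p = nxt n i) ∧ (p = nxt n i → q ≠ i) ∧
        ((p ≠ i ∧ p ≠ nxt n i) → p < q)
    · exact H p q hp hq hpq h1.1 h1.2.1 h1.2.2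
    · rw [h.symm, pairVal_comm]
      exact H q p hq hp hpq.symm (by omega) (by omega) (by omega)
  intro p q hp hq hpq h1 h2 h3
  by_cases hi' : i + 1 = n
  · obtain rfl : i = n - 1 := by omega
    rw [nxt_pred hn] at h1 h2 h3 ⊢
    rw [wrap, if_pos hi', pairVal]
    by_cases hpi : p = n - 1
    · subst hpi
      rw [if_pos (Or.inl rfl)]
      by_cases hq0 : q = 0
      · subst hq0
        rw [if_pos (Or.inr rfl), h.both_last hn]
      · rw [if_neg (by omega), (h.last_step hn (by omega) (by omega)).1]
    · by_cases hp0 : p = 0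
      · subst hp0
        rw [if_neg (by omega), if_pos (Or.inl rfl), (h.last_step hn (by omega) (by omega)).2,
          h.last_round hn]
      · rw [if_neg (by omega), if_neg (by omega)]
        exact h.loop_last hn (n - 2 - q) p q (by omega) (by omega) (by omega)
  · have hni := nxt_of_lt (n := n) (i := i) (by omega)
    rw [hni] at h1 h2 h3 ⊢
    rw [wrap, if_neg hi', sub_zero, pairVal]
    by_cases hpi : p = i
    · subst hpi
      rw [if_pos (Or.inl rfl)]
      by_cases hq0 : q = p + 1
      · subst hq0
        rw [if_pos (Or.inr rfl), h.both_linear hq]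
      · rw [if_neg (by omega), h.fwd _ _ (by omega) hq (by omega) (by omega)]
    · by_cases hp0 : p = i + 1
      · subst hp0
        rw [if_neg (by omega), if_pos (Or.inl rfl),
          h.back_linear _ _ (by omega) hq (by omega) (by omega)]
      · rw [if_neg (by omega), if_neg (by omega)]
        exact h.loop_linear _ i p q le_rfl (by omega) (by omega) (by omega) (by omega) (by omega)
          (by omega) (by omega)

end IsForward

section Generators

variable {n t : ℕ}

/-- The generators of the free group, numbered from `0`. -/
def freeGen (n i : ℕ) : FreeGroup (Fin n) := gen n (i + 1)

lemma freeGen_val (b : Fin n) : freeGen n b = FreeGroup.of b := by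
  simp [freeGen, gen, Nat.mod_eq_of_lt b.isLt, b.pos]

lemma cycleRels_cases (hn : 4 < n) {r : FreeGroup (Fin n)} (hr : r ∈ cycleRels n) :
    (∃ i < n, r = braidRel (freeGen n i) (freeGen n (nxt n i)) ∨
      r = braidRel (freeGen n (nxt n i)) (freeGen n i)) ∨
    ∃ i j, i < n ∧ j < n ∧ i ≠ j ∧ nxt n i ≠ j ∧ nxt n j ≠ i ∧
      r = ⁅freeGen n i, freeGen n j⁆ := by
  obtain ⟨i, j, hi, hij, hj, h | h⟩ := hr
  · obtain ⟨⟨-, h1, rfl⟩ | ⟨rfl, rfl⟩, rfl⟩ := h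
    · obtain ⟨i, rfl⟩ := Nat.exists_eq_add_of_le' hi
      refine Or.inl ⟨i, by omega, Or.inl ?_⟩
      rw [IsForward.nxt_of_lt (by omega)]
      rfl
    · refine Or.inl ⟨j - 1, by omega, Or.inr ?_⟩
      rw [IsForward.nxt_pred hn, freeGen, freeGen, Nat.sub_add_cancel (by omega)]
  · obtain ⟨i, rfl⟩ := Nat.exists_eq_add_of_le' hi
    obtain ⟨j, rfl⟩ := Nat.exists_eq_add_of_le' (show 1 ≤ j by omega)
    have hE := h.1
    unfold cycEdge at hE
    refine Or.inr ⟨i, j, by omega, by omega, by omega, ?_, ?_, h.2⟩ <;> unfold nxt <;>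
      split_ifs <;> omega

/-- The generators of the quotient of the Artin group, numbered from `0`. -/
def quotGen (n t i : ℕ) : Gnt n t := PresentedGroup.mk _ (freeGen n i)

lemma braid_of_mem {α : Type*} {rels : Set (FreeGroup α)} {u v : FreeGroup α}
    (h : braidRel u v ∈ rels) : PresentedGroup.mk rels u * PresentedGroup.mk rels v *
      PresentedGroup.mk rels u = PresentedGroup.mk rels v * PresentedGroup.mk rels u *
      PresentedGroup.mk rels v := by
  have := PresentedGroup.one_of_mem h
  rw [braidRel, map_mul, map_inv] at this
  simpa using mul_inv_eq_one.1 this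

lemma comm_of_mem {α : Type*} {rels : Set (FreeGroup α)} {u v : FreeGroup α}
    (h : ⁅u, v⁆ ∈ rels) : PresentedGroup.mk rels u * PresentedGroup.mk rels v =
      PresentedGroup.mk rels v * PresentedGroup.mk rels u := by
  have := PresentedGroup.one_of_mem h
  rw [map_commutatorElement] at this
  exact commutatorElement_eq_one_iff_mul_comm.1 this

lemma quotGen_braid (hn : 4 < n) {i : ℕ} (hi : i < n) :
    quotGen n t i * quotGen n t (nxt n i) * quotGen n t i =
      quotGen n t (nxt n i) * quotGen n t i * quotGen n t (nxt n i) := by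
  by_cases h : i + 1 = n
  · obtain rfl : i = n - 1 := by omega
    rw [IsForward.nxt_pred hn]
    refine (braid_of_mem (Or.inl ⟨1, n, le_rfl, by omega, le_rfl,
      Or.inl ⟨Or.inr ⟨rfl, rfl⟩, ?_⟩⟩)).symm
    rw [freeGen, freeGen, h]
  · rw [IsForward.nxt_of_lt (by omega)]
    exact braid_of_mem (Or.inl ⟨i + 1, i + 2, by omega, by omega, by omega,
      Or.inl ⟨Or.inl ⟨by omega, by omega, rfl⟩, rfl⟩⟩)

lemma quotGen_comm {i j : ℕ} (hi : i < n) (hj : j < n) (hij : i ≠ j)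
    (hij' : nxt n i ≠ j) (hji' : nxt n j ≠ i) :
    quotGen n t i * quotGen n t j = quotGen n t j * quotGen n t i := by
  wlog h : i < j generalizing i j
  · exact (this hj hi hij.symm hji' hij' (by omega)).symm
  · refine comm_of_mem (Or.inl ⟨i + 1, j + 1, by omega, by omega, by omega,
      Or.inr ⟨?_, rfl⟩⟩)
    unfold cycEdge
    unfold nxt at hij' hji'
    split_ifs at hij' hji' <;> omega

lemma mk_tc (hn : 4 < n) :
    PresentedGroup.mk (cycleRels n ∪ {tc (gen n) n t})
      ⁅freeGen n 0, IsStandard.twisted (freeGen n) n t⁆ = 1 := by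
  have := tc_eq (y := gen n) (a := freeGen n) (fun _ => rfl) (t := t) hn
  rw [IsStandard.twisted, ← this]
  exact PresentedGroup.one_of_mem (Or.inr rfl)

end Generators

section Existence

variable {n t : ℕ} {M : Type*} [AddCommGroup M]

/-- Standard values satisfying the two relations define a cocycle on the quotient group. -/
theorem exists_isStandard (hn : 4 < n) (ht : t + 3 ≤ n) (σ : Gnt n t →* Equiv.Perm ℕ)
    (hlt : ∀ g p, p < n → σ g p < n)
    (hσ : ∀ i < n, σ (quotGen n t i) = Equiv.swap i (nxt n i)) {x y c w : M}
    (h1 : 2 • ((n - 2 - t) • c + t • x + x - (n - 2 - t) • x + y - w) = 0)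
    (h2 : 4 • (x + y - c) = 0) : ∃ φ, IsStandard n (quotGen n t) σ φ x y c w := by
  obtain ⟨φ, hφ, hv⟩ := exists_pairCocycle σ hlt
    (fun (b : Fin n) => pairVal x y (wrap n w b) (c - wrap n w b) b (nxt n b)) (by
    intro ψ hψ hv
    have hs : IsStandard n (freeGen n) (σ.comp (PresentedGroup.mk _)) ψ x y c w := by
      refine ⟨hψ, hσ, fun i hi p q hp hq hpq => ?_⟩
      have := hv ⟨i, hi⟩ p q hp hq hpq
      rwa [← freeGen_val] at this
    have hsymm : ∀ g p q, p < n → q < n → p ≠ q → ψ g p q = ψ g q p := by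
      intro g p q hp hq hpq
      refine IsPairCocycle.ext_of_generators hψ hψ.swap (AddMonoidHom.id M)
        (FreeGroup.closure_range_of _) ?_ g hp hq hpq
      intro b p q hp hq hpq
      simp only [AddMonoidHom.id_apply]
      rw [hv b p q hp hq hpq, hv b q p hq hp hpq.symm, pairVal_comm]
    intro r hr p q hp hq hpq
    rcases hr with hr | rfl
    · rcases cycleRels_cases hn hr with ⟨i, hi, rfl | rfl⟩ | ⟨i, j, hi, hj, hij, hij', hji', rfl⟩
      · exact hψ.mul_inv_eq_zero hp hq hpq fun p q hp hq hpq => hs.braid_val hn hi hp hq hpq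
      · exact hψ.mul_inv_eq_zero hp hq hpq
          fun p q hp hq hpq => (hs.braid_val hn hi hp hq hpq).symm
      · rw [show ⁅freeGen n i, freeGen n j⁆ =
          freeGen n i * freeGen n j * (freeGen n j * freeGen n i)⁻¹ by
            rw [commutatorElement_def]; group]
        exact hψ.mul_inv_eq_zero hp hq hpq
          fun p q hp hq hpq => hs.comm_val hn hi hj hij hij' hji' hp hq hpq
    · rw [tc_eq (a := freeGen n) (fun _ => rfl) hn]
      exact hs.commutator_eq_zero hn ht hsymm h1 h2 hp hq hpq)
  refine ⟨φ, hφ, hσ, fun i hi p q hp hq hpq => ?_⟩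
  have := hv ⟨i, hi⟩ p q hp hq hpq
  rwa [PresentedGroup.of, ← freeGen_val] at this

/-- The parameters of a standard cocycle on the quotient group satisfy the two relations. -/
theorem IsStandard.relations_of_quot (hn : 4 < n) (ht1 : 1 ≤ t) (ht : t + 3 ≤ n)
    {σ : Gnt n t →* Equiv.Perm ℕ} {φ : Gnt n t → ℕ → ℕ → M} {x y c w : M}
    (h : IsStandard n (quotGen n t) σ φ x y c w) :
    2 • ((n - 2 - t) • c + t • x + x - (n - 2 - t) • x + y - w) = 0 ∧ 4 • (x + y - c) = 0 := by
  have hs : IsStandard n (freeGen n) (σ.comp (PresentedGroup.mk _))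
      (fun g => φ (PresentedGroup.mk _ g)) x y c w :=
    ⟨⟨fun g => h.lt _, fun g k => by
      rw [map_mul]
      exact h.mul (PresentedGroup.mk _ g) (PresentedGroup.mk _ k)⟩,
      h.perm, h.gen⟩
  refine hs.relations hn ht1 ht fun p q hp hq hpq => ?_
  rw [mk_tc hn]
  exact h.one hp hq hpq

/-- Standard cocycles are natural in their parameters. -/
lemma IsStandard.map {M' : Type*} [AddCommGroup M'] {σ : Gnt n t →* Equiv.Perm ℕ}
    {φ : Gnt n t → ℕ → ℕ → M} {ψ : Gnt n t → ℕ → ℕ → M'} {x y c w : M} {x' y' c' w' : M'}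
    (h : IsStandard n (quotGen n t) σ φ x y c w) (h' : IsStandard n (quotGen n t) σ ψ x' y' c' w')
    (θ : M →+ M') (hx : θ x = x') (hy : θ y = y') (hc : θ c = c') (hw : θ w = w')
    (g : Gnt n t) {p q : ℕ} (hp : p < n) (hq : q < n) (hpq : p ≠ q) :
    θ (φ g p q) = ψ g p q := by
  refine IsPairCocycle.ext_of_generators h.toIsPairCocycle h'.toIsPairCocycle θ
    (PresentedGroup.closure_range_of _) ?_ g hp hq hpq
  intro b p q hp hq hpq
  have hb : PresentedGroup.of b = quotGen n t b := by
    rw [quotGen, freeGen_val]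
    rfl
  rw [hb, h.gen b b.isLt p q hp hq hpq, h'.gen b b.isLt p q hp hq hpq]
  unfold pairVal wrap
  split_ifs <;> simp [hx, hy, hc, hw]

lemma IsStandard.symm {σ : Gnt n t →* Equiv.Perm ℕ} {φ : Gnt n t → ℕ → ℕ → M} {x y c w : M}
    (h : IsStandard n (quotGen n t) σ φ x y c w) (g : Gnt n t) {p q : ℕ} (hp : p < n) (hq : q < n)
    (hpq : p ≠ q) : φ g p q = φ g q p := by
  have h' : IsStandard n (quotGen n t) σ (fun g p q => φ g q p) x y c w :=
    ⟨h.toIsPairCocycle.swap, h.perm, fun i hi p q hp hq hpq => by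
      rw [pairVal_comm]; exact h.gen i hi q p hq hp hpq.symm⟩
  exact h.map h' (AddMonoidHom.id M) rfl rfl rfl rfl g hp hq hpq

end Existence

section Reverse

variable {G : Type*} [Group G] {n : ℕ} {a : ℕ → G} {σ : G →* Equiv.Perm ℕ}

/-- The product `a (s + m - 1) * ⋯ * a (s + 1) * a s`. -/
def climb (a : ℕ → G) (s : ℕ) : ℕ → G
  | 0 => 1
  | m + 1 => a (s + m) * climb a s m

/-- An element carrying `{0, 1}` to `{p, q}`. -/
def pairRep (a : ℕ → G) (p q : ℕ) : G := climb a 0 (min p q) * climb a 1 (max p q - 1)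

lemma pairRep_comm (a : ℕ → G) (p q : ℕ) : pairRep a p q = pairRep a q p := by
  rw [pairRep, pairRep, min_comm, max_comm]

lemma climb_apply_self (hσ : ∀ i < n, σ (a i) = Equiv.swap i (nxt n i)) {s m : ℕ}
    (hm : s + m < n) : σ (climb a s m) s = s + m := by
  induction m with
  | zero => simp [climb]
  | succ m ih =>
    rw [climb, map_mul, Equiv.Perm.mul_apply, ih (by omega), hσ _ (by omega),
      Equiv.swap_apply_left, IsForward.nxt_of_lt (by omega), add_assoc]

lemma climb_apply_of_ne (hσ : ∀ i < n, σ (a i) = Equiv.swap i (nxt n i)) {s m k : ℕ}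
    (hm : s + m < n) (hk : k < s ∨ s + m < k) : σ (climb a s m) k = k := by
  induction m with
  | zero => simp [climb]
  | succ m ih =>
    rw [climb, map_mul, Equiv.Perm.mul_apply, ih (by omega) (by omega), hσ _ (by omega),
      IsForward.nxt_of_lt (by omega), Equiv.swap_apply_of_ne_of_ne (by omega) (by omega)]

lemma pairRep_apply_zero (hσ : ∀ i < n, σ (a i) = Equiv.swap i (nxt n i)) {p q : ℕ}
    (hpq : p < q) (hq : q < n) : σ (pairRep a p q) 0 = p := by
  rw [pairRep, min_eq_left hpq.le, max_eq_right hpq.le, map_mul, Equiv.Perm.mul_apply,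
    climb_apply_of_ne hσ (s := 1) (by omega) (by omega),
    climb_apply_self hσ (s := 0) (by omega), zero_add]

lemma pairRep_apply_one (hσ : ∀ i < n, σ (a i) = Equiv.swap i (nxt n i)) {p q : ℕ}
    (hpq : p < q) (hq : q < n) : σ (pairRep a p q) 1 = q := by
  rw [pairRep, min_eq_left hpq.le, max_eq_right hpq.le, map_mul, Equiv.Perm.mul_apply,
    climb_apply_self hσ (by omega), climb_apply_of_ne hσ (by omega) (by omega)]
  omega

lemma pairRep_inv_apply (hσ : ∀ i < n, σ (a i) = Equiv.swap i (nxt n i)) {p q : ℕ}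
    (hp : p < n) (hq : q < n) (hpq : p ≠ q) :
    σ (pairRep a p q)⁻¹ p = 0 ∧ σ (pairRep a p q)⁻¹ q = 1 ∨
      σ (pairRep a p q)⁻¹ p = 1 ∧ σ (pairRep a p q)⁻¹ q = 0 := by
  simp only [map_inv, Equiv.Perm.inv_eq_iff_eq]
  rcases Nat.lt_or_gt_of_ne hpq with h | h
  · exact Or.inl ⟨(pairRep_apply_zero hσ h hq).symm, (pairRep_apply_one hσ h hq).symm⟩
  · rw [pairRep_comm]
    exact Or.inr ⟨(pairRep_apply_one hσ h hp).symm, (pairRep_apply_zero hσ h hp).symm⟩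

lemma pairRep_apply (hσ : ∀ i < n, σ (a i) = Equiv.swap i (nxt n i)) {p q : ℕ}
    (hp : p < n) (hq : q < n) (hpq : p ≠ q) :
    σ (pairRep a p q) 0 = p ∧ σ (pairRep a p q) 1 = q ∨
      σ (pairRep a p q) 0 = q ∧ σ (pairRep a p q) 1 = p := by
  rcases Nat.lt_or_gt_of_ne hpq with h | h
  · exact Or.inl ⟨pairRep_apply_zero hσ h hq, pairRep_apply_one hσ h hq⟩
  · rw [pairRep_comm]
    exact Or.inr ⟨pairRep_apply_zero hσ h hp, pairRep_apply_one hσ h hp⟩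

lemma climb_comm (hc : ∀ i j, i < n → j < n → i ≠ j → nxt n i ≠ j → nxt n j ≠ i →
      a i * a j = a j * a i) {i m : ℕ} (hi : i + 1 < n) (hm : m < i) :
    climb a 0 m * a i = a i * climb a 0 m := by
  induction m with
  | zero => simp [climb]
  | succ m ih =>
    rw [climb, mul_assoc, ih (by omega), ← mul_assoc, ← mul_assoc, hc (0 + m) i (by omega)
      (by omega) (by omega) (by rw [IsForward.nxt_of_lt (by omega)]; omega)
      (by rw [IsForward.nxt_of_lt (by omega)]; omega)]

lemma pairRep_step (hc : ∀ i j, i < n → j < n → i ≠ j → nxt n i ≠ j → nxt n j ≠ i →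
      a i * a j = a j * a i) {i k : ℕ} (hi : i + 1 < n) (hki : k ≠ i) (hki' : k ≠ i + 1) :
    pairRep a (i + 1) k = a i * pairRep a i k := by
  rcases Nat.lt_or_gt_of_ne hki with h | h
  · obtain ⟨j, rfl⟩ := Nat.exists_eq_add_of_le' (show 1 ≤ i by omega)
    rw [pairRep, pairRep, min_eq_right (by omega), min_eq_right (by omega), max_eq_left (by omega),
      max_eq_left (by omega), ← mul_assoc, ← climb_comm hc hi h, mul_assoc]
    simp [climb, add_comm]
  · rw [pairRep, pairRep, min_eq_left (by omega), min_eq_left (by omega), max_eq_right (by omega),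
      max_eq_right (by omega), ← mul_assoc, climb, zero_add]

open Classical in
/-- The class in the abelianization of an element of a subgroup. -/
noncomputable def abClass (H : Subgroup G) (g : G) : Additive (Abelianization H) :=
  if h : g ∈ H then Additive.ofMul (Abelianization.of ⟨g, h⟩) else 0

lemma abClass_of_mem {H : Subgroup G} {g : G} (h : g ∈ H) :
    abClass H g = Additive.ofMul (Abelianization.of ⟨g, h⟩) := dif_pos h

lemma abClass_mul {H : Subgroup G} {g k : G} (hg : g ∈ H) (hk : k ∈ H) :
    abClass H (g * k) = abClass H g + abClass H k := by
  rw [abClass_of_mem hg, abClass_of_mem hk, abClass_of_mem (H.mul_mem hg hk), ← ofMul_mul,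
    ← map_mul]
  rfl

lemma abClass_one (H : Subgroup G) : abClass H 1 = 0 := by
  rw [abClass_of_mem H.one_mem, show (⟨1, H.one_mem⟩ : H) = 1 from rfl, map_one, ofMul_one]

/-- The classes of the elements of the stabilizer of `{0, 1}` extend to a cocycle. -/
theorem exists_isForward (hlt : ∀ g p, p < n → σ g p < n)
    (hσ : ∀ i < n, σ (a i) = Equiv.swap i (nxt n i))
    (hb : ∀ i < n, a i * a (nxt n i) * a i = a (nxt n i) * a i * a (nxt n i))
    (hc : ∀ i j, i < n → j < n → i ≠ j → nxt n i ≠ j → nxt n j ≠ i → a i * a j = a j * a i)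
    {H : Subgroup G}
    (hH : ∀ g, g ∈ H ↔ σ g 0 = 0 ∧ σ g 1 = 1 ∨ σ g 0 = 1 ∧ σ g 1 = 0) :
    ∃ φ : G → ℕ → ℕ → Additive (Abelianization H), IsForward n a σ φ ∧
      ∀ (g : G) (hg : g ∈ H), φ g 0 1 = Additive.ofMul (Abelianization.of ⟨g, hg⟩) := by
  have hmem : ∀ g p q, p < n → q < n → p ≠ q →
      (pairRep a (σ g p) (σ g q))⁻¹ * g * pairRep a p q ∈ H := by
    intro g p q hp hq hpq
    rw [hH]
    simp only [map_mul, Equiv.Perm.mul_apply]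
    rcases pairRep_apply hσ hp hq hpq with ⟨h0, h1⟩ | ⟨h0, h1⟩ <;> rw [h0, h1]
    · exact pairRep_inv_apply hσ (hlt g p hp) (hlt g q hq) (IsPairCocycle.ne σ g hpq)
    · have := pairRep_inv_apply hσ (hlt g p hp) (hlt g q hq) (IsPairCocycle.ne σ g hpq)
      tauto
  refine ⟨fun g p q => abClass H ((pairRep a (σ g p) (σ g q))⁻¹ * g * pairRep a p q),
    ⟨⟨hlt, ?_⟩, ?_, hσ, hb, hc, ?_⟩, ?_⟩
  · intro g k p q hp hq hpq
    rw [← abClass_mul (hmem _ _ _ (hlt k p hp) (hlt k q hq) (IsPairCocycle.ne σ k hpq))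
      (hmem k p q hp hq hpq)]
    congr 1
    simp only [map_mul, Equiv.Perm.mul_apply]
    group
  · intro g p q
    rw [pairRep_comm, pairRep_comm a p]
  · intro i k hi hk hki hki'
    rw [hσ i (by omega), IsForward.nxt_of_lt hi, Equiv.swap_apply_left,
      Equiv.swap_apply_of_ne_of_ne hki hki', pairRep_step hc hi hki hki', mul_assoc,
      inv_mul_cancel, abClass_one]
  · intro g hg
    have h01 : pairRep a 0 1 = 1 := by simp [pairRep, climb]
    have h10 : pairRep a 1 0 = 1 := by rw [pairRep_comm, h01]
    beta_reduce
    rcases (hH g).1 hg with ⟨h0, h1⟩ | ⟨h0, h1⟩ <;>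
      simp only [h0, h1, h01, h10, inv_one, one_mul, mul_one, abClass_of_mem hg]

end Reverse

section Computation

variable {n t : ℕ}

/-- Homomorphisms out of `ℤ/2 ⊕ ℤ/4 ⊕ ℤ²`. -/
lemma exists_addMonoidHom {M : Type*} [AddCommGroup M] (e f x c : M) (he : 2 • e = 0)
    (hf : 4 • f = 0) : ∃ θ : ZMod 2 × ZMod 4 × ℤ × ℤ →+ M, θ (1, 0, 0, 0) = e ∧
      θ (0, 1, 0, 0) = f ∧ θ (0, 0, 1, 0) = x ∧ θ (0, 0, 0, 1) = c := by
  have he' : zmultiplesHom M e (2 : ℕ) = 0 := by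
    rw [zmultiplesHom_apply, natCast_zsmul, he]
  have hf' : zmultiplesHom M f (4 : ℕ) = 0 := by
    rw [zmultiplesHom_apply, natCast_zsmul, hf]
  have h2 : ZMod.lift 2 ⟨zmultiplesHom M e, he'⟩ 1 = e := by
    have := ZMod.lift_coe 2 ⟨zmultiplesHom M e, he'⟩ 1
    simpa using this
  have h4 : ZMod.lift 4 ⟨zmultiplesHom M f, hf'⟩ 1 = f := by
    have := ZMod.lift_coe 4 ⟨zmultiplesHom M f, hf'⟩ 1
    simpa using this
  exact ⟨(ZMod.lift 2 ⟨zmultiplesHom M e, he'⟩).coprod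
    ((ZMod.lift 4 ⟨zmultiplesHom M f, hf'⟩).coprod
      ((zmultiplesHom M x).coprod (zmultiplesHom M c))), by simp [h2], by simp [h4],
    by simp, by simp⟩

lemma eq_top_of_generators {R : AddSubgroup (ZMod 2 × ZMod 4 × ℤ × ℤ)} (he : (1, 0, 0, 0) ∈ R)
    (hf : (0, 1, 0, 0) ∈ R) (hx : (0, 0, 1, 0) ∈ R) (hc : (0, 0, 0, 1) ∈ R) : R = ⊤ := by
  refine (AddSubgroup.eq_top_iff' R).2 ?_
  rintro ⟨u, v, i, j⟩
  obtain ⟨k, rfl⟩ := ZMod.intCast_surjective u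
  obtain ⟨l, rfl⟩ := ZMod.intCast_surjective v
  have : (((k : ZMod 2), (l : ZMod 4), i, j) : ZMod 2 × ZMod 4 × ℤ × ℤ) =
      k • (1, 0, 0, 0) + l • (0, 1, 0, 0) + i • (0, 0, 1, 0) + j • (0, 0, 0, 1) := by
    simp
  rw [this]
  exact R.add_mem (R.add_mem (R.add_mem (R.zsmul_mem he k) (R.zsmul_mem hf l))
    (R.zsmul_mem hx i)) (R.zsmul_mem hc j)

namespace IsStandard

variable {G M : Type*} [Group G] [AddCommGroup M] {a : ℕ → G} {σ : G →* Equiv.Perm ℕ}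
  {φ : G → ℕ → ℕ → M} {x y c w : M}

lemma climb_val (h : IsStandard n a σ φ x y c w) {m : ℕ} (hm : 1 + m < n) :
    φ (climb a 1 m) 0 1 = 0 := by
  induction m with
  | zero => exact h.one (by omega) (by omega) (by omega)
  | succ m ih =>
    rw [climb, h.mul _ _ _ _ (by omega) (by omega) (by omega), ih (by omega), add_zero,
      climb_apply_self h.perm (by omega), climb_apply_of_ne h.perm (by omega) (by omega),
      h.gen _ (by omega) _ _ (by omega) (by omega) (by omega), pairVal, if_pos (Or.inr rfl),
      IsForward.nxt_of_lt (by omega), if_neg (by omega), wrap, if_neg (by omega)]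

/-- The parameters of a standard cocycle are values on the stabilizer of `{0, 1}`. -/
lemma exists_values (h : IsStandard n a σ φ x y c w) (hn : 4 < n) {H : Subgroup G}
    (hH : ∀ g, g ∈ H ↔ σ g 0 = 0 ∧ σ g 1 = 1 ∨ σ g 0 = 1 ∧ σ g 1 = 0) :
    (∃ g ∈ H, φ g 0 1 = x) ∧ (∃ g ∈ H, φ g 0 1 = y) ∧ (∃ g ∈ H, φ g 0 1 = c) ∧
      ∃ g ∈ H, φ g 0 1 = w := by
  have p0 : σ (a 0) = Equiv.swap 0 1 := h.perm_step (by omega)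
  have p1 : σ (a 1) = Equiv.swap 1 2 := h.perm_step (by omega)
  have p2 : σ (a 2) = Equiv.swap 2 3 := h.perm_step (by omega)
  have pl : σ (a (n - 1)) = Equiv.swap (n - 1) 0 := h.perm_last hn
  refine ⟨⟨a 2, (hH _).2 (Or.inl ?_), ?_⟩, ⟨a 0, (hH _).2 (Or.inr ?_), ?_⟩,
    ⟨a 1 * a 1, (hH _).2 (Or.inl ?_), ?_⟩,
    ⟨a (n - 1) * (a 0 * climb a 1 (n - 2)), (hH _).2 (Or.inr ?_), ?_⟩⟩
  · rw [p2]
    exact ⟨Equiv.swap_apply_of_ne_of_ne (by omega) (by omega),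
      Equiv.swap_apply_of_ne_of_ne (by omega) (by omega)⟩
  · rw [h.gen 2 (by omega) 0 1 (by omega) (by omega) (by omega),
      IsForward.nxt_of_lt (by omega), pairVal, if_neg (by omega), if_neg (by omega)]
  · rw [p0]
    exact ⟨Equiv.swap_apply_left _ _, Equiv.swap_apply_right _ _⟩
  · rw [h.gen 0 (by omega) 0 1 (by omega) (by omega) (by omega),
      IsForward.nxt_of_lt (by omega), pairVal, if_pos (by omega), if_pos (by omega)]
  · rw [map_mul, p1, Equiv.swap_mul_self]
    exact ⟨rfl, rfl⟩
  · rw [h.mul _ _ _ _ (by omega) (by omega) (by omega), p1,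
      Equiv.swap_apply_of_ne_of_ne (by omega) (by omega), Equiv.swap_apply_left,
      h.gen 1 (by omega) 0 1 (by omega) (by omega) (by omega),
      h.gen 1 (by omega) 0 2 (by omega) (by omega) (by omega),
      IsForward.nxt_of_lt (by omega), pairVal, pairVal, if_neg (by omega), if_pos (by omega),
      if_pos (by omega), if_neg (by omega), wrap, if_neg (by omega), sub_zero, add_zero]
  all_goals
    have c0 : σ (climb a 1 (n - 2)) 0 = 0 := climb_apply_of_ne h.perm (by omega) (by omega)
    have c1 : σ (climb a 1 (n - 2)) 1 = n - 1 := by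
      rw [climb_apply_self h.perm (by omega)]
      omega
    have d0 : σ (a 0 * climb a 1 (n - 2)) 0 = 1 := by
      rw [map_mul, Equiv.Perm.mul_apply, c0, p0, Equiv.swap_apply_left]
    have d1 : σ (a 0 * climb a 1 (n - 2)) 1 = n - 1 := by
      rw [map_mul, Equiv.Perm.mul_apply, c1, p0,
        Equiv.swap_apply_of_ne_of_ne (by omega) (by omega)]
  · rw [map_mul, Equiv.Perm.mul_apply, Equiv.Perm.mul_apply, d0, d1, pl]
    exact ⟨Equiv.swap_apply_of_ne_of_ne (by omega) (by omega), Equiv.swap_apply_left _ _⟩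
  · rw [h.mul _ _ _ _ (by omega) (by omega) (by omega), d0, d1,
      h.mul _ _ _ _ (by omega) (by omega) (by omega), c0, c1, h.climb_val (by omega), add_zero,
      h.gen 0 (by omega) 0 (n - 1) (by omega) (by omega) (by omega),
      h.gen (n - 1) (by omega) 1 (n - 1) (by omega) (by omega) (by omega),
      IsForward.nxt_pred hn, IsForward.nxt_of_lt (by omega), pairVal, pairVal,
      if_pos (by omega), if_neg (by omega), if_pos (by omega), if_neg (by omega), wrap,
      if_pos (by omega), wrap, if_neg (by omega), add_zero]

end IsStandard

/-- The abelianization of the stabilizer of `{0, 1}`. -/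
theorem abelianization_stabilizer (hn : 4 < n) (ht1 : 1 ≤ t) (ht : t + 3 ≤ n)
    (σ : Gnt n t →* Equiv.Perm ℕ) (hlt : ∀ g p, p < n → σ g p < n)
    (hσ : ∀ i < n, σ (quotGen n t i) = Equiv.swap i (nxt n i)) {H : Subgroup (Gnt n t)}
    (hH : ∀ g, g ∈ H ↔ σ g 0 = 0 ∧ σ g 1 = 1 ∨ σ g 0 = 1 ∧ σ g 1 = 0) :
    Nonempty (Additive (Abelianization H) ≃+ ZMod 2 × ZMod 4 × ℤ × ℤ) := by
  obtain ⟨φ, hφ, hval⟩ := exists_isForward hlt hσ (fun i hi => quotGen_braid hn hi)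
    (fun i j => quotGen_comm) hH
  have hM := hφ.isStandard hn
  obtain ⟨h1, h2⟩ := hM.relations_of_quot hn ht1 ht
  set x := φ (quotGen n t 2) 0 1
  set y := φ (quotGen n t 0) 0 1
  set c := φ (quotGen n t 1) 2 0
  set w := φ (quotGen n t (n - 1)) (n - 1) 1
  set r := n - 2 - t with hr
  obtain ⟨θ, θe, θf, θx, θc⟩ := exists_addMonoidHom
    (w - (r • c + t • x + x - r • x + y)) (x + y - c) x c
    (by rw [← neg_eq_zero, ← smul_neg, ← h1]; congr 1; abel) h2
  set xA : ZMod 2 × ZMod 4 × ℤ × ℤ := (0, 0, 1, 0)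
  set cA : ZMod 2 × ZMod 4 × ℤ × ℤ := (0, 0, 0, 1)
  set eA : ZMod 2 × ZMod 4 × ℤ × ℤ := (1, 0, 0, 0) with heA
  set fA : ZMod 2 × ZMod 4 × ℤ × ℤ := (0, 1, 0, 0) with hfA
  set yA := fA + cA - xA with hyA
  set wA := eA + (r • cA + t • xA + xA - r • xA + yA) with hwA
  have he2 : 2 • eA = 0 := by rw [heA]; decide
  have hf4 : 4 • fA = 0 := by rw [hfA]; decide
  have θy : θ yA = y := by simp [hyA, θf, θc, θx]
  have θw : θ wA = w := by
    rw [hwA]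
    simp only [map_add, map_sub, map_nsmul, θe, θc, θx, θy]
    abel
  obtain ⟨ψ, hψ⟩ := exists_isStandard hn ht σ hlt hσ (x := xA) (y := yA) (c := cA) (w := wA)
    (by rw [← hr, hwA, ← neg_eq_zero, ← smul_neg, ← he2]; congr 1; abel)
    (by rw [hyA, add_sub_cancel, add_sub_cancel_right, hf4])
  let Φ : H →* Multiplicative (ZMod 2 × ZMod 4 × ℤ × ℤ) := MonoidHom.mk'
    (fun g => Multiplicative.ofAdd (ψ g 0 1)) (by
      intro g k
      rw [← ofAdd_add, Subgroup.coe_mul, hψ.mul _ _ _ _ (by omega) (by omega) (by omega)]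
      rcases (hH k).1 k.2 with ⟨k0, k1⟩ | ⟨k0, k1⟩ <;> rw [k0, k1]
      rw [hψ.symm _ (by omega : 1 < n) (by omega : 0 < n) (by omega)])
  let Ψ := MonoidHom.toAdditiveLeft (Abelianization.lift Φ)
  have hΨ : ∀ (g : Gnt n t) (hg : g ∈ H),
      Ψ (Additive.ofMul (Abelianization.of ⟨g, hg⟩)) = ψ g 0 1 := fun g hg => rfl
  have hinv : ∀ m, θ (Ψ m) = m := by
    intro m
    induction m using Additive.rec with | _ m
    induction m using QuotientGroup.induction_on with | H g
    calc θ (Ψ (Additive.ofMul (Abelianization.of g))) = θ (ψ g 0 1) := rfl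
      _ = φ g 0 1 := hψ.map hM θ θx θy θc θw g (by omega) (by omega) (by omega)
      _ = _ := hval g g.2
  have hmem : ∀ g ∈ H, ψ g 0 1 ∈ Ψ.range := fun g hg => ⟨_, hΨ g hg⟩
  have hsurj : Ψ.range = ⊤ := by
    obtain ⟨⟨g1, k1, hx⟩, ⟨g2, k2, hy⟩, ⟨g3, k3, hc⟩, ⟨g4, k4, hw⟩⟩ := hψ.exists_values hn hH
    have hx := hx ▸ hmem g1 k1
    have hy := hy ▸ hmem g2 k2
    have hc := hc ▸ hmem g3 k3
    have hw := hw ▸ hmem g4 k4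
    refine eq_top_of_generators ?_ ?_ hx hc
    · have : eA = wA - (r • cA + t • xA + xA - r • xA + yA) := by rw [hwA]; abel
      rw [← heA, this]
      exact sub_mem hw (add_mem (sub_mem (add_mem (add_mem (nsmul_mem hc _) (nsmul_mem hx _)) hx)
        (nsmul_mem hx _)) hy)
    · have : fA = yA - cA + xA := by rw [hyA]; abel
      rw [← hfA, this]
      exact add_mem (sub_mem hy hc) hx
  exact ⟨AddEquiv.ofBijective Ψ ⟨Function.LeftInverse.injective hinv,
    AddMonoidHom.range_eq_top.1 hsurj⟩⟩

end Computation
open Pointwise in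
/-- part of Proposition 4.2: for `n > 4` and `1 ≤ t ≤ n-3`, with
`G_t` the quotient of `A(Δ_n)` by the normal closure of the `t`-twisted cycle
commutator `tc_t(a_1,…,a_n)`, `σ_t : G_t → Sym(n)` induced by `a_i ↦ (i,i+1)`,
`a_n ↦ (1,n)`, and `H_t` the preimage under `σ_t` of the setwise stabiliser of
`{1, 2}` (i.e. `{0, 1}` in our `Fin n` indexing), the abelianisation of `H_t` is
`ℤ/2ℤ ⊕ ℤ/4ℤ ⊕ ℤ²`. -/
theorem abelianization_Ht (n t : ℕ) (hn : 4 < n) (ht1 : 1 ≤ t) (ht2 : t ≤ n - 3)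
    (σt : PresentedGroup (cycleRels n ∪ {tc (gen n) n t}) →* Equiv.Perm (Fin n))
    (hσt : ∀ x : Fin n, σt (PresentedGroup.of x)
      = Equiv.swap x ⟨(x.val + 1) % n, Nat.mod_lt _ (by omega)⟩) :
    Nonempty (Additive (Abelianization
      (Subgroup.comap σt (MulAction.stabilizer (Equiv.Perm (Fin n))
        ({⟨0, by omega⟩, ⟨1, by omega⟩} : Set (Fin n))))) ≃+
      (ZMod 2 × ZMod 4 × ℤ × ℤ)) := by
  have ht : t + 3 ≤ n := by omega
  set σ : Gnt n t →* Equiv.Perm ℕ :=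
    (Equiv.Perm.extendDomainHom (Fin.equivSubtype (n := n))).comp σt
  have hval : ∀ g (p : Fin n), σ g p = σt g p := fun g p =>
    Equiv.Perm.extendDomain_apply_image (σt g) Fin.equivSubtype p
  have hlt : ∀ g p, p < n → σ g p < n := by
    intro g p hp
    rw [hval g ⟨p, hp⟩]
    exact (σt g ⟨p, hp⟩).isLt
  have hσ : ∀ i < n, σ (quotGen n t i) = Equiv.swap i (nxt n i) := by
    intro i hi
    have hb : quotGen n t i = PresentedGroup.of ⟨i, hi⟩ :=
      congrArg (PresentedGroup.mk _) (freeGen_val ⟨i, hi⟩)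
    have hm : (i + 1) % n = nxt n i := by
      unfold nxt
      split_ifs with h
      · rw [h, Nat.mod_self]
      · exact Nat.mod_eq_of_lt (by omega)
    have hs : σt (quotGen n t i) =
        Equiv.swap ⟨i, hi⟩ ⟨nxt n i, hm ▸ Nat.mod_lt _ (by omega)⟩ := by
      rw [hb, hσt]
      simp only [hm]
    ext k
    by_cases hk : k < n
    · rw [hval _ ⟨k, hk⟩, hs, Equiv.swap_apply_def, Equiv.swap_apply_def]
      simp only [Fin.mk.injEq]
      split_ifs <;> rfl
    · have hn' : nxt n i < n := IsStandard.nxt_lt hn hi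
      rw [Equiv.swap_apply_of_ne_of_ne (by omega) (by omega)]
      exact Equiv.Perm.extendDomain_apply_not_subtype _ _ hk
  refine abelianization_stabilizer hn ht1 ht σ hlt hσ fun g => ?_
  have h0 := hval g ⟨0, by omega⟩
  have h1 := hval g ⟨1, by omega⟩
  simp only at h0 h1
  rw [h0, h1, Subgroup.mem_comap, MulAction.mem_stabilizer_iff, ← Set.image_smul,
    Set.image_pair, Set.pair_eq_pair_iff]
  simp only [Equiv.Perm.smul_def, Fin.ext_iff]

end ArtinPaper
end

section
/- Let k ≥ 2 and let a_1, …, a_k be elements of a group G satisfying BR(a_i, a_{i+1}) for 1 ≤ i ≤ k−1 and CM(a_i, a_j) for 1 ≤ i < j−1 ≤ k−1 (for instance, the first k standard generators of A(Δ_n) with k < n). Then, for every k with 1 < k, the identity a_1^{−1} (a_2 a_3 ⋯ a_{k−1}) a_k^2 (a_1 a_2 ⋯ a_k) = (a_2 a_3 ⋯ a_{k−1}) (a_1 a_2 ⋯ a_{k−2}) a_k a_{k−1}^2 holds in G. -/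
/- Scaffolding: braid/commuting predicates, ordered products, cycle and twisted
cycle commutators, and the Artin groups of the diagrams `Δ_n`, `Δ_{t,n}`, `D_n`
(generators numbered `1, …, n` as in the paper, realized on the index type `Fin n`). -/

namespace ArtinPaper

open scoped commutatorElement

theorem mulIcc_succ {M : Type*} [Monoid M] (y : ℕ → M) {a b : ℕ} (h : a ≤ b + 1) :
    mulIcc y a (b + 1) = mulIcc y a b * y (b + 1) := by
  have h1 : b + 1 + 1 - a = (b + 1 - a) + 1 := by omega
  have h2 : a + (b + 1 - a) = b + 1 := by omega
  simp [mulIcc, h1, h2, List.range_succ]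

theorem commute_mulIcc {M : Type*} [Monoid M] (y : ℕ → M) (x : M) {a b : ℕ}
    (h : ∀ i, a ≤ i → i ≤ b → Commute x (y i)) : Commute x (mulIcc y a b) := by
  refine Commute.list_prod_right _ _ fun z hz => ?_
  obtain ⟨i, hi, rfl⟩ := List.mem_map.1 hz
  rw [List.mem_range] at hi
  exact h _ (by omega) (by omega)

/-- The product `a₁ ⋯ a_{m+1}` shifts `a₁ ⋯ a_m` to `a₂ ⋯ a_{m+1}`. -/
theorem mulIcc_two_mul_mulIcc_one {G : Type*} [Group G] (a : ℕ → G) (m : ℕ)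
    (hbr : ∀ i, 1 ≤ i → i < m + 1 → BR (a i) (a (i + 1)))
    (hcm : ∀ i j, 1 ≤ i → i + 1 < j → j ≤ m + 1 → CM (a i) (a j)) :
    mulIcc a 2 (m + 1) * mulIcc a 1 (m + 1) = mulIcc a 1 (m + 1) * mulIcc a 1 m := by
  induction m with
  | zero => simp [mulIcc]
  | succ m ih =>
    have ih' := ih (fun i h1 h2 => hbr i h1 (by omega))
      (fun i j h1 h2 h3 => hcm i j h1 h2 (by omega))
    have hb : a (m + 1) * a (m + 2) * a (m + 1) = a (m + 2) * a (m + 1) * a (m + 2) :=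
      hbr (m + 1) (by omega) (by omega)
    have hc : a (m + 2) * mulIcc a 1 m = mulIcc a 1 m * a (m + 2) :=
      commute_mulIcc a _ fun i h1 h2 => (hcm i (m + 2) h1 (by omega) le_rfl).symm
    have e1 : mulIcc a 1 (m + 1) = mulIcc a 1 m * a (m + 1) := mulIcc_succ a (by omega)
    have e2 : mulIcc a 1 (m + 2) = mulIcc a 1 (m + 1) * a (m + 2) := mulIcc_succ a (by omega)
    have e3 : mulIcc a 2 (m + 2) = mulIcc a 2 (m + 1) * a (m + 2) := mulIcc_succ a (by omega)
    calc mulIcc a 2 (m + 2) * mulIcc a 1 (m + 2)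
        = mulIcc a 2 (m + 1) * (a (m + 2) * mulIcc a 1 m) * a (m + 1) * a (m + 2) := by
          rw [e3, e2, e1]; group
      _ = mulIcc a 2 (m + 1) * mulIcc a 1 m * (a (m + 2) * a (m + 1) * a (m + 2)) := by
          rw [hc]; group
      _ = mulIcc a 2 (m + 1) * mulIcc a 1 (m + 1) * (a (m + 2) * a (m + 1)) := by
          rw [← hb, e1]; group
      _ = mulIcc a 1 (m + 1) * (mulIcc a 1 m * a (m + 2)) * a (m + 1) := by
          rw [ih']; group
      _ = mulIcc a 1 (m + 2) * mulIcc a 1 (m + 1) := by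
          rw [← hc, e2, e1]; group

/-- Lemma 4.4: if `a 1, …, a k` (`k ≥ 2`) satisfy the braid
relations of consecutive generators and distant generators commute, then
`a₁⁻¹ (a₂ ⋯ a_{k-1}) a_k² (a₁ ⋯ a_k) = (a₂ ⋯ a_{k-1}) (a₁ ⋯ a_{k-2}) a_k a_{k-1}²`. -/
theorem hardcase {G : Type*} [Group G] (k : ℕ) (hk : 2 ≤ k) (a : ℕ → G)
    (hbr : ∀ i, 1 ≤ i → i < k → BR (a i) (a (i + 1)))
    (hcm : ∀ i j, 1 ≤ i → i + 1 < j → j ≤ k → CM (a i) (a j)) :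
    (a 1)⁻¹ * mulIcc a 2 (k - 1) * (a k) ^ 2 * mulIcc a 1 k
      = mulIcc a 2 (k - 1) * mulIcc a 1 (k - 2) * a k * (a (k - 1)) ^ 2 := by
  obtain ⟨m, rfl⟩ : ∃ m, k = m + 2 := ⟨k - 2, by omega⟩
  change (a 1)⁻¹ * mulIcc a 2 (m + 1) * a (m + 2) ^ 2 * mulIcc a 1 (m + 2)
    = mulIcc a 2 (m + 1) * mulIcc a 1 m * a (m + 2) * a (m + 1) ^ 2
  have hb : a (m + 1) * a (m + 2) * a (m + 1) = a (m + 2) * a (m + 1) * a (m + 2) :=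
    hbr (m + 1) (by omega) (by omega)
  have hc : a (m + 2) ^ 2 * mulIcc a 1 m = mulIcc a 1 m * a (m + 2) ^ 2 :=
    (commute_mulIcc a _ fun i h1 h2 =>
      (hcm i (m + 2) h1 (by omega) le_rfl).symm : Commute (a (m + 2)) _).pow_left 2
  have e1 : mulIcc a 1 (m + 1) = mulIcc a 1 m * a (m + 1) := mulIcc_succ a (by omega)
  have e2 : mulIcc a 1 (m + 2) = mulIcc a 1 (m + 1) * a (m + 2) := mulIcc_succ a (by omega)
  have shift := mulIcc_two_mul_mulIcc_one a m (fun i h1 h2 => hbr i h1 (by omega))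
    (fun i j h1 h2 h3 => hcm i j h1 h2 (by omega))
  have head : mulIcc a 1 (m + 1) = a 1 * mulIcc a 2 (m + 1) := by
    simp [mulIcc, List.range_succ_eq_map, Function.comp_def, add_comm, add_left_comm]
  calc (a 1)⁻¹ * mulIcc a 2 (m + 1) * a (m + 2) ^ 2 * mulIcc a 1 (m + 2)
      = (a 1)⁻¹ * mulIcc a 2 (m + 1) * (a (m + 2) ^ 2 * mulIcc a 1 m)
          * a (m + 1) * a (m + 2) := by
        rw [e2, e1]; group
    _ = (a 1)⁻¹ * mulIcc a 2 (m + 1) * mulIcc a 1 m * a (m + 2)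
          * (a (m + 2) * a (m + 1) * a (m + 2)) := by
        rw [hc, pow_two]; group
    _ = (a 1)⁻¹ * mulIcc a 2 (m + 1) * mulIcc a 1 m
          * (a (m + 2) * a (m + 1) * a (m + 2)) * a (m + 1) := by
        nth_rewrite 1 [← hb]; group
    _ = (a 1)⁻¹ * (mulIcc a 2 (m + 1) * mulIcc a 1 (m + 1)) * a (m + 2) * a (m + 1) ^ 2 := by
        rw [← hb, e1, pow_two]; group
    _ = mulIcc a 2 (m + 1) * mulIcc a 1 m * a (m + 2) * a (m + 1) ^ 2 := by
        rw [shift, head]; group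

end ArtinPaper
end
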